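/- Let n ≥ 1 and N > n be integers, let V ⊆ ℝ^n be an n-dimensional simplex all of whose vertices lie in ℚ^n, and let g₁,…,g_N : ℝ^n → ℝ be affine (degree ≤ 1) polynomials with rational coefficients satisfying 0 ≤ g_i(x) ≤ 1 for all x ∈ V and all i, and such that at every vertex p of V at least one g_i satisfies g_i(p) ≠ 0. Let T = ({ g_i(p) : 1 ≤ i ≤ N, p a vertex of V } ∪ {1}) ∖ {0} ⊆ (0,1], and let m be a positive integer. Then there exists F : ℂ → ℂ, meromorphic on all of ℂ, with F(s) = ∫_V ζ(1−s, g₁(x)) ⋯ ζ(1−s, g_N(x)) dx for every s with Re(s) > 1, such that the limit lim_{s→−m} (s+m)^n · F(s) exists and lies in the ℚ-linear span of the set of complex numbers { ζ(w₁,t₁)·ζ(w₂,t₂)⋯ζ(w_l,t_l) : 1 ≤ l ≤ N−n, each w_j an integer with w_j ≥ m+1, w₁+⋯+w_l = (m+1)N − n, each t_j ∈ T }, where for an integer w ≥ 2 and real t > 0, ζ(w,t) := Σ_{k=0}^∞ (k+t)^{−w}. -/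

import Mathlib

open Complex MeasureTheory HurwitzZeta Filter

open scoped Topology in
theorem differentiableOn_integral_of_locally_bounded {α : Type*} [MeasurableSpace α]
    {μ : Measure α} [IsFiniteMeasure μ] {U : Set ℂ} (hU : IsOpen U) {F : ℂ → α → ℂ}
    (hmeas : ∀ s ∈ U, AEStronglyMeasurable (F s) μ)
    (hdiff : ∀ᵐ x ∂μ, DifferentiableOn ℂ (fun s => F s x) U)
    (hbdd : ∀ s₀ ∈ U, ∃ C : ℝ, ∃ V ∈ 𝓝 s₀, ∀ᵐ x ∂μ, ∀ s ∈ V, ‖F s x‖ ≤ C) :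
    DifferentiableOn ℂ (fun s => ∫ x, F s x ∂μ) U := by
  intro s₀ hs₀
  apply DifferentiableAt.differentiableWithinAt
  obtain ⟨C, V, hV, hC⟩ := hbdd s₀ hs₀
  obtain ⟨r, hr, hrV⟩ := Metric.mem_nhds_iff.1 (Filter.inter_mem hV (hU.mem_nhds hs₀))
  have hr2 : 0 < r / 2 := by positivity
  have hball : Metric.ball s₀ (r / 2) ∈ 𝓝 s₀ := Metric.ball_mem_nhds _ hr2
  have hderiv : ∀ᵐ x ∂μ, ∀ s ∈ Metric.ball s₀ (r / 2),
      HasDerivAt (fun s => F s x) (deriv (fun s => F s x) s) s ∧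
        ‖deriv (fun s => F s x) s‖ ≤ C / (r / 2) := by
    filter_upwards [hdiff, hC] with x hx hCx s hs
    have hsub : Metric.closedBall s (r / 2) ⊆ V ∩ U := by
      refine subset_trans (fun y hy => ?_) hrV
      rw [Metric.mem_ball] at hs ⊢
      rw [Metric.mem_closedBall] at hy
      linarith [dist_triangle y s s₀]
    have hsU : s ∈ U := (hsub (Metric.mem_closedBall_self hr2.le)).2
    refine ⟨(hx.differentiableAt (hU.mem_nhds hsU)).hasDerivAt, ?_⟩
    apply Complex.norm_deriv_le_of_forall_mem_sphere_norm_le hr2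
    · apply DifferentiableOn.diffContOnCl
      rw [closure_ball _ hr2.ne']
      exact hx.mono fun y hy => (hsub hy).2
    · intro z hz
      exact hCx z (hsub (Metric.sphere_subset_closedBall hz)).1
  refine (hasDerivAt_integral_of_dominated_loc_of_deriv_le (μ := μ)
    (F := F) (F' := fun s x => deriv (fun s => F s x) s) (bound := fun _ => C / (r / 2))
    hball ?_ ?_ ?_ ?_ ?_ ?_).2.differentiableAt
  · filter_upwards [hU.mem_nhds hs₀] with s hs using hmeas s hs
  · refine Integrable.of_bound (hmeas s₀ hs₀) C ?_
    filter_upwards [hC] with x hx using hx s₀ (mem_of_mem_nhds hV)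
  · have hu : Tendsto (fun k : ℕ => s₀ + ((r / 2 / (k + 2) : ℝ) : ℂ)) atTop (𝓝[≠] s₀) := by
      rw [tendsto_nhdsWithin_iff]
      constructor
      · have h1 : Tendsto (fun k : ℕ => (r / 2 / (k + 2) : ℝ)) atTop (𝓝 0) := by
          apply Tendsto.div_atTop tendsto_const_nhds
          exact tendsto_atTop_add_const_right _ _ tendsto_natCast_atTop_atTop
        have h2 := (Complex.continuous_ofReal.tendsto 0).comp h1
        simpa using h2.const_add s₀
      · refine Eventually.of_forall fun k => ?_
        have : (r / 2 / (k + 2) : ℝ) ≠ 0 := by positivity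
        simpa [-Complex.ofReal_div] using this
    have hmem : ∀ k : ℕ, s₀ + ((r / 2 / (k + 2) : ℝ) : ℂ) ∈ U := by
      intro k
      refine (hrV ?_).2
      rw [Metric.mem_ball, dist_eq_norm]
      simp only [add_sub_cancel_left, Complex.norm_real, Real.norm_eq_abs]
      rw [abs_of_pos (by positivity), div_lt_iff₀ (by positivity)]
      nlinarith [(Nat.cast_nonneg k : (0 : ℝ) ≤ k)]
    refine aestronglyMeasurable_of_tendsto_ae atTop
      (f := fun (k : ℕ) x => slope (fun s => F s x) s₀ (s₀ + ((r / 2 / (k + 2) : ℝ) : ℂ))) ?_ ?_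
    · intro k
      simp only [slope_def_field, div_eq_mul_inv]
      exact ((hmeas _ (hmem k)).sub (hmeas _ hs₀)).mul aestronglyMeasurable_const
    · filter_upwards [hderiv] with x hx
      exact ((hasDerivAt_iff_tendsto_slope.1 (hx s₀ (Metric.mem_ball_self hr2)).1)).comp hu
  · filter_upwards [hderiv] with x hx s hs using (hx s hs).2
  · exact integrable_const _
  · filter_upwards [hderiv] with x hx s hs using (hx s hs).1

theorem continuousOn_parametric_integral {X : Type*} [TopologicalSpace X]
    [FirstCountableTopology X] {U : Set X} {F : X → ℝ → ℂ}
    (hF : ContinuousOn (Function.uncurry F) (U ×ˢ Set.Icc (0 : ℝ) 1)) :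
    ContinuousOn (fun x => ∫ η in (0 : ℝ)..1, F x η) U := by
  rw [continuousOn_iff_continuous_domRestrict]
  have h1 : Continuous (Function.uncurry
      (fun (x : U) (η : ℝ) => F x (Set.projIcc (0 : ℝ) 1 zero_le_one η))) := by
    have h2 : Continuous (fun p : U × ℝ =>
      (((p.1 : X), ((Set.projIcc (0 : ℝ) 1 zero_le_one p.2 : Set.Icc (0 : ℝ) 1) : ℝ)) : X × ℝ)) := by
      fun_prop
    exact hF.comp_continuous h2 fun p => ⟨p.1.2, (Set.projIcc (0 : ℝ) 1 zero_le_one p.2).2⟩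
  have h3 := intervalIntegral.continuous_parametric_intervalIntegral_of_continuous' (μ := volume)
    h1 0 1
  convert h3 using 2 with x
  apply intervalIntegral.integral_congr
  intro η hη
  rw [Set.uIcc_of_le zero_le_one] at hη
  simp only [Set.projIcc_of_mem zero_le_one hη]

open scoped Topology in
theorem differentiableOn_parametric_integral {U : Set ℂ} (hU : IsOpen U) {F : ℂ → ℝ → ℂ}
    (hF : ContinuousOn (Function.uncurry F) (U ×ˢ Set.Icc (0 : ℝ) 1))
    (hd : ∀ η ∈ Set.Icc (0 : ℝ) 1, DifferentiableOn ℂ (fun s => F s η) U) :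
    DifferentiableOn ℂ (fun s => ∫ η in (0 : ℝ)..1, F s η) U := by
  simp only [intervalIntegral.integral_of_le zero_le_one, ← integral_Icc_eq_integral_Ioc]
  refine differentiableOn_integral_of_locally_bounded hU ?_ ?_ ?_
  · intro s hs
    refine ContinuousOn.aestronglyMeasurable ?_ measurableSet_Icc
    exact hF.comp (f := fun η : ℝ => (s, η)) (by fun_prop) fun η hη => ⟨hs, hη⟩
  · exact (ae_restrict_iff' measurableSet_Icc).2 (Eventually.of_forall fun η hη => hd η hη)
  · intro s₀ hs₀
    obtain ⟨r, hr, hrU⟩ := Metric.nhds_basis_closedBall.mem_iff.1 (hU.mem_nhds hs₀)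
    obtain ⟨C, hC⟩ := ((isCompact_closedBall s₀ r).prod (isCompact_Icc (a := (0 : ℝ))
      (b := 1))).exists_bound_of_continuousOn (hF.mono (Set.prod_mono hrU subset_rfl))
    refine ⟨C, _, Metric.closedBall_mem_nhds s₀ hr, ?_⟩
    refine (ae_restrict_iff' measurableSet_Icc).2 (Eventually.of_forall fun η hη s hs => ?_)
    exact hC (s, η) ⟨hs, hη⟩

open scoped Topology in
theorem hasDerivAt_parametric_integral {U : Set ℝ} (hU : IsOpen U) {F F' : ℝ → ℝ → ℂ}
    (hF : ContinuousOn (Function.uncurry F) (U ×ˢ Set.Icc (0 : ℝ) 1))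
    (hF' : ContinuousOn (Function.uncurry F') (U ×ˢ Set.Icc (0 : ℝ) 1))
    (hd : ∀ x ∈ U, ∀ η ∈ Set.Icc (0 : ℝ) 1, HasDerivAt (fun x => F x η) (F' x η) x)
    {x₀ : ℝ} (hx₀ : x₀ ∈ U) :
    HasDerivAt (fun x => ∫ η in (0 : ℝ)..1, F x η) (∫ η in (0 : ℝ)..1, F' x₀ η) x₀ := by
  simp only [intervalIntegral.integral_of_le zero_le_one, ← integral_Icc_eq_integral_Ioc]
  obtain ⟨r, hr, hrU⟩ := Metric.nhds_basis_closedBall.mem_iff.1 (hU.mem_nhds hx₀)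
  obtain ⟨C, hC⟩ := ((isCompact_closedBall x₀ r).prod (isCompact_Icc (a := (0 : ℝ))
      (b := 1))).exists_bound_of_continuousOn (hF'.mono (Set.prod_mono hrU subset_rfl))
  have hc : ∀ x ∈ U, ContinuousOn (F x) (Set.Icc 0 1) := fun x hx =>
    hF.comp (f := fun η : ℝ => (x, η)) (by fun_prop) fun η hη => ⟨hx, hη⟩
  have hc' : ∀ x ∈ U, ContinuousOn (F' x) (Set.Icc 0 1) := fun x hx =>
    hF'.comp (f := fun η : ℝ => (x, η)) (by fun_prop) fun η hη => ⟨hx, hη⟩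
  refine (hasDerivAt_integral_of_dominated_loc_of_deriv_le (F := F) (F' := F')
    (bound := fun _ => C) (Metric.closedBall_mem_nhds x₀ hr) ?_ ?_ ?_ ?_ ?_ ?_).2
  · filter_upwards [hU.mem_nhds hx₀] with x hx
    exact (hc x hx).aestronglyMeasurable measurableSet_Icc
  · exact (hc x₀ hx₀).integrableOn_Icc
  · exact (hc' x₀ hx₀).aestronglyMeasurable measurableSet_Icc
  · exact (ae_restrict_iff' measurableSet_Icc).2
      (Eventually.of_forall fun η hη x hx => hC (x, η) ⟨hx, hη⟩)
  · exact integrable_const _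
  · exact (ae_restrict_iff' measurableSet_Icc).2
      (Eventually.of_forall fun η hη x hx => hd x (hrU hx) η hη)

/-- The partial derivative in the `i`-th real variable. -/
noncomputable def partialDeriv {n : ℕ} (i : Fin n) (f : (Fin n → ℝ) → ℂ → ℂ) :
    (Fin n → ℝ) → ℂ → ℂ :=
  fun t s => deriv (fun x : ℝ => f (Function.update t i x) s) (t i)

/-- `f t s` is jointly continuous and entire in `s`, as are its iterated partial derivatives in `t`
up to order `K`. -/
def SmoothHol {n : ℕ} : ℕ → ((Fin n → ℝ) → ℂ → ℂ) → Prop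
  | 0, f => Continuous (Function.uncurry f) ∧ ∀ t, Differentiable ℂ (f t)
  | K + 1, f => (Continuous (Function.uncurry f) ∧ ∀ t, Differentiable ℂ (f t)) ∧ ∀ i,
      (∀ t s, DifferentiableAt ℝ (fun x : ℝ => f (Function.update t i x) s) (t i)) ∧
        SmoothHol K (partialDeriv i f)

namespace SmoothHol

variable {n : ℕ} {K : ℕ} {f g : (Fin n → ℝ) → ℂ → ℂ}

theorem zero_of (h : SmoothHol K f) : SmoothHol 0 f := by
  cases K with
  | zero => exact h
  | succ K => exact h.1

theorem cont (h : SmoothHol K f) : Continuous (Function.uncurry f) := h.zero_of.1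

theorem entire (h : SmoothHol K f) (t : Fin n → ℝ) : Differentiable ℂ (f t) := h.zero_of.2 t

theorem hasDerivAt (h : SmoothHol (K + 1) f) (i : Fin n) (t : Fin n → ℝ) (s : ℂ) (x : ℝ) :
    HasDerivAt (fun x : ℝ => f (Function.update t i x) s)
      (partialDeriv i f (Function.update t i x) s) x := by
  have h1 := ((h.2 i).1 (Function.update t i x) s).hasDerivAt
  simpa [partialDeriv] using h1

theorem partialDeriv_mem (h : SmoothHol (K + 1) f) (i : Fin n) : SmoothHol K (partialDeriv i f) :=
  (h.2 i).2

theorem partialDeriv_eq {i : Fin n}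
    (hd : ∀ t s, HasDerivAt (fun x : ℝ => f (Function.update t i x) s) (g t s) (t i)) :
    partialDeriv i f = g := by
  funext t s
  exact (hd t s).deriv

theorem succ_of (h0 : SmoothHol 0 f) (g : Fin n → (Fin n → ℝ) → ℂ → ℂ)
    (hd : ∀ i t s, HasDerivAt (fun x : ℝ => f (Function.update t i x) s) (g i t s) (t i))
    (hg : ∀ i, SmoothHol K (g i)) : SmoothHol (K + 1) f := by
  refine ⟨h0, fun i => ⟨fun t s => (hd i t s).differentiableAt, ?_⟩⟩
  rw [partialDeriv_eq (hd i)]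
  exact hg i

theorem of_succ (h : SmoothHol (K + 1) f) : SmoothHol K f := by
  induction K generalizing f with
  | zero => exact h.1
  | succ K ih => exact ⟨h.1, fun i => ⟨(h.2 i).1, ih (h.2 i).2⟩⟩

theorem hasDerivAt_self (h : SmoothHol (K + 1) f) (i : Fin n) (t : Fin n → ℝ) (s : ℂ) :
    HasDerivAt (fun x : ℝ => f (Function.update t i x) s) (partialDeriv i f t s) (t i) := by
  simpa using h.hasDerivAt i t s (t i)

theorem const {c : ℂ → ℂ} (hc : Differentiable ℂ c) :
    SmoothHol K (fun (_ : Fin n → ℝ) s => c s) := by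
  induction K generalizing c with
  | zero => exact ⟨hc.continuous.comp continuous_snd, fun _ => hc⟩
  | succ K ih =>
    refine succ_of ⟨hc.continuous.comp continuous_snd, fun _ => hc⟩ (fun _ _ _ => 0)
      (fun i t s => hasDerivAt_const _ _) (fun i => ?_)
    exact ih (differentiable_const (0 : ℂ))

theorem add (hf : SmoothHol K f) (hg : SmoothHol K g) :
    SmoothHol K (fun t s => f t s + g t s) := by
  have h0 : SmoothHol 0 (fun t s => f t s + g t s) :=
    ⟨hf.cont.add hg.cont, fun t => (hf.entire t).add (hg.entire t)⟩
  induction K generalizing f g with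
  | zero => exact h0
  | succ K ih =>
    exact succ_of h0 (fun i t s => partialDeriv i f t s + partialDeriv i g t s)
      (fun i t s => (hf.hasDerivAt_self i t s).add (hg.hasDerivAt_self i t s))
      (fun i => ih (hf.partialDeriv_mem i) (hg.partialDeriv_mem i)
        ⟨(hf.partialDeriv_mem i).cont.add (hg.partialDeriv_mem i).cont, fun t =>
          ((hf.partialDeriv_mem i).entire t).add ((hg.partialDeriv_mem i).entire t)⟩)

theorem hasDerivAt_mul (hf : SmoothHol (K + 1) f) (hg : SmoothHol (K + 1) g) (i : Fin n)
    (t : Fin n → ℝ) (s : ℂ) :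
    HasDerivAt (fun x : ℝ => f (Function.update t i x) s * g (Function.update t i x) s)
      (partialDeriv i f t s * g t s + f t s * partialDeriv i g t s) (t i) := by
  exact ((hf.hasDerivAt_self i t s).fun_mul (hg.hasDerivAt_self i t s)).congr_deriv (by simp)

theorem mul (hf : SmoothHol K f) (hg : SmoothHol K g) :
    SmoothHol K (fun t s => f t s * g t s) := by
  induction K generalizing f g with
  | zero => exact ⟨hf.cont.mul hg.cont, fun t => (hf.entire t).mul (hg.entire t)⟩
  | succ K ih =>
    exact succ_of ⟨hf.cont.mul hg.cont, fun t => (hf.entire t).mul (hg.entire t)⟩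
      (fun i t s => partialDeriv i f t s * g t s + f t s * partialDeriv i g t s)
      (hf.hasDerivAt_mul hg)
      (fun i => (ih (hf.partialDeriv_mem i) hg.of_succ).add (ih hf.of_succ (hg.partialDeriv_mem i)))

open scoped ContDiff in
theorem of_contDiff {p : (Fin n → ℝ) → ℝ} (hp : ContDiff ℝ ∞ p) :
    SmoothHol K (fun t _ => (p t : ℂ)) := by
  induction K generalizing p with
  | zero =>
    exact ⟨Complex.continuous_ofReal.comp (hp.continuous.comp continuous_fst),
      fun t => differentiable_const _⟩
  | succ K ih =>
    refine succ_of ⟨Complex.continuous_ofReal.comp (hp.continuous.comp continuous_fst),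
      fun t => differentiable_const _⟩ (fun i t _ => ((fderiv ℝ p t (Pi.single i 1) : ℝ) : ℂ))
      (fun i t s => ?_) (fun i => ih ?_)
    · have h1 : HasDerivAt (fun x : ℝ => p (Function.update t i x))
          (fderiv ℝ p t (Pi.single i 1)) (t i) := by
        have h2 : HasFDerivAt p (fderiv ℝ p t) (Function.update t i (t i)) := by
          simpa using ((hp.differentiable (by simp)) t).hasFDerivAt
        exact h2.comp_hasDerivAt (t i) (hasDerivAt_update t i (t i))
      exact h1.ofReal_comp
    · exact (hp.fderiv_right (m := ∞) (by simp)).clm_apply contDiff_const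

end SmoothHol

/-- A sequence of functions on `(0, ∞) × ℂ`, each the derivative in the first variable of the
preceding one, jointly continuous and entire in the second variable. -/
structure DerivFamily (h : ℕ → ℝ → ℂ → ℂ) : Prop where
  cont : ∀ k, ContinuousOn (Function.uncurry (h k)) (Set.Ioi 0 ×ˢ Set.univ)
  entire : ∀ k, ∀ a > 0, Differentiable ℂ (h k a)
  deriv : ∀ k, ∀ a > 0, ∀ s, HasDerivAt (fun a => h k a s) (h (k + 1) a s) a

theorem DerivFamily.hasDerivAt_comp {n : ℕ} {h : ℕ → ℝ → ℂ → ℂ} (hh : DerivFamily h)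
    {p : (Fin n → ℝ) → ℝ} (hp0 : ∀ t, 0 < p t)
    (hp : SmoothHol 1 (fun t (_ : ℂ) => (p t : ℂ)))
    (k : ℕ) (i : Fin n) (t : Fin n → ℝ) (s : ℂ) :
    HasDerivAt (fun x : ℝ => h k (p (Function.update t i x)) s)
      (h (k + 1) (p t) s * partialDeriv i (fun t (_ : ℂ) => (p t : ℂ)) t s) (t i) := by
  have h1 := hp.hasDerivAt_self i t s
  have h2 : HasDerivAt (fun x : ℝ => p (Function.update t i x))
      (partialDeriv i (fun t (_ : ℂ) => (p t : ℂ)) t s).re (t i) := by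
    have h3 := Complex.reCLM.hasFDerivAt.comp_hasDerivAt (t i) h1
    simpa [Function.comp_def] using h3
  have h4 : partialDeriv i (fun t (_ : ℂ) => (p t : ℂ)) t s =
      ((partialDeriv i (fun t (_ : ℂ) => (p t : ℂ)) t s).re : ℂ) :=
    h1.unique h2.ofReal_comp
  rw [h4]
  have h5 := hh.deriv k (p (Function.update t i (t i))) (hp0 _) s
  have h6 := HasDerivAt.scomp (t i) h5 h2
  simpa [Function.comp_def, mul_comm] using h6

open scoped ContDiff in
theorem DerivFamily.comp {n : ℕ} {h : ℕ → ℝ → ℂ → ℂ} (hh : DerivFamily h)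
    {p : (Fin n → ℝ) → ℝ} (hp0 : ∀ t, 0 < p t) (hp : ContDiff ℝ ∞ p) (K k : ℕ) :
    SmoothHol K (fun t s => h k (p t) s) := by
  have h0 : ∀ k, SmoothHol 0 (fun t s => h k (p t) s) := fun k =>
    ⟨(hh.cont k).comp_continuous (f := fun q : (Fin n → ℝ) × ℂ => (p q.1, q.2))
      ((hp.continuous.comp continuous_fst).prodMk continuous_snd)
      fun q => ⟨hp0 _, Set.mem_univ _⟩, fun t => hh.entire k _ (hp0 t)⟩
  induction K generalizing k with
  | zero => exact h0 k
  | succ K ih =>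
    refine SmoothHol.succ_of (h0 k) (fun i t s =>
      h (k + 1) (p t) s * partialDeriv i (fun t (_ : ℂ) => (p t : ℂ)) t s)
      (hh.hasDerivAt_comp hp0 (SmoothHol.of_contDiff hp) k) fun i => ?_
    exact (ih (k + 1)).mul ((SmoothHol.of_contDiff (K := K + 1) hp).partialDeriv_mem i)

/-- Setting the `i`-th variable to zero. -/
def faceRestrict {n : ℕ} (i : Fin n) (f : (Fin n → ℝ) → ℂ → ℂ) : (Fin n → ℝ) → ℂ → ℂ :=
  fun t s => f (Function.update t i 0) s

/-- The weighted average of `f` over the segment in direction `i` from the face `t i = 0`. -/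
noncomputable def segmentAverage {n : ℕ} (i : Fin n) (a : ℕ) (f : (Fin n → ℝ) → ℂ → ℂ) :
    (Fin n → ℝ) → ℂ → ℂ :=
  fun t s => ∫ θ in (0 : ℝ)..1, (θ : ℂ) ^ a * f (Function.update t i (θ * t i)) s

namespace SmoothHol

variable {n : ℕ} {K : ℕ} {f g : (Fin n → ℝ) → ℂ → ℂ}

theorem faceRestrict_hasDerivAt_of_ne (hf : SmoothHol (K + 1) f) {i j : Fin n} (hij : j ≠ i)
    (t : Fin n → ℝ) (s : ℂ) :
    HasDerivAt (fun x : ℝ => faceRestrict i f (Function.update t j x) s)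
      (faceRestrict i (partialDeriv j f) t s) (t j) := by
  have := hf.hasDerivAt j (Function.update t i 0) s (t j)
  simp only [faceRestrict]
  have h2 : Function.update (Function.update t i 0) j (t j) = Function.update t i 0 := by
    rw [Function.update_comm hij.symm, Function.update_eq_self]
  rw [h2] at this
  refine this.congr_of_eventuallyEq (Eventually.of_forall fun x => ?_)
  simp only [Function.update_comm hij]

theorem faceRestrict_hasDerivAt_self (i : Fin n) (f : (Fin n → ℝ) → ℂ → ℂ)
    (t : Fin n → ℝ) (s : ℂ) :
    HasDerivAt (fun x : ℝ => faceRestrict i f (Function.update t i x) s) 0 (t i) := by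
  simp only [faceRestrict, Function.update_idem]
  exact hasDerivAt_const _ _

theorem faceRestrict_mem (hf : SmoothHol K f) (i : Fin n) : SmoothHol K (faceRestrict i f) := by
  have h0 : SmoothHol 0 (faceRestrict i f) :=
    ⟨hf.cont.comp ((continuous_fst.update i continuous_const).prodMk continuous_snd),
      fun t => hf.entire _⟩
  induction K generalizing f with
  | zero => exact h0
  | succ K ih =>
    refine succ_of h0 (fun j => if j = i then fun _ _ => 0 else faceRestrict i (partialDeriv j f))
      (fun j t s => ?_) (fun j => ?_)
    · split_ifs with hj
      · subst hj
        exact faceRestrict_hasDerivAt_self j f t s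
      · exact hf.faceRestrict_hasDerivAt_of_ne hj t s
    · split_ifs with hj
      · exact const (differentiable_const 0)
      · have h1 := hf.partialDeriv_mem j
        exact ih h1 ⟨h1.cont.comp ((continuous_fst.update i continuous_const).prodMk
          continuous_snd), fun t => h1.entire _⟩

theorem segmentAverage_zero (hf : SmoothHol K f) (i : Fin n) (a : ℕ) :
    SmoothHol 0 (segmentAverage i a f) := by
  constructor
  · have h1 : Continuous (Function.uncurry (fun (q : (Fin n → ℝ) × ℂ) (θ : ℝ) =>
        (θ : ℂ) ^ a * f (Function.update q.1 i (θ * q.1 i)) q.2)) := by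
      refine Continuous.mul (by fun_prop) ?_
      exact hf.cont.comp (f := fun r : ((Fin n → ℝ) × ℂ) × ℝ =>
        (Function.update r.1.1 i (r.2 * r.1.1 i), r.1.2)) (by fun_prop)
    exact intervalIntegral.continuous_parametric_intervalIntegral_of_continuous' (μ := volume)
      h1 0 1
  · intro t
    rw [← differentiableOn_univ]
    refine differentiableOn_parametric_integral isOpen_univ ?_ ?_
    · refine Continuous.continuousOn (Continuous.mul (by fun_prop) ?_)
      exact hf.cont.comp (f := fun r : ℂ × ℝ =>
        (Function.update t i (r.2 * t i), r.1)) (by fun_prop)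
    · intro θ _
      exact ((hf.entire _).const_mul _).differentiableOn

theorem segmentAverage_hasDerivAt (hf : SmoothHol (K + 1) f) (i j : Fin n) (a : ℕ)
    (t : Fin n → ℝ) (s : ℂ) :
    HasDerivAt (fun x : ℝ => segmentAverage i a f (Function.update t j x) s)
      (segmentAverage i (a + if j = i then 1 else 0) (partialDeriv j f) t s) (t j) := by
  have hf' := hf.partialDeriv_mem j
  by_cases hj : j = i
  · subst hj
    simp only [segmentAverage, Function.update_idem, Function.update_self, if_true]
    refine hasDerivAt_parametric_integral isOpen_univ
      (F' := fun x θ => (θ : ℂ) ^ (a + 1) * partialDeriv j f (Function.update t j (θ * x)) s)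
      ?_ ?_ ?_ (Set.mem_univ _)
    · refine Continuous.continuousOn (Continuous.mul (by fun_prop) ?_)
      exact hf.cont.comp (f := fun r : ℝ × ℝ =>
        (Function.update t j (r.2 * r.1), s)) (by fun_prop)
    · refine Continuous.continuousOn (Continuous.mul (by fun_prop) ?_)
      exact hf'.cont.comp (f := fun r : ℝ × ℝ =>
        (Function.update t j (r.2 * r.1), s)) (by fun_prop)
    · intro x _ θ _
      have h1 := hf.hasDerivAt j t s (θ * x)
      have h2 : HasDerivAt (fun x : ℝ => θ * x) θ x := by
        simpa using (hasDerivAt_id x).const_mul θ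
      have h3 := (HasDerivAt.scomp x h1 h2).const_mul ((θ : ℂ) ^ a)
      refine h3.congr_deriv ?_
      rw [pow_succ, Complex.real_smul]
      ring
  · simp only [segmentAverage, if_neg hj, Function.update_of_ne (Ne.symm hj), add_zero,
      Function.update_comm hj]
    refine (hasDerivAt_parametric_integral isOpen_univ
      (F' := fun x θ => (θ : ℂ) ^ a *
        partialDeriv j f (Function.update (Function.update t i (θ * t i)) j x) s)
      ?_ ?_ ?_ (Set.mem_univ _)).congr_deriv ?_
    · refine Continuous.continuousOn (Continuous.mul (by fun_prop) ?_)
      exact hf.cont.comp (f := fun r : ℝ × ℝ =>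
        (Function.update (Function.update t i (r.2 * t i)) j r.1, s)) (by fun_prop)
    · refine Continuous.continuousOn (Continuous.mul (by fun_prop) ?_)
      exact hf'.cont.comp (f := fun r : ℝ × ℝ =>
        (Function.update (Function.update t i (r.2 * t i)) j r.1, s)) (by fun_prop)
    · intro x _ θ _
      exact (hf.hasDerivAt j _ s x).const_mul _
    · simp only [Function.update_comm (Ne.symm hj), Function.update_eq_self]

theorem segmentAverage_mem (hf : SmoothHol K f) (i : Fin n) (a : ℕ) :
    SmoothHol K (segmentAverage i a f) := by
  induction K generalizing f a with
  | zero => exact hf.segmentAverage_zero i a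
  | succ K ih =>
    exact succ_of (hf.segmentAverage_zero i a) _
      (fun j t s => hf.segmentAverage_hasDerivAt i j a t s)
      (fun j => ih (hf.partialDeriv_mem j) _)

theorem partialDeriv_segmentAverage (hf : SmoothHol (K + 1) f) (i : Fin n) (a : ℕ) :
    partialDeriv i (segmentAverage i a f) = segmentAverage i (a + 1) (partialDeriv i f) := by
  apply partialDeriv_eq
  simpa using hf.segmentAverage_hasDerivAt i i a

theorem partialDeriv_faceRestrict_of_ne (hf : SmoothHol (K + 1) f) {i j : Fin n} (hij : j ≠ i) :
    partialDeriv j (faceRestrict i f) = faceRestrict i (partialDeriv j f) :=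
  partialDeriv_eq (hf.faceRestrict_hasDerivAt_of_ne hij)

/-- Hadamard's lemma in the `i`-th variable. -/
theorem eq_faceRestrict_add (hf : SmoothHol (K + 1) f) (i : Fin n) (t : Fin n → ℝ) (s : ℂ) :
    f t s = faceRestrict i f t s + t i * segmentAverage i 0 (partialDeriv i f) t s := by
  have hf' := hf.partialDeriv_mem i
  have hc : Continuous fun θ : ℝ =>
      (t i : ℂ) * partialDeriv i f (Function.update t i (θ * t i)) s :=
    continuous_const.mul (hf'.cont.comp (f := fun θ : ℝ =>
      (Function.update t i (θ * t i), s)) (by fun_prop))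
  have h1 := intervalIntegral.integral_eq_sub_of_hasDerivAt (a := 0) (b := 1)
    (f := fun θ : ℝ => f (Function.update t i (θ * t i)) s)
    (f' := fun θ => (t i : ℂ) * partialDeriv i f (Function.update t i (θ * t i)) s)
    (fun θ _ => by
      have h2 : HasDerivAt (fun θ : ℝ => θ * t i) (t i) θ := by
        simpa using (hasDerivAt_id θ).mul_const (t i)
      simpa [Function.comp_def] using HasDerivAt.scomp θ (hf.hasDerivAt i t s (θ * t i)) h2)
    (hc.intervalIntegrable _ _)
  rw [intervalIntegral.integral_const_mul] at h1
  simp only [segmentAverage, pow_zero, one_mul, h1, faceRestrict]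
  simp

theorem iterate_mem (i : Fin n) (k : ℕ) (hf : SmoothHol (K + k) f) :
    SmoothHol K ((partialDeriv i)^[k] f) := by
  induction k generalizing f with
  | zero => exact hf
  | succ k ih =>
    rw [Function.iterate_succ_apply]
    exact ih (SmoothHol.partialDeriv_mem (by rwa [← add_assoc] at hf) i)

theorem iterate_partialDeriv_segmentAverage (hf : ∀ K, SmoothHol K f) (i : Fin n) (k a : ℕ) :
    (partialDeriv i)^[k] (segmentAverage i a f) =
      segmentAverage i (a + k) ((partialDeriv i)^[k] f) := by
  induction k generalizing f a with
  | zero => rfl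
  | succ k ih =>
    rw [Function.iterate_succ_apply, Function.iterate_succ_apply,
      partialDeriv_segmentAverage (hf 1), ih fun K => (hf (K + 1)).partialDeriv_mem i]
    congr 1
    ring

theorem faceRestrict_segmentAverage (i : Fin n) (a : ℕ) (f : (Fin n → ℝ) → ℂ → ℂ) :
    faceRestrict i (segmentAverage i a f) = fun t s => faceRestrict i f t s / (a + 1) := by
  funext t s
  simp only [faceRestrict, segmentAverage, Function.update_self, mul_zero, Function.update_idem]
  rw [intervalIntegral.integral_mul_const]
  have : ∫ θ in (0 : ℝ)..1, (θ : ℂ) ^ a = 1 / (a + 1) := by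
    have h := integral_pow (a := 0) (b := 1) a
    have h2 : ∫ θ in (0 : ℝ)..1, (θ : ℂ) ^ a = ((∫ θ in (0 : ℝ)..1, θ ^ a : ℝ) : ℂ) := by
      rw [← intervalIntegral.integral_ofReal]
      simp
    rw [h2, h]
    simp
  rw [this]
  ring

end SmoothHol

/-- The restriction of Lebesgue measure to the open unit cube. -/
noncomputable def cubeMeasure (n : ℕ) : Measure (Fin n → ℝ) :=
  Measure.pi fun _ => volume.restrict (Set.Ioo (0 : ℝ) 1)

instance isProbabilityMeasure_restrict_Ioo :
    IsProbabilityMeasure (volume.restrict (Set.Ioo (0 : ℝ) 1)) := ⟨by simp⟩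

instance isProbabilityMeasure_cubeMeasure (n : ℕ) : IsProbabilityMeasure (cubeMeasure n) := by
  unfold cubeMeasure
  infer_instance

theorem cubeMeasure_eq_restrict (n : ℕ) :
    cubeMeasure n = volume.restrict (Set.univ.pi fun _ => Set.Ioo (0 : ℝ) 1) := by
  rw [cubeMeasure, volume_pi, Measure.restrict_pi_pi]

theorem ae_mem_cube (n : ℕ) : ∀ᵐ t ∂cubeMeasure n, ∀ i, t i ∈ Set.Ioo (0 : ℝ) 1 := by
  rw [cubeMeasure_eq_restrict]
  filter_upwards [ae_restrict_mem (MeasurableSet.univ_pi fun _ => measurableSet_Ioo)] with t ht i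
  exact ht i (Set.mem_univ i)

theorem integral_cubeMeasure_mul {n : ℕ} (i : Fin n) (a : ℝ → ℂ) (H : (Fin n → ℝ) → ℂ)
    (hH : ∀ t x, H (Function.update t i x) = H t) :
    ∫ t, a (t i) * H t ∂cubeMeasure n =
      (∫ x in Set.Ioo (0 : ℝ) 1, a x) * ∫ t, H t ∂cubeMeasure n := by
  obtain ⟨n, rfl⟩ : ∃ k, n = k + 1 := ⟨n - 1, by have := i.pos; omega⟩
  have key : ∀ b : ℝ → ℂ, ∫ t, b (t i) * H t ∂cubeMeasure (n + 1) =
      (∫ x in Set.Ioo (0 : ℝ) 1, b x) * ∫ r, H (i.insertNth 0 r) ∂cubeMeasure n := by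
    intro b
    have h1 := (measurePreserving_piFinSuccAbove
      (fun _ : Fin (n + 1) => volume.restrict (Set.Ioo (0 : ℝ) 1)) i).integral_comp
      (MeasurableEquiv.measurableEmbedding _)
      (fun q : ℝ × (Fin n → ℝ) => b q.1 * H (i.insertNth 0 q.2))
    have h3 := h1.trans (integral_prod_mul b fun r => H (i.insertNth 0 r))
    rw [cubeMeasure, cubeMeasure, ← h3]
    refine integral_congr_ae (Eventually.of_forall fun t => ?_)
    have h2 : (i.insertNth 0 (i.removeNth t) : Fin (n + 1) → ℝ) = Function.update t i 0 := by
      simp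
    simp only [MeasurableEquiv.piFinSuccAbove_apply, Fin.insertNthEquiv, Equiv.coe_fn_symm_mk]
    rw [h2, hH]
  have h1 := key fun _ => 1
  simp only [one_mul] at h1
  rw [key a, h1]
  simp

/-- The value at the origin and `s` of the iterated partial derivative of `f` along a word. -/
noncomputable def wordDeriv {n : ℕ} (s : ℂ) : List (Fin n) → ((Fin n → ℝ) → ℂ → ℂ) → ℂ
  | [], f => f 0 s
  | i :: w, f => wordDeriv s w (partialDeriv i f)

theorem wordDeriv_div_const {n : ℕ} (s : ℂ) (w : List (Fin n)) (f : (Fin n → ℝ) → ℂ → ℂ) (c : ℂ) :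
    wordDeriv s w (fun t s => f t s / c) = wordDeriv s w f / c := by
  induction w generalizing f with
  | nil => rfl
  | cons i w ih =>
    rw [wordDeriv, wordDeriv, ← ih]
    congr 1
    funext t s
    simp [partialDeriv]

theorem wordDeriv_faceRestrict {n : ℕ} (s : ℂ) (w : List (Fin n)) {f : (Fin n → ℝ) → ℂ → ℂ}
    (hf : ∀ K, SmoothHol K f) {i : Fin n} (hi : i ∉ w) :
    wordDeriv s w (faceRestrict i f) = wordDeriv s w f := by
  induction w generalizing f with
  | nil =>
    have h : Function.update (0 : Fin n → ℝ) i 0 = 0 := Function.update_eq_self i 0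
    simp only [wordDeriv, faceRestrict, h]
  | cons j w ih =>
    rw [List.mem_cons, not_or] at hi
    rw [wordDeriv, wordDeriv, SmoothHol.partialDeriv_faceRestrict_of_ne (hf 1) (Ne.symm hi.1),
      ih (fun K => (hf (K + 1)).partialDeriv_mem j) hi.2]

theorem wordDeriv_replicate_append {n : ℕ} (s : ℂ) (i : Fin n) (k : ℕ) (w : List (Fin n))
    (f : (Fin n → ℝ) → ℂ → ℂ) :
    wordDeriv s (List.replicate k i ++ w) f = wordDeriv s w ((partialDeriv i)^[k] f) := by
  induction k generalizing f with
  | zero => rfl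
  | succ k ih =>
    rw [List.replicate_succ, List.cons_append, wordDeriv, ih, Function.iterate_succ_apply]

theorem wordDeriv_segmentAverage {n : ℕ} (s : ℂ) (i : Fin n) (k : ℕ) {w : List (Fin n)}
    (hi : i ∉ w) {f : (Fin n → ℝ) → ℂ → ℂ} (hf : ∀ K, SmoothHol K f) :
    wordDeriv s (List.replicate k i ++ w) (segmentAverage i 0 (partialDeriv i f)) =
      wordDeriv s (List.replicate (k + 1) i ++ w) f / (k + 1) := by
  have hf' : ∀ K, SmoothHol K (partialDeriv i f) := fun K => (hf (K + 1)).partialDeriv_mem i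
  rw [wordDeriv_replicate_append, wordDeriv_replicate_append,
    SmoothHol.iterate_partialDeriv_segmentAverage hf', ← Function.iterate_succ_apply]
  have hg : ∀ K, SmoothHol K ((partialDeriv i)^[k + 1] f) :=
    fun K => SmoothHol.iterate_mem i (k + 1) (hf _)
  rw [← wordDeriv_faceRestrict s w (fun K => (hg K).segmentAverage_mem i _) hi,
    SmoothHol.faceRestrict_segmentAverage, wordDeriv_div_const, wordDeriv_faceRestrict s w hg hi]
  simp

/-- The integral over the unit cube of `f` against the monomial with exponents `z`. -/
noncomputable def monomialIntegral {n : ℕ} (z : Fin n → ℂ) (φ : (Fin n → ℝ) → ℂ) : ℂ :=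
  ∫ t, (∏ i, (t i : ℂ) ^ z i) * φ t ∂cubeMeasure n

theorem norm_prod_cpow_le_one {n : ℕ} {z : Fin n → ℂ} (hz : ∀ i, 0 ≤ (z i).re) {t : Fin n → ℝ}
    (ht : ∀ i, t i ∈ Set.Ioo (0 : ℝ) 1) : ‖∏ i, (t i : ℂ) ^ z i‖ ≤ 1 := by
  rw [norm_prod]
  refine Finset.prod_le_one (fun _ _ => norm_nonneg _) fun i _ => ?_
  rw [norm_cpow_eq_rpow_re_of_pos (ht i).1]
  exact Real.rpow_le_one (ht i).1.le (ht i).2.le (hz i)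

theorem measurable_prod_cpow {n : ℕ} (z : Fin n → ℂ) :
    Measurable fun t : Fin n → ℝ => ∏ i, (t i : ℂ) ^ z i := by
  fun_prop

theorem exists_bound_cube {n : ℕ} {f : (Fin n → ℝ) → ℂ → ℂ}
    (hf : Continuous (Function.uncurry f)) (s₀ : ℂ) :
    ∃ C, ∀ t : Fin n → ℝ, (∀ i, t i ∈ Set.Ioo (0 : ℝ) 1) → ∀ s ∈ Metric.closedBall s₀ 1,
      ‖f t s‖ ≤ C := by
  have hK : IsCompact ((Set.univ.pi fun _ : Fin n => Set.Icc (0 : ℝ) 1) ×ˢ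
      Metric.closedBall s₀ 1) :=
    (isCompact_univ_pi fun _ => isCompact_Icc).prod (isCompact_closedBall s₀ 1)
  obtain ⟨C, hC⟩ := hK.exists_bound_of_continuousOn hf.continuousOn
  exact ⟨C, fun t ht s hs => hC (t, s) ⟨fun i _ => Set.Ioo_subset_Icc_self (ht i), hs⟩⟩

theorem integrable_monomial {n : ℕ} {z : Fin n → ℂ} (hz : ∀ i, 0 ≤ (z i).re)
    {φ : (Fin n → ℝ) → ℂ} (hφ : Continuous φ) :
    Integrable (fun t => (∏ i, (t i : ℂ) ^ z i) * φ t) (cubeMeasure n) := by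
  obtain ⟨C, hC⟩ := exists_bound_cube (f := fun t _ => φ t) (hφ.comp continuous_fst) 0
  refine Integrable.of_bound
    (((measurable_prod_cpow z).mul hφ.measurable).aestronglyMeasurable) C ?_
  filter_upwards [ae_mem_cube n] with t ht
  rw [norm_mul]
  have h1 := norm_prod_cpow_le_one hz ht
  have h2 := hC t ht 0 (by simp)
  nlinarith [norm_nonneg (φ t), norm_nonneg (∏ i, (t i : ℂ) ^ z i)]

theorem monomialIntegral_add_mul {n : ℕ} {z : Fin n → ℂ} (hz : ∀ i, 0 ≤ (z i).re) (i : Fin n)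
    {φ φ₀ φ₁ : (Fin n → ℝ) → ℂ} (h0 : Continuous φ₀) (h1 : Continuous φ₁)
    (hi : ∀ t x, φ₀ (Function.update t i x) = φ₀ t) (hφ : ∀ t, φ t = φ₀ t + t i * φ₁ t) :
    monomialIntegral z φ = 1 / (z i + 1) * monomialIntegral (Function.update z i 0) φ₀ +
      monomialIntegral (Function.update z i (z i + 1)) φ₁ := by
  have hsplit : ∀ (x : ℂ) (t : Fin n → ℝ), ∏ j, (t j : ℂ) ^ Function.update z i x j =
      (t i : ℂ) ^ x * ∏ j ∈ Finset.univ.erase i, (t j : ℂ) ^ z j := by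
    intro x t
    rw [← Finset.mul_prod_erase _ _ (Finset.mem_univ i), Function.update_self]
    congr 1
    refine Finset.prod_congr rfl fun j hj => ?_
    rw [Function.update_of_ne (Finset.ne_of_mem_erase hj)]
  have hz1 : ∀ j, 0 ≤ (Function.update z i (z i + 1) j).re := by
    intro j
    by_cases hj : j = i
    · subst hj
      have := hz j
      simp only [Function.update_self, add_re, one_re]
      linarith
    · rw [Function.update_of_ne hj]
      exact hz j
  have e1 : monomialIntegral z φ = monomialIntegral z φ₀ +
      monomialIntegral (Function.update z i (z i + 1)) φ₁ := by
    unfold monomialIntegral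
    rw [← integral_add (integrable_monomial hz h0) (integrable_monomial hz1 h1)]
    refine integral_congr_ae ?_
    filter_upwards [ae_mem_cube n] with t ht
    have h2 : (t i : ℂ) ≠ 0 := by exact_mod_cast (ht i).1.ne'
    rw [hφ, hsplit, cpow_add _ _ h2, cpow_one,
      ← Finset.mul_prod_erase _ (fun j => (t j : ℂ) ^ z j) (Finset.mem_univ i)]
    ring
  rw [e1]
  congr 1
  unfold monomialIntegral
  have h3 : ∀ x : ℂ, ∫ t, (∏ j, (t j : ℂ) ^ Function.update z i x j) * φ₀ t ∂cubeMeasure n =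
      (∫ y in Set.Ioo (0 : ℝ) 1, (y : ℂ) ^ x) *
        ∫ t, (∏ j ∈ Finset.univ.erase i, (t j : ℂ) ^ z j) * φ₀ t ∂cubeMeasure n := by
    intro x
    simp_rw [hsplit, mul_assoc]
    refine integral_cubeMeasure_mul i (fun y => (y : ℂ) ^ x)
      (fun t => (∏ j ∈ Finset.univ.erase i, (t j : ℂ) ^ z j) * φ₀ t) fun t x => ?_
    rw [hi]
    congr 1
    refine Finset.prod_congr rfl fun j hj => ?_
    rw [Function.update_of_ne (Finset.ne_of_mem_erase hj)]
  have h4 : ∀ x : ℂ, 0 ≤ x.re → ∫ y in Set.Ioo (0 : ℝ) 1, (y : ℂ) ^ x = 1 / (x + 1) := by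
    intro x hx
    rw [← integral_Ioc_eq_integral_Ioo, ← intervalIntegral.integral_of_le zero_le_one,
      integral_cpow (Or.inl (by linarith))]
    have : x + 1 ≠ 0 := fun h => by
      have := congrArg re h
      simp at this
      linarith
    rw [ofReal_one, one_cpow, ofReal_zero, zero_cpow this, sub_zero]
  have h5 := h3 (z i)
  rw [Function.update_eq_self] at h5
  rw [h5, h3, h4 _ (hz i), h4 _ (by simp)]
  simp

theorem monomialIntegral_differentiableOn {n : ℕ} (R : ℝ) (A : Fin n → ℕ) (B : Fin n → ℤ)
    (hAB : ∀ i, (A i : ℝ) * R ≤ B i) {f : (Fin n → ℝ) → ℂ → ℂ} (hf : SmoothHol 0 f) :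
    DifferentiableOn ℂ (fun s => monomialIntegral (fun i => A i * s + B i) (fun t => f t s))
      {s | -R < s.re} := by
  have hU : IsOpen {s : ℂ | -R < s.re} := isOpen_lt continuous_const continuous_re
  have hre : ∀ s : ℂ, -R < s.re → ∀ i, 0 ≤ ((A i : ℂ) * s + B i).re := by
    intro s hs i
    have h1 := hAB i
    have h2 : (0 : ℝ) ≤ A i := Nat.cast_nonneg _
    have h3 : ((A i : ℂ) * s + B i).re = A i * s.re + B i := by simp
    rw [h3]
    nlinarith
  refine differentiableOn_integral_of_locally_bounded hU ?_ ?_ ?_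
  · intro s _
    exact ((measurable_prod_cpow _).mul
      (hf.cont.comp (Continuous.prodMk_left s)).measurable).aestronglyMeasurable
  · filter_upwards [ae_mem_cube n] with t ht
    refine DifferentiableOn.mul ?_ (hf.entire t).differentiableOn
    refine DifferentiableOn.fun_finsetProd fun i _ => ?_
    refine DifferentiableOn.const_cpow (by fun_prop) (Or.inl ?_)
    exact_mod_cast (ht i).1.ne'
  · intro s₀ hs₀
    obtain ⟨C, hC⟩ := exists_bound_cube hf.cont s₀
    refine ⟨C, Metric.closedBall s₀ 1 ∩ {s | -R < s.re},
      inter_mem (Metric.closedBall_mem_nhds _ one_pos) (hU.mem_nhds hs₀), ?_⟩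
    filter_upwards [ae_mem_cube n] with t ht s hs
    rw [norm_mul]
    have h1 := norm_prod_cpow_le_one (hre s hs.2) ht
    have h2 := hC t ht s hs.1
    nlinarith [norm_nonneg (f t s), norm_nonneg (∏ i, (t i : ℂ) ^ ((A i : ℂ) * s + B i))]

/-- The word recording the partial derivatives which enter the leading coefficient at `-m`. -/
def residueWord {n : ℕ} (m : ℕ) (A : Fin n → ℕ) (B : Fin n → ℤ) (l : List (Fin n)) :
    List (Fin n) :=
  l.flatMap fun i => List.replicate (A i * m - B i - 1 : ℤ).toNat i

theorem residueWord_congr {n : ℕ} (m : ℕ) {A A' : Fin n → ℕ} {B B' : Fin n → ℤ} {l : List (Fin n)}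
    (hA : ∀ i ∈ l, A i = A' i) (hB : ∀ i ∈ l, B i = B' i) :
    residueWord m A B l = residueWord m A' B' l := by
  refine List.flatMap_congr fun i hi => ?_
  rw [hA i hi, hB i hi]

theorem notMem_residueWord {n : ℕ} {m : ℕ} {A : Fin n → ℕ} {B : Fin n → ℤ} {l : List (Fin n)}
    {i : Fin n} (hi : i ∉ l) : i ∉ residueWord m A B l := by
  intro h
  obtain ⟨j, hj, h1⟩ := List.mem_flatMap.1 h
  rw [List.eq_of_mem_replicate h1] at hi
  exact hi hj

/-- The integral of `f` against the monomial with exponents `A i * s + B i` continues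
meromorphically to `re s > -R`, with a pole of order at most `l.length` at `-m`, whose leading
coefficient is a rational multiple of a derivative of `f` at the origin. -/
def MonomialContinuation {n : ℕ} (R m : ℕ) (l : List (Fin n)) (A : Fin n → ℕ) (B : Fin n → ℤ)
    (f : (Fin n → ℝ) → ℂ → ℂ) : Prop :=
  ∃ (G : ℂ → ℂ) (L : ℂ),
    (∀ z : ℂ, -(R : ℝ) < z.re → MeromorphicAt G z) ∧
    (∀ s : ℂ, 1 < s.re →
      G s = monomialIntegral (fun i => A i * s + B i) (fun t => f t s)) ∧
    Tendsto (fun s => (s + (m : ℂ)) ^ l.length * G s)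
      (nhdsWithin (-(m : ℂ)) {-(m : ℂ)}ᶜ) (nhds L) ∧
    ((∀ i ∉ l, A i = 0 ∧ B i = 0) → (∀ t t', (∀ i ∈ l, t i = t' i) → f t = f t') →
      ((∃ i ∈ l, (A i * m - B i - 1 : ℤ) < 0) → L = 0) ∧
      ∃ q : ℚ, L = q * wordDeriv (-(m : ℂ)) (residueWord m A B l) f)

theorem monomialContinuation_nil {n : ℕ} {R m : ℕ} (hmR : m < R) {A : Fin n → ℕ} {B : Fin n → ℤ}
    {f : (Fin n → ℝ) → ℂ → ℂ} (hf : SmoothHol 0 f) (hAB : ∀ i, (A i * R : ℤ) ≤ B i) :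
    MonomialContinuation R m [] A B f := by
  have hd := monomialIntegral_differentiableOn (R : ℝ) A B
    (fun i => by exact_mod_cast hAB i) hf
  have hU : IsOpen {s : ℂ | -(R : ℝ) < s.re} := isOpen_lt continuous_const continuous_re
  have hm : -(m : ℂ) ∈ {s : ℂ | -(R : ℝ) < s.re} := by
    simpa using hmR
  refine ⟨_, monomialIntegral (fun i => A i * (-(m : ℂ)) + B i) (fun t => f t (-(m : ℂ))),
    fun z hz => (hd.analyticAt (hU.mem_nhds hz)).meromorphicAt, fun s _ => rfl, ?_, ?_⟩
  · simp only [List.length_nil, pow_zero, one_mul]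
    exact ((hd.differentiableAt (hU.mem_nhds hm)).continuousAt.tendsto).mono_left nhdsWithin_le_nhds
  · intro h0 hc
    refine ⟨by simp, 1, ?_⟩
    have h1 : ∀ i, A i = 0 ∧ B i = 0 := fun i => h0 i (by simp)
    have h2 : ∀ t, f t = f 0 := fun t => hc _ _ (by simp)
    simp [monomialIntegral, h1, h2, residueWord, wordDeriv]

theorem tendsto_pow_succ_mul_zero {z₀ m : ℂ} (hz : z₀ = -m) {k : ℕ} {G : ℂ → ℂ} {L : ℂ}
    (h : Tendsto (fun s => (s + m) ^ k * G s) (nhdsWithin z₀ {z₀}ᶜ) (nhds L)) :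
    Tendsto (fun s => (s + m) ^ (k + 1) * G s) (nhdsWithin z₀ {z₀}ᶜ) (nhds 0) := by
  have h1 : Tendsto (fun s : ℂ => s + m) (nhdsWithin z₀ {z₀}ᶜ) (nhds 0) := by
    have : ContinuousAt (fun s : ℂ => s + m) z₀ := by fun_prop
    have h2 := this.tendsto.mono_left (nhdsWithin_le_nhds (s := {z₀}ᶜ))
    simpa [hz] using h2
  have h2 := h1.mul h
  rw [zero_mul] at h2
  refine h2.congr fun s => ?_
  ring

theorem monomialContinuation_cons {n : ℕ} {R m : ℕ} {l : List (Fin n)} {i : Fin n}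
    (hi : i ∉ l)
    (ih : ∀ (A : Fin n → ℕ) (B : Fin n → ℤ) (f : (Fin n → ℝ) → ℂ → ℂ), (∀ K, SmoothHol K f) →
      (∀ j ∈ l, 1 ≤ A j) → (∀ j, 0 ≤ (A j : ℤ) + B j) → (∀ j ∉ l, (A j * R : ℤ) ≤ B j) →
      MonomialContinuation R m l A B f)
    (A : Fin n → ℕ) (hA : ∀ j ∈ i :: l, 1 ≤ A j) (M : ℕ) :
    ∀ (B : Fin n → ℤ) (f : (Fin n → ℝ) → ℂ → ℂ), (∀ K, SmoothHol K f) →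
      (∀ j, 0 ≤ (A j : ℤ) + B j) → (∀ j ∉ i :: l, (A j * R : ℤ) ≤ B j) →
      (A i * R : ℤ) ≤ B i + M → MonomialContinuation R m (i :: l) A B f := by
  have hAi : 1 ≤ A i := hA i (by simp)
  induction M with
  | zero =>
    intro B f hf hAB ht hM
    obtain ⟨G, L, h1, h2, h3, -⟩ := ih A B f hf (fun j hj => hA j (by simp [hj])) hAB
      (fun j hj => by
        by_cases hji : j = i
        · subst hji; simpa using hM
        · exact ht j (by simp [hji, hj]))
    refine ⟨G, 0, h1, h2, tendsto_pow_succ_mul_zero rfl h3, fun _ _ => ⟨fun _ => rfl, 0, by simp⟩⟩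
  | succ M ihM =>
    intro B f hf hAB ht hM
    have hf1 : ∀ K, SmoothHol K (faceRestrict i f) := fun K => (hf K).faceRestrict_mem i
    have hf2 : ∀ K, SmoothHol K (segmentAverage i 0 (partialDeriv i f)) :=
      fun K => ((hf (K + 1)).partialDeriv_mem i).segmentAverage_mem i 0
    obtain ⟨G₁, L₁, m1, e1, t1, r1⟩ := ih (Function.update A i 0) (Function.update B i 0)
      (faceRestrict i f) hf1
      (fun j hj => by
        have hji : j ≠ i := by
          rintro rfl
          exact hi hj
        rw [Function.update_of_ne hji]
        exact hA j (by simp [hj]))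
      (fun j => by
        by_cases hji : j = i
        · subst hji; simp
        · simpa [hji] using hAB j)
      (fun j hj => by
        by_cases hji : j = i
        · subst hji; simp
        · simpa [hji] using ht j (by simp [hji, hj]))
    obtain ⟨G₂, L₂, m2, e2, t2, r2⟩ := ihM (Function.update B i (B i + 1))
      (segmentAverage i 0 (partialDeriv i f)) hf2
      (fun j => by
        have := hAB j
        by_cases hji : j = i
        · subst hji; simp; omega
        · simpa [hji] using this)
      (fun j hj => by
        have hji : j ≠ i := fun h => hj (by simp [h])
        simpa [hji] using ht j hj)
      (by simp; push_cast at hM; linarith)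
    have hlin : ∀ z, AnalyticAt ℂ (fun s : ℂ => (A i : ℂ) * s + B i + 1) z := fun z => by fun_prop
    obtain ⟨c, hc, hc'⟩ : ∃ c : ℚ, Tendsto (fun s : ℂ => (s + m) * (1 / ((A i : ℂ) * s + B i + 1)))
        (nhdsWithin (-(m : ℂ)) {-(m : ℂ)}ᶜ) (nhds c) ∧
        ((A i * m - B i - 1 : ℤ) ≠ 0 → c = 0) := by
      have hA0 : (A i : ℂ) ≠ 0 := by exact_mod_cast (by omega : A i ≠ 0)
      by_cases hk : (A i * m - B i - 1 : ℤ) = 0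
      · refine ⟨1 / (A i), ?_, fun h => absurd hk h⟩
        have hk' : (A i * m - B i - 1 : ℂ) = 0 := by exact_mod_cast hk
        refine tendsto_const_nhds.congr' ?_
        filter_upwards [self_mem_nhdsWithin] with s hs
        have h1 : (A i : ℂ) * s + B i + 1 = A i * (s + m) := by linear_combination -hk'
        have h2 : s + m ≠ 0 := fun h => hs (by
          rw [Set.mem_singleton_iff]; linear_combination h)
        rw [h1]
        push_cast
        field_simp
      · refine ⟨0, ?_, fun _ => rfl⟩
        have h1 : (A i : ℂ) * (-(m : ℂ)) + B i + 1 ≠ 0 := by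
          intro h
          apply hk
          have : ((A i * m - B i - 1 : ℤ) : ℂ) = 0 := by push_cast; linear_combination -h
          exact_mod_cast this
        have h2 : ContinuousAt (fun s : ℂ => (s + m) * (1 / ((A i : ℂ) * s + B i + 1)))
            (-(m : ℂ)) := by
          refine ContinuousAt.mul (by fun_prop) (ContinuousAt.div (by fun_prop) (by fun_prop) h1)
        have h3 := h2.tendsto.mono_left (nhdsWithin_le_nhds (s := {-(m : ℂ)}ᶜ))
        simpa using h3
    refine ⟨fun s => 1 / ((A i : ℂ) * s + B i + 1) * G₁ s + G₂ s, c * L₁ + L₂, ?_, ?_, ?_, ?_⟩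
    · intro z hz
      exact (((MeromorphicAt.const 1 z).fun_div (hlin z).meromorphicAt).fun_mul (m1 z hz)).fun_add
        (m2 z hz)
    · intro s hs
      have hre : ∀ j, 0 ≤ ((A j : ℂ) * s + B j).re := by
        intro j
        have h3 : ((A j : ℂ) * s + B j).re = A j * s.re + B j := by simp
        have h4 : (0 : ℝ) ≤ (A j : ℝ) + B j := by exact_mod_cast hAB j
        have h5 : (0 : ℝ) ≤ A j := Nat.cast_nonneg _
        rw [h3]
        nlinarith
      have h6 := monomialIntegral_add_mul hre i (φ := fun t => f t s)
        (φ₀ := fun t => faceRestrict i f t s)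
        (φ₁ := fun t => segmentAverage i 0 (partialDeriv i f) t s)
        ((hf1 0).cont.comp (Continuous.prodMk_left s)) ((hf2 0).cont.comp (Continuous.prodMk_left s))
        (fun t x => by simp [faceRestrict]) (fun t => (hf 1).eq_faceRestrict_add i t s)
      simp only [h6, e1 s hs, e2 s hs]
      congr 3
      · funext j
        by_cases hji : j = i
        · subst hji; simp
        · simp [hji]
      · funext j
        by_cases hji : j = i
        · subst hji; simp; ring
        · simp [hji]
    · refine ((hc.mul t1).add t2).congr fun s => ?_
      rw [List.length_cons]
      ring
    · intro h0 hind
      have hne : ∀ j ∈ l, j ≠ i := by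
        rintro j hj rfl
        exact hi hj
      have r1' := (r1 (fun j hj => by
          by_cases hji : j = i
          · subst hji; simp
          · simpa [hji] using h0 j (by simp [hji, hj]))
        (fun t t' htt => hind _ _ fun j hj => by
          by_cases hji : j = i
          · subst hji; simp
          · simpa [hji] using htt j (by simpa [hji] using hj)))
      have r2' := (r2 (fun j hj => by
          have hji : j ≠ i := fun h => hj (by simp [h])
          simpa [hji] using h0 j hj)
        (fun t t' htt => by
          funext s
          have h1 : ∀ x, f (Function.update t i x) = f (Function.update t' i x) := fun x =>
            hind _ _ fun j hj => by
              by_cases hji : j = i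
              · subst hji; simp
              · simpa [hji] using htt j hj
          simp only [segmentAverage, partialDeriv, Function.update_idem, Function.update_self, h1,
            htt i (by simp)]))
      have hw1 : residueWord m (Function.update A i 0) (Function.update B i 0) l =
          residueWord m A B l :=
        residueWord_congr m (fun j hj => Function.update_of_ne (hne j hj) _ _)
          (fun j hj => Function.update_of_ne (hne j hj) _ _)
      have hw2 : residueWord m A (Function.update B i (B i + 1)) l = residueWord m A B l :=
        residueWord_congr m (fun j hj => rfl)
          (fun j hj => Function.update_of_ne (hne j hj) _ _)
      have hcons : ∀ B : Fin n → ℤ, residueWord m A B (i :: l) =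
          List.replicate (A i * m - B i - 1 : ℤ).toNat i ++ residueWord m A B l := fun B => rfl
      rw [hw1, wordDeriv_faceRestrict _ _ hf (notMem_residueWord hi)] at r1'
      rw [hcons, hw2, Function.update_self] at r2'
      rw [hcons]
      obtain ⟨z1, q1, hq1⟩ := r1'
      obtain ⟨z2, q2, hq2⟩ := r2'
      constructor
      · rintro ⟨j, hj, hk⟩
        have hL2 : L₂ = 0 := z2 ⟨j, hj, by
          by_cases hji : j = i
          · subst hji; simp; omega
          · simpa [hji] using hk⟩
        by_cases hji : j = i
        · subst hji
          rw [hL2, hc' hk.ne]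
          simp
        · have hL1 : L₁ = 0 := z1 ⟨j, by simpa [hji] using hj, by simpa [hji] using hk⟩
          rw [hL1, hL2]
          simp
      · rcases lt_trichotomy (A i * m - B i - 1 : ℤ) 0 with hk | hk | hk
        · have hL2 : L₂ = 0 := z2 ⟨i, by simp, by simp; omega⟩
          exact ⟨0, by rw [hL2, hc' hk.ne]; simp⟩
        · have hL2 : L₂ = 0 := z2 ⟨i, by simp, by simp; omega⟩
          refine ⟨c * q1, ?_⟩
          rw [hL2, hk, hq1]
          simp [mul_assoc]
        · obtain ⟨k, hk'⟩ : ∃ k : ℕ, (A i * m - B i - 1 : ℤ) = k + 1 :=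
            ⟨(A i * m - B i - 1 - 1 : ℤ).toNat, by omega⟩
          have h7 : (A i * m - (B i + 1) - 1 : ℤ).toNat = k := by omega
          have h8 : (A i * m - B i - 1 : ℤ).toNat = k + 1 := by omega
          rw [h7, wordDeriv_segmentAverage _ _ _ (notMem_residueWord hi) hf] at hq2
          refine ⟨q2 / (k + 1), ?_⟩
          rw [hq2, hc' hk.ne', h8]
          push_cast
          ring

theorem monomialContinuation {n : ℕ} {R m : ℕ} (hmR : m < R) (l : List (Fin n)) (hl : l.Nodup) :
    ∀ (A : Fin n → ℕ) (B : Fin n → ℤ) (f : (Fin n → ℝ) → ℂ → ℂ), (∀ K, SmoothHol K f) →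
      (∀ j ∈ l, 1 ≤ A j) → (∀ j, 0 ≤ (A j : ℤ) + B j) → (∀ j ∉ l, (A j * R : ℤ) ≤ B j) →
      MonomialContinuation R m l A B f := by
  induction l with
  | nil => exact fun A B f hf _ _ ht => monomialContinuation_nil hmR (hf 0) fun i => ht i (by simp)
  | cons i l ih =>
    intro A B f hf hA hAB ht
    rw [List.nodup_cons] at hl
    exact monomialContinuation_cons hl.1 (ih hl.2) A hA (A i * R - B i : ℤ).toNat B f hf hAB ht
      (by omega)

theorem wordDeriv_add {n : ℕ} (s : ℂ) (w : List (Fin n)) {f g : (Fin n → ℝ) → ℂ → ℂ}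
    (hf : ∀ K, SmoothHol K f) (hg : ∀ K, SmoothHol K g) :
    wordDeriv s w (fun t s => f t s + g t s) = wordDeriv s w f + wordDeriv s w g := by
  induction w generalizing f g with
  | nil => rfl
  | cons i w ih =>
    rw [wordDeriv, wordDeriv, wordDeriv, ← ih (fun K => (hf (K + 1)).partialDeriv_mem i)
      (fun K => (hg (K + 1)).partialDeriv_mem i)]
    congr 1
    exact SmoothHol.partialDeriv_eq fun t s =>
      ((hf 1).hasDerivAt_self i t s).add ((hg 1).hasDerivAt_self i t s)

theorem wordDeriv_const_cons {n : ℕ} (s : ℂ) (i : Fin n) (w : List (Fin n)) (c : ℂ → ℂ) :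
    wordDeriv s (i :: w) (fun _ s => c s) = 0 := by
  have h : partialDeriv i (fun (_ : Fin n → ℝ) s => c s) = fun _ _ => 0 := by
    funext t s
    simp [partialDeriv]
  induction w generalizing i c with
  | nil => simp [wordDeriv, h]
  | cons j w ih =>
    rw [wordDeriv, h]
    exact ih j (fun _ => 0) (by funext t s; simp [partialDeriv])

theorem wordDeriv_congr_of_eventuallyEq {n : ℕ} (s : ℂ) (w : List (Fin n))
    {f g : (Fin n → ℝ) → ℂ → ℂ} (h : ∀ᶠ t in nhds 0, f t = g t) :
    wordDeriv s w f = wordDeriv s w g := by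
  induction w generalizing f g with
  | nil => simp only [wordDeriv, h.self_of_nhds]
  | cons i w ih =>
    refine ih ?_
    filter_upwards [eventually_eventually_nhds.2 h] with t ht
    funext s
    have h1 : Tendsto (fun x : ℝ => Function.update t i x) (nhds (t i)) (nhds t) := by
      have h2 : Continuous fun x : ℝ => Function.update t i x := by fun_prop
      simpa using h2.tendsto (t i)
    refine Filter.EventuallyEq.deriv_eq ?_
    filter_upwards [h1.eventually ht] with x hx
    rw [hx]

/-- `f` is smooth and its iterated derivatives at the origin and `s`, up to order `d`, along a
word `w`, lie in the rational span of `X w`. -/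
def WordMem {n : ℕ} (s : ℂ) (d : ℕ) (X : Multiset (Fin n) → Set ℂ)
    (f : (Fin n → ℝ) → ℂ → ℂ) : Prop :=
  (∀ K, SmoothHol K f) ∧ ∀ w : List (Fin n), w.length ≤ d →
    wordDeriv s w f ∈ Submodule.span ℚ (X (w : Multiset (Fin n)))

namespace WordMem

variable {n : ℕ} {s : ℂ} {d : ℕ} {X Y Z : Multiset (Fin n) → Set ℂ} {f g : (Fin n → ℝ) → ℂ → ℂ}

theorem mono (hf : WordMem s d X f) (h : ∀ a, X a ⊆ Y a) : WordMem s d Y f :=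
  ⟨hf.1, fun w hw => Submodule.span_mono (h _) (hf.2 w hw)⟩

theorem partialDeriv (hf : WordMem s (d + 1) X f) (i : Fin n) :
    WordMem s d (fun a => X (i ::ₘ a)) (partialDeriv i f) :=
  ⟨fun K => (hf.1 (K + 1)).partialDeriv_mem i, fun w hw => hf.2 (i :: w) (by simpa using hw)⟩

theorem of_le {e : ℕ} (hf : WordMem s d X f) (he : e ≤ d) : WordMem s e X f :=
  ⟨hf.1, fun w hw => hf.2 w (hw.trans he)⟩

theorem add (hf : WordMem s d X f) (hg : WordMem s d X g) :
    WordMem s d X (fun t s => f t s + g t s) :=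
  ⟨fun K => (hf.1 K).add (hg.1 K), fun w hw => by
    rw [wordDeriv_add s w hf.1 hg.1]
    exact add_mem (hf.2 w hw) (hg.2 w hw)⟩

theorem mul (hf : WordMem s d X f) (hg : WordMem s d Y g)
    (h : ∀ a b, ∀ x ∈ X a, ∀ y ∈ Y b, x * y ∈ Z (a + b)) :
    WordMem s d Z (fun t s => f t s * g t s) := by
  have hsm : ∀ K, SmoothHol K (fun t s => f t s * g t s) := fun K => (hf.1 K).mul (hg.1 K)
  refine ⟨hsm, fun w hw => ?_⟩
  induction w generalizing d X Y Z f g with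
  | nil =>
    have h1 := Submodule.mul_mem_mul (hf.2 [] hw) (hg.2 [] hw)
    rw [Submodule.span_mul_span] at h1
    refine Submodule.span_mono ?_ h1
    rintro _ ⟨x, hx, y, hy, rfl⟩
    simpa using h _ _ x hx y hy
  | cons i w ih =>
    obtain ⟨d, rfl⟩ : ∃ e, d = e + 1 := ⟨d - 1, by simp at hw; omega⟩
    have hw' : w.length ≤ d := by simpa using hw
    have e1 : _root_.partialDeriv i (fun t s => f t s * g t s) = fun t s =>
        _root_.partialDeriv i f t s * g t s + f t s * _root_.partialDeriv i g t s :=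
      SmoothHol.partialDeriv_eq ((hf.1 1).hasDerivAt_mul (hg.1 1) i)
    have hfi := hf.partialDeriv i
    have hgi := hg.partialDeriv i
    have hf' := hf.of_le (Nat.le_succ d)
    have hg' := hg.of_le (Nat.le_succ d)
    rw [wordDeriv, e1, wordDeriv_add s w (fun K => (hfi.1 K).mul (hg'.1 K))
      (fun K => (hf'.1 K).mul (hgi.1 K))]
    refine add_mem
      (ih (Z := fun a => Z (i ::ₘ a)) hfi hg' (fun a b x hx y hy => ?_)
        (fun K => (hfi.1 K).mul (hg'.1 K)) hw')
      (ih (Z := fun a => Z (i ::ₘ a)) hf' hgi (fun a b x hx y hy => ?_)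
        (fun K => (hf'.1 K).mul (hgi.1 K)) hw')
    · simpa using h _ _ x hx y hy
    · simpa using h _ _ x hx y hy

theorem const (q : ℚ) (h : 1 ∈ X 0) : WordMem s d X (fun _ _ => (q : ℂ)) := by
  refine ⟨fun K => SmoothHol.const (differentiable_const _), fun w _ => ?_⟩
  cases w with
  | nil =>
    have := Submodule.smul_mem _ q (Submodule.subset_span (R := ℚ) h)
    simpa [wordDeriv, Rat.smul_def] using this
  | cons i w =>
    rw [wordDeriv_const_cons s i w (fun _ => (q : ℂ))]
    exact zero_mem _

theorem prod {κ : Type*} [DecidableEq κ] (J : Finset κ) {F : κ → (Fin n → ℝ) → ℂ → ℂ}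
    {X : κ → Multiset (Fin n) → Set ℂ} (hF : ∀ j ∈ J, WordMem s d (X j) (F j)) :
    WordMem s d (fun a => {z | ∃ (α : κ → Multiset (Fin n)) (ζ : κ → ℂ), ∑ j ∈ J, α j = a ∧
      (∀ j ∈ J, ζ j ∈ X j (α j)) ∧ z = ∏ j ∈ J, ζ j}) (fun t s => ∏ j ∈ J, F j t s) := by
  induction J using Finset.induction_on with
  | empty =>
    have := const (s := s) (d := d) (X := fun a : Multiset (Fin n) =>
      {z | ∃ (α : κ → Multiset (Fin n)) (ζ : κ → ℂ), ∑ j ∈ (∅ : Finset κ), α j = a ∧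
      (∀ j ∈ (∅ : Finset κ), ζ j ∈ X j (α j)) ∧ z = ∏ j ∈ (∅ : Finset κ), ζ j}) 1 (by simp)
    simpa using this
  | insert j J hj ih =>
    simp only [Finset.prod_insert hj]
    refine (hF j (Finset.mem_insert_self _ _)).mul
      (ih fun k hk => hF k (Finset.mem_insert_of_mem hk)) ?_
    rintro a b x hx _ ⟨α, ζ, h1, h2, rfl⟩
    have hne : ∀ k ∈ J, k ≠ j := by
      rintro k hk rfl
      exact hj hk
    refine ⟨Function.update α j a, Function.update ζ j x, ?_, ?_, ?_⟩
    · rw [Finset.sum_insert hj, Function.update_self, ← h1]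
      congr 1
      exact Finset.sum_congr rfl fun k hk => by rw [Function.update_of_ne (hne k hk)]
    · intro k hk
      rcases Finset.mem_insert.1 hk with rfl | hk
      · simpa using hx
      · simpa [hne k hk] using h2 k hk
    · rw [Function.update_self]
      congr 1
      exact Finset.prod_congr rfl fun k hk => by rw [Function.update_of_ne (hne k hk)]

theorem coord (i : Fin n) : WordMem s d (fun a => {z | z = 1 ∧ a = {i}})
    (fun t _ => (t i : ℂ)) := by
  refine ⟨fun K => SmoothHol.of_contDiff (p := fun t => t i) (by fun_prop), fun w _ => ?_⟩
  cases w with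
  | nil => simp [wordDeriv]
  | cons j w =>
    have h : _root_.partialDeriv j (fun (t : Fin n → ℝ) (_ : ℂ) => (t i : ℂ)) =
        fun _ _ => if j = i then 1 else 0 := by
      refine SmoothHol.partialDeriv_eq fun t s => ?_
      by_cases hj : j = i
      · subst hj
        simpa using (hasDerivAt_id (t j)).ofReal_comp
      · simpa [hj, Ne.symm hj] using hasDerivAt_const (t j) ((t i : ℂ))
    rw [wordDeriv, h]
    cases w with
    | nil =>
      by_cases hj : j = i
      · subst hj
        simp only [wordDeriv, if_true]
        exact Submodule.subset_span ⟨rfl, rfl⟩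
      · simp [wordDeriv, hj]
    | cons k w =>
      rw [wordDeriv_const_cons s k w (fun _ => if j = i then 1 else 0)]
      exact zero_mem _

theorem monomial (S : Finset (Fin n)) : WordMem s d (fun a => {z | z = 1 ∧ a = S.val})
    (fun t _ => ∏ i ∈ S, (t i : ℂ)) := by
  refine (prod S fun i _ => coord i).mono ?_
  rintro a _ ⟨α, ζ, rfl, h, rfl⟩
  refine ⟨Finset.prod_eq_one fun j hj => (h j hj).1, ?_⟩
  rw [Finset.sum_congr rfl fun j hj => (h j hj).2, Finset.sum_multiset_singleton]

theorem polynomial {κ : Type*} (Λ : Finset κ) (c : κ → ℚ) (S : κ → Finset (Fin n)) :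
    WordMem s d (fun a => {z | z = 1 ∧ ∃ l ∈ Λ, a = (S l).val})
      (fun t _ => ((∑ l ∈ Λ, (c l : ℝ) * ∏ i ∈ S l, t i : ℝ) : ℂ)) := by
  classical
  push_cast
  induction Λ using Finset.induction_on with
  | empty =>
    refine ⟨fun K => ?_, fun w _ => ?_⟩
    · simpa using SmoothHol.const (differentiable_const (0 : ℂ))
    · have h : wordDeriv s w (fun (t : Fin n → ℝ) (_ : ℂ) => (0 : ℂ)) = 0 := by
        cases w with
        | nil => rfl
        | cons i w => exact wordDeriv_const_cons s i w (fun _ => 0)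
      simp [h]
  | insert l Λ hl ih =>
    simp only [Finset.sum_insert hl]
    refine add ?_ (ih.mono ?_)
    · refine (const (X := fun a => {z | z = 1 ∧ a = 0}) (c l) (by simp)).mul (monomial (S l)) ?_
      rintro a b x ⟨rfl, rfl⟩ y ⟨rfl, rfl⟩
      exact ⟨by simp, l, by simp, by simp⟩
    · rintro a z ⟨rfl, k, hk, rfl⟩
      exact ⟨rfl, k, Finset.mem_insert_of_mem hk, rfl⟩

theorem congr_of_eventuallyEq (hf : WordMem s d X f) (hg : ∀ K, SmoothHol K g)
    (h : ∀ᶠ t in nhds 0, f t = g t) : WordMem s d X g :=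
  ⟨hg, fun w hw => by
    rw [← wordDeriv_congr_of_eventuallyEq s w h]
    exact hf.2 w hw⟩

open scoped ContDiff in
theorem comp {h : ℕ → ℝ → ℂ → ℂ} (hh : DerivFamily h) {p : (Fin n → ℝ) → ℝ} (hp0 : ∀ t, 0 < p t)
    (hp : ContDiff ℝ ∞ p) {X : ℕ → Multiset (Fin n) → Set ℂ}
    (hpY : WordMem s d Y (fun t _ => (p t : ℂ)))
    (h0 : ∀ k, h k (p 0) s ∈ Submodule.span ℚ (X k 0))
    (hX : ∀ k i a b, ∀ x ∈ X (k + 1) a, ∀ y ∈ Y (i ::ₘ b), x * y ∈ X k (i ::ₘ (a + b))) (k : ℕ) :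
    WordMem s d (X k) (fun t s => h k (p t) s) := by
  induction d generalizing k with
  | zero =>
    refine ⟨fun K => hh.comp hp0 hp K k, fun w hw => ?_⟩
    obtain rfl : w = [] := List.length_eq_zero_iff.1 (by omega)
    exact h0 k
  | succ d ih =>
    refine ⟨fun K => hh.comp hp0 hp K k, fun w hw => ?_⟩
    cases w with
    | nil => exact h0 k
    | cons i w =>
      rw [wordDeriv, SmoothHol.partialDeriv_eq
        (hh.hasDerivAt_comp hp0 (SmoothHol.of_contDiff hp) k i)]
      exact ((ih (hpY.of_le (Nat.le_succ d)) (k + 1)).mul (Z := fun a => X k (i ::ₘ a))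
        (hpY.partialDeriv i) fun a b x hx y hy => hX k i a b x hx y hy).2 w (by simpa using hw)

end WordMem

theorem hasDerivAt_ofReal_cpow {x : ℝ} (hx : 0 < x) (r : ℂ) :
    HasDerivAt (fun y : ℝ => (y : ℂ) ^ r) (r * (x : ℂ) ^ (r - 1)) x := by
  have h1 : HasDerivAt (fun z : ℂ => z ^ r) (r * (x : ℂ) ^ (r - 1)) (x : ℂ) := by
    simpa using (hasDerivAt_id (x : ℂ)).cpow_const (c := r) (Or.inl (by simpa using hx))
  exact h1.comp_ofReal

theorem continuousOn_ofReal_cpow :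
    ContinuousOn (fun q : ℂ × ℝ => (q.2 : ℂ) ^ q.1) (Set.univ ×ˢ Set.Ioi 0) := by
  refine ContinuousOn.cpow (by fun_prop) (by fun_prop) ?_
  rintro ⟨w, a⟩ ⟨-, ha⟩
  exact Or.inl (by simpa using ha)

theorem differentiable_ofReal_cpow {a : ℝ} (ha : 0 < a) : Differentiable ℂ fun w : ℂ => (a : ℂ) ^ w :=
  fun _ => DifferentiableAt.const_cpow (f := fun w => w) differentiableAt_id
    (Or.inl (by exact_mod_cast ha.ne'))

/-- The Hurwitz series with its first term removed. -/
noncomputable def hurwitzTail (w : ℂ) (a : ℝ) : ℂ := ∑' j : ℕ, ((j + 1 + a : ℝ) : ℂ) ^ (-w)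

theorem norm_hurwitzTail_term_le {σ : ℝ} (hσ : 0 ≤ σ) {w : ℂ} (hw : σ ≤ w.re) {a : ℝ} (ha : 0 ≤ a)
    (j : ℕ) : ‖((j + 1 + a : ℝ) : ℂ) ^ (-w)‖ ≤ (j + 1 : ℝ) ^ (-σ) := by
  have hj : (0 : ℝ) ≤ j := Nat.cast_nonneg j
  rw [norm_cpow_eq_rpow_re_of_pos (by positivity), neg_re]
  calc (j + 1 + a : ℝ) ^ (-w.re) ≤ (j + 1 + a : ℝ) ^ (-σ) :=
        Real.rpow_le_rpow_of_exponent_le (by linarith) (by linarith)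
    _ ≤ (j + 1 : ℝ) ^ (-σ) :=
        Real.rpow_le_rpow_of_nonpos (by positivity) (by linarith) (by linarith)

theorem summable_succ_rpow {σ : ℝ} (hσ : 1 < σ) : Summable fun j : ℕ => (j + 1 : ℝ) ^ (-σ) := by
  have := (summable_nat_add_iff 1).2 (Real.summable_nat_rpow.2 (by linarith : -σ < -1))
  simpa using this

theorem summable_hurwitzTail {w : ℂ} (hw : 1 < w.re) {a : ℝ} (ha : 0 ≤ a) :
    Summable fun j : ℕ => ((j + 1 + a : ℝ) : ℂ) ^ (-w) :=
  Summable.of_norm_bounded (summable_succ_rpow hw) fun j =>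
    norm_hurwitzTail_term_le (by linarith) le_rfl ha j

theorem hasSum_hurwitzTail {w : ℂ} (hw : 1 < w.re) {a : ℝ} (ha : 0 < a) :
    HasSum (fun j : ℕ => ((j + a : ℝ) : ℂ) ^ (-w)) ((a : ℂ) ^ (-w) + hurwitzTail w a) := by
  have h1 : HasSum (fun j : ℕ => (((j + 1 : ℕ) + a : ℝ) : ℂ) ^ (-w)) (hurwitzTail w a) := by
    simpa [hurwitzTail] using (summable_hurwitzTail hw ha.le).hasSum
  have h2 := (hasSum_nat_add_iff (f := fun j : ℕ => ((j + a : ℝ) : ℂ) ^ (-w)) 1).1 h1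
  simpa [add_comm] using h2

theorem exists_re_gt {w : ℂ} (hw : 1 < w.re) : ∃ σ : ℝ, 1 < σ ∧ σ < w.re :=
  exists_between hw

theorem continuousOn_hurwitzTail :
    ContinuousOn (fun q : ℂ × ℝ => hurwitzTail q.1 q.2) ({w | 1 < w.re} ×ˢ Set.Ioi 0) := by
  rintro ⟨w, a⟩ ⟨hw, ha⟩
  obtain ⟨σ, h1, h2⟩ := exists_re_gt hw
  have hc : ContinuousOn (fun q : ℂ × ℝ => hurwitzTail q.1 q.2) ({w | σ < w.re} ×ˢ Set.Ioi 0) := by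
    refine continuousOn_tsum (u := fun j : ℕ => (j + 1 : ℝ) ^ (-σ)) (fun j => ?_)
      (summable_succ_rpow h1) ?_
    · refine continuousOn_ofReal_cpow.comp (f := fun q : ℂ × ℝ => (-q.1, (j + 1 + q.2 : ℝ)))
        (by fun_prop) ?_
      rintro ⟨w, a⟩ ⟨-, ha⟩
      have : (0 : ℝ) < a := ha
      exact ⟨Set.mem_univ _, by simp only [Set.mem_Ioi]; positivity⟩
    · rintro j ⟨w, a⟩ ⟨hw, ha⟩
      exact norm_hurwitzTail_term_le (by linarith) (le_of_lt hw) (le_of_lt ha) j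
  refine (hc.continuousAt ?_).continuousWithinAt
  exact ((isOpen_lt continuous_const continuous_re).prod isOpen_Ioi).mem_nhds ⟨h2, ha⟩

theorem differentiableOn_hurwitzTail {a : ℝ} (ha : 0 ≤ a) :
    DifferentiableOn ℂ (fun w => hurwitzTail w a) {w | 1 < w.re} := by
  intro w hw
  obtain ⟨σ, h1, h2⟩ := exists_re_gt hw
  have hU : IsOpen {w : ℂ | σ < w.re} := isOpen_lt continuous_const continuous_re
  have hd : DifferentiableOn ℂ (fun w => hurwitzTail w a) {w | σ < w.re} := by
    refine differentiableOn_tsum_of_summable_norm (summable_succ_rpow h1) (fun j => ?_) hU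
      fun j w hw => norm_hurwitzTail_term_le (by linarith) (le_of_lt hw) ha j
    exact ((differentiable_ofReal_cpow (by positivity)).comp differentiable_neg).differentiableOn
  exact (hd.differentiableAt (hU.mem_nhds h2)).differentiableWithinAt

theorem hasDerivAt_hurwitzTail {w : ℂ} (hw : 1 < w.re) {a : ℝ} (ha : 0 < a) :
    HasDerivAt (fun a => hurwitzTail w a) (-w * hurwitzTail (w + 1) a) a := by
  have hw1 : 1 < (w + 1).re := by simp; linarith
  have key := hasDerivAt_tsum_of_isPreconnected (𝕜 := ℝ) (t := Set.Ioi (0 : ℝ)) (y₀ := a) (y := a)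
    (g := fun (j : ℕ) (a : ℝ) => ((j + 1 + a : ℝ) : ℂ) ^ (-w))
    (g' := fun (j : ℕ) (a : ℝ) => -w * ((j + 1 + a : ℝ) : ℂ) ^ (-(w + 1)))
    (u := fun j : ℕ => ‖w‖ * (j + 1 : ℝ) ^ (-(w + 1).re))
    ((summable_succ_rpow hw1).mul_left _) isOpen_Ioi isPreconnected_Ioi ?_ ?_
    (Set.mem_Ioi.2 ha) (summable_hurwitzTail hw ha.le) (Set.mem_Ioi.2 ha)
  · rw [tsum_mul_left] at key
    exact key
  · intro j y hy
    have hy' : (0 : ℝ) < j + 1 + y := by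
      have : (0 : ℝ) < y := hy
      positivity
    have h1 := hasDerivAt_ofReal_cpow hy' (-w)
    have h2 : HasDerivAt (fun y : ℝ => (j + 1 + y : ℝ)) 1 y := by
      simpa using (hasDerivAt_id y).const_add (j + 1 : ℝ)
    have h3 := HasDerivAt.scomp y h1 h2
    refine h3.congr_deriv ?_
    rw [one_smul, neg_add']
  · intro j y hy
    rw [norm_mul, norm_neg]
    exact mul_le_mul_of_nonneg_left
      (norm_hurwitzTail_term_le (by linarith) le_rfl (le_of_lt hy) j) (norm_nonneg _)

/-- `(w - 1) ζ(w, a)` on `re w > 1 - K`, by `K` integrations by parts. -/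
noncomputable def hurwitzStep : ℕ → ℂ → ℝ → ℂ
  | 0, w, a => (w - 1) * ((a : ℂ) ^ (-w) + hurwitzTail w a)
  | K + 1, w, a => (a : ℂ) ^ (1 - w) +
      (w - 1) * ∫ η in (0 : ℝ)..1, (1 - η : ℂ) * hurwitzStep K (w + 1) (a + η)

theorem hurwitzStep_properties (K : ℕ) :
    ContinuousOn (fun q : ℂ × ℝ => hurwitzStep K q.1 q.2) ({w | 1 - (K : ℝ) < w.re} ×ˢ Set.Ioi 0) ∧
    (∀ a : ℝ, 0 < a → DifferentiableOn ℂ (fun w => hurwitzStep K w a) {w | 1 - (K : ℝ) < w.re}) ∧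
    ∀ w : ℂ, 1 - (K : ℝ) < w.re → ∀ a : ℝ, 0 < a →
      HasDerivAt (fun a => hurwitzStep K w a) (-(w - 1) * hurwitzStep K (w + 1) a) a := by
  induction K with
  | zero =>
    simp only [Nat.cast_zero, sub_zero, hurwitzStep]
    refine ⟨?_, ?_, ?_⟩
    · refine ContinuousOn.mul (by fun_prop) (ContinuousOn.add ?_ continuousOn_hurwitzTail)
      exact continuousOn_ofReal_cpow.comp (f := fun q : ℂ × ℝ => (-q.1, q.2)) (by fun_prop)
        fun q hq => ⟨Set.mem_univ _, hq.2⟩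
    · intro a ha
      refine DifferentiableOn.mul (by fun_prop) (DifferentiableOn.add ?_
        (differentiableOn_hurwitzTail ha.le))
      exact ((differentiable_ofReal_cpow ha).comp differentiable_neg).differentiableOn
    · intro w hw a ha
      refine (((hasDerivAt_ofReal_cpow ha (-w)).add
        (hasDerivAt_hurwitzTail hw ha)).const_mul (w - 1)).congr_deriv ?_
      rw [neg_add']
      ring
  | succ K ih =>
    obtain ⟨hc, hd, ha'⟩ := ih
    have hU : IsOpen {w : ℂ | 1 - ((K + 1 : ℕ) : ℝ) < w.re} :=
      isOpen_lt continuous_const continuous_re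
    have hshift : ∀ w : ℂ, 1 - ((K + 1 : ℕ) : ℝ) < w.re → 1 - (K : ℝ) < (w + 1).re := by
      intro w hw
      push_cast at hw
      simp only [add_re, one_re]
      linarith
    have hint : ContinuousOn (fun r : (ℂ × ℝ) × ℝ =>
        (1 - r.2 : ℂ) * hurwitzStep K (r.1.1 + 1) (r.1.2 + r.2))
        (({w | 1 - ((K + 1 : ℕ) : ℝ) < w.re} ×ˢ Set.Ioi 0) ×ˢ Set.Icc (0 : ℝ) 1) := by
      refine ContinuousOn.mul (by fun_prop) ?_
      refine hc.comp (f := fun r : (ℂ × ℝ) × ℝ => (r.1.1 + 1, r.1.2 + r.2)) (by fun_prop) ?_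
      rintro ⟨⟨w, a⟩, η⟩ ⟨⟨hw, ha⟩, hη⟩
      exact ⟨hshift w hw, add_pos_of_pos_of_nonneg ha hη.1⟩
    simp only [hurwitzStep]
    refine ⟨?_, ?_, ?_⟩
    · refine ContinuousOn.add ?_ (ContinuousOn.mul (by fun_prop)
        (continuousOn_parametric_integral (F := fun (q : ℂ × ℝ) (η : ℝ) =>
          (1 - η : ℂ) * hurwitzStep K (q.1 + 1) (q.2 + η)) hint))
      exact continuousOn_ofReal_cpow.comp (f := fun q : ℂ × ℝ => (1 - q.1, q.2)) (by fun_prop)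
        fun q hq => ⟨Set.mem_univ _, hq.2⟩
    · intro a ha
      refine DifferentiableOn.add ?_ (DifferentiableOn.mul (by fun_prop)
        (differentiableOn_parametric_integral hU ?_ ?_))
      · exact ((differentiable_ofReal_cpow ha).comp (by fun_prop :
          Differentiable ℂ fun w : ℂ => 1 - w)).differentiableOn
      · exact hint.comp (f := fun r : ℂ × ℝ => ((r.1, a), r.2)) (by fun_prop)
          fun r hr => ⟨⟨hr.1, ha⟩, hr.2⟩
      · intro η hη
        refine DifferentiableOn.const_mul ?_ _
        exact (hd (a + η) (add_pos_of_pos_of_nonneg ha hη.1)).comp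
          (by fun_prop : DifferentiableOn ℂ (fun w : ℂ => w + 1) _) fun w hw => hshift w hw
    · intro w hw a ha
      have hw1 : 1 - ((K + 1 : ℕ) : ℝ) < (w + 1).re := by
        have := hshift w hw
        push_cast
        linarith
      have h1 := hasDerivAt_parametric_integral isOpen_Ioi
        (F := fun a η => (1 - η : ℂ) * hurwitzStep K (w + 1) (a + η))
        (F' := fun a η => (1 - η : ℂ) * (-(w + 1 - 1) * hurwitzStep K (w + 1 + 1) (a + η)))
        (hint.comp (f := fun r : ℝ × ℝ => ((w, r.1), r.2)) (by fun_prop)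
          fun r hr => ⟨⟨hw, hr.1⟩, hr.2⟩) ?_ ?_ (Set.mem_Ioi.2 ha)
      · refine ((hasDerivAt_ofReal_cpow ha (1 - w)).add (h1.const_mul (w - 1))).congr_deriv ?_
        have h2 : ∫ η in (0 : ℝ)..1, (1 - η : ℂ) *
            (-(w + 1 - 1) * hurwitzStep K (w + 1 + 1) (a + η)) =
            -w * ∫ η in (0 : ℝ)..1, (1 - η : ℂ) * hurwitzStep K (w + 1 + 1) (a + η) := by
          rw [← intervalIntegral.integral_const_mul]
          congr 1
          funext η
          ring
        rw [h2]
        have h3 : 1 - (w + 1) = 1 - w - 1 := by ring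
        rw [h3]
        ring
      · have h4 := hint.comp (f := fun r : ℝ × ℝ => ((w + 1, r.1), r.2))
          (s := Set.Ioi (0 : ℝ) ×ˢ Set.Icc (0 : ℝ) 1) (by fun_prop)
          fun r hr => ⟨⟨hw1, hr.1⟩, hr.2⟩
        refine (h4.const_smul (-(w + 1 - 1))).congr fun r _ => ?_
        simp only [Function.uncurry, Function.comp_apply, Pi.smul_apply, smul_eq_mul]
        ring
      · intro x hx η hη
        have h5 := ha' (w + 1) (hshift w hw) (x + η) (add_pos_of_pos_of_nonneg hx hη.1)
        exact (h5.comp_add_const x η).const_mul _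

theorem integral_one_sub_mul_cpow {w : ℂ} (hw : 1 < w.re) {x : ℝ} (hx : 0 < x) :
    ∫ η in (0 : ℝ)..1, (1 - η : ℂ) * (w * ((x + η : ℝ) : ℂ) ^ (-(w + 1))) =
      (x : ℂ) ^ (-w) + (((x + 1 : ℝ) : ℂ) ^ (1 - w) - (x : ℂ) ^ (1 - w)) / (w - 1) := by
  have hw1 : w - 1 ≠ 0 := fun h => by
    have := congrArg re h
    simp at this
    linarith
  have hd : ∀ η ∈ Set.uIcc (0 : ℝ) 1, HasDerivAt (fun η : ℝ =>
      ((x + η : ℝ) : ℂ) ^ (1 - w) / (w - 1) - (1 - η : ℂ) * ((x + η : ℝ) : ℂ) ^ (-w))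
      ((1 - η : ℂ) * (w * ((x + η : ℝ) : ℂ) ^ (-(w + 1)))) η := by
    intro η hη
    rw [Set.uIcc_of_le zero_le_one] at hη
    have hpos : 0 < x + η := add_pos_of_pos_of_nonneg hx hη.1
    have hc : ∀ r : ℂ, HasDerivAt (fun η : ℝ => ((x + η : ℝ) : ℂ) ^ r)
        (r * ((x + η : ℝ) : ℂ) ^ (r - 1)) η := fun r =>
      (hasDerivAt_ofReal_cpow hpos r).comp_const_add x η
    have h1 : HasDerivAt (fun η : ℝ => (1 - η : ℂ)) (-1) η := by
      simpa using (hasDerivAt_id η).ofReal_comp.const_sub 1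
    refine (((hc (1 - w)).div_const (w - 1)).sub (h1.fun_mul (hc (-w)))).congr_deriv ?_
    have e1 : 1 - w - 1 = -w := by ring
    rw [e1, neg_add']
    field_simp
    ring
  have hcont : ContinuousOn (fun η : ℝ => (1 - η : ℂ) * (w * ((x + η : ℝ) : ℂ) ^ (-(w + 1))))
      (Set.uIcc 0 1) := by
    rw [Set.uIcc_of_le zero_le_one]
    refine ContinuousOn.mul (by fun_prop) (ContinuousOn.mul (by fun_prop) ?_)
    exact continuousOn_ofReal_cpow.comp (f := fun η : ℝ => (-(w + 1), x + η)) (by fun_prop)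
      fun η hη => ⟨Set.mem_univ _, add_pos_of_pos_of_nonneg hx hη.1⟩
  rw [intervalIntegral.integral_eq_sub_of_hasDerivAt hd hcont.intervalIntegrable]
  simp
  ring

theorem hurwitzStep_one {w : ℂ} (hw : 1 < w.re) {a : ℝ} (ha : 0 < a) :
    hurwitzStep 1 w a = hurwitzStep 0 w a := by
  have hw1 : w - 1 ≠ 0 := fun h => by
    have := congrArg re h
    simp at this
    linarith
  have hw2 : 1 < (w + 1).re := by
    simp only [add_re, one_re]
    linarith
  have hI : HasSum (fun j : ℕ => ∫ η in (0 : ℝ)..1,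
      (1 - η : ℂ) * (w * ((j + a + η : ℝ) : ℂ) ^ (-(w + 1))))
      (∫ η in (0 : ℝ)..1, (1 - η : ℂ) * hurwitzStep 0 (w + 1) (a + η)) := by
    refine intervalIntegral.hasSum_integral_of_dominated_convergence
      (fun j _ => ‖w‖ * (j + a : ℝ) ^ (-(w + 1).re)) (fun j => ?_) (fun j => ?_) ?_ ?_ ?_
    · refine Measurable.aestronglyMeasurable ?_
      fun_prop
    · refine Eventually.of_forall fun η hη => ?_
      rw [Set.uIoc_of_le zero_le_one] at hη
      have hj : (0 : ℝ) ≤ j := Nat.cast_nonneg j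
      have h0 : 0 < η := hη.1
      have h1 : ‖(1 - η : ℂ)‖ ≤ 1 := by
        rw [← ofReal_one, ← ofReal_sub, norm_real, Real.norm_eq_abs, abs_le]
        constructor <;> linarith [hη.2]
      have h2 : ‖((j + a + η : ℝ) : ℂ) ^ (-(w + 1))‖ ≤ (j + a : ℝ) ^ (-(w + 1).re) := by
        rw [norm_cpow_eq_rpow_re_of_pos (by positivity), neg_re]
        exact Real.rpow_le_rpow_of_nonpos (by positivity) (by linarith) (by linarith)
      rw [norm_mul, norm_mul]
      calc ‖(1 - η : ℂ)‖ * (‖w‖ * ‖((j + a + η : ℝ) : ℂ) ^ (-(w + 1))‖)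
          ≤ 1 * (‖w‖ * (j + a : ℝ) ^ (-(w + 1).re)) := by gcongr
        _ = _ := one_mul _
    · refine Eventually.of_forall fun η _ => Summable.mul_left _ ?_
      have := (hasSum_hurwitzTail hw2 ha).summable.norm
      refine this.congr fun j => ?_
      rw [norm_cpow_eq_rpow_re_of_pos (by positivity), neg_re]
    · exact intervalIntegrable_const
    · refine Eventually.of_forall fun η hη => ?_
      rw [Set.uIoc_of_le zero_le_one] at hη
      have h0 : 0 < a + η := add_pos ha hη.1
      have h1 := ((hasSum_hurwitzTail hw2 h0).mul_left w).mul_left (1 - η : ℂ)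
      simp only [hurwitzStep, add_sub_cancel_right]
      simpa only [add_assoc] using h1
  have hZ := hasSum_hurwitzTail hw ha
  have hD := hI.sub hZ
  have hterm : ∀ j : ℕ, (∫ η in (0 : ℝ)..1,
      (1 - η : ℂ) * (w * ((j + a + η : ℝ) : ℂ) ^ (-(w + 1)))) - ((j + a : ℝ) : ℂ) ^ (-w) =
      ((((j + 1 : ℕ) + a : ℝ) : ℂ) ^ (1 - w) - ((j + a : ℝ) : ℂ) ^ (1 - w)) / (w - 1) := by
    intro j
    rw [integral_one_sub_mul_cpow hw (by positivity)]
    push_cast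
    have : (j : ℂ) + a + 1 = j + 1 + a := by ring
    rw [this]
    ring
  simp only [hterm] at hD
  have hlim : Tendsto (fun j : ℕ => ((j + a : ℝ) : ℂ) ^ (1 - w)) atTop (nhds 0) := by
    rw [tendsto_zero_iff_norm_tendsto_zero]
    have h1 : Tendsto (fun j : ℕ => (j + a : ℝ) ^ (-(w.re - 1))) atTop (nhds 0) :=
      (tendsto_rpow_neg_atTop (by linarith)).comp
        (tendsto_atTop_add_const_right _ a tendsto_natCast_atTop_atTop)
    refine h1.congr fun j => ?_
    rw [norm_cpow_eq_rpow_re_of_pos (by positivity)]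
    simp
  have hS := hD.tendsto_sum_nat
  have hS' : Tendsto (fun N : ℕ => ∑ j ∈ Finset.range N,
      ((((j + 1 : ℕ) + a : ℝ) : ℂ) ^ (1 - w) - ((j + a : ℝ) : ℂ) ^ (1 - w)) / (w - 1)) atTop
      (nhds ((0 - (a : ℂ) ^ (1 - w)) / (w - 1))) := by
    simp only [← Finset.sum_div]
    simp only [Finset.sum_range_sub (fun j : ℕ => ((j + a : ℝ) : ℂ) ^ (1 - w))]
    have := (hlim.sub_const ((a : ℂ) ^ (1 - w))).div_const (w - 1)
    simpa using this
  have heq := tendsto_nhds_unique hS hS'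
  have hrec : hurwitzStep 1 w a = (a : ℂ) ^ (1 - w) +
      (w - 1) * ∫ η in (0 : ℝ)..1, (1 - η : ℂ) * hurwitzStep 0 (w + 1) (a + η) := rfl
  have h0 : hurwitzStep 0 w a = (w - 1) * ((a : ℂ) ^ (-w) + hurwitzTail w a) := rfl
  rw [hrec, h0]
  rw [eq_div_iff hw1] at heq
  linear_combination heq

theorem hurwitzStep_succ (K : ℕ) : ∀ {w : ℂ}, 1 - (K : ℝ) < w.re → ∀ {a : ℝ}, 0 < a →
    hurwitzStep (K + 1) w a = hurwitzStep K w a := by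
  induction K with
  | zero =>
    intro w hw a ha
    exact hurwitzStep_one (by simpa using hw) ha
  | succ K ih =>
    intro w hw a ha
    rw [hurwitzStep, hurwitzStep]
    congr 2
    refine intervalIntegral.integral_congr fun η hη => ?_
    rw [Set.uIcc_of_le zero_le_one] at hη
    have hw1 : 1 - (K : ℝ) < (w + 1).re := by
      push_cast at hw
      simp only [add_re, one_re]
      linarith
    simp only [ih hw1 (add_pos_of_pos_of_nonneg ha hη.1)]

theorem hurwitzStep_of_le {K K' : ℕ} (h : K ≤ K') {w : ℂ} (hw : 1 - (K : ℝ) < w.re) {a : ℝ}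
    (ha : 0 < a) : hurwitzStep K' w a = hurwitzStep K w a := by
  induction K', h using Nat.le_induction with
  | base => rfl
  | succ k hk ih =>
    rw [hurwitzStep_succ k _ ha, ih]
    have : (K : ℝ) ≤ k := by exact_mod_cast hk
    linarith

/-- The entire function `(w - 1) ζ(w, a)` of `w`, for `a > 0`. -/
noncomputable def hurwitzEntire (w : ℂ) (a : ℝ) : ℂ := hurwitzStep (⌊1 - w.re⌋₊ + 1) w a

theorem hurwitzEntire_eq {K : ℕ} {w : ℂ} (hw : 1 - (K : ℝ) < w.re) {a : ℝ} (ha : 0 < a) :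
    hurwitzEntire w a = hurwitzStep K w a := by
  have h1 : 1 - ((⌊1 - w.re⌋₊ + 1 : ℕ) : ℝ) < w.re := by
    have := Nat.lt_floor_add_one (1 - w.re)
    push_cast
    linarith
  unfold hurwitzEntire
  rcases le_total K (⌊1 - w.re⌋₊ + 1) with h | h
  · exact hurwitzStep_of_le h hw ha
  · exact (hurwitzStep_of_le h h1 ha).symm

theorem exists_step (w : ℂ) : ∃ K : ℕ, 1 - (K : ℝ) < w.re := by
  obtain ⟨K, hK⟩ := exists_nat_gt (1 - w.re)
  exact ⟨K, by linarith⟩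

theorem isOpen_step (K : ℕ) : IsOpen {w : ℂ | 1 - (K : ℝ) < w.re} :=
  isOpen_lt continuous_const continuous_re

theorem continuousOn_hurwitzEntire :
    ContinuousOn (fun q : ℂ × ℝ => hurwitzEntire q.1 q.2) (Set.univ ×ˢ Set.Ioi 0) := by
  rintro ⟨w, a⟩ ⟨-, ha⟩
  obtain ⟨K, hK⟩ := exists_step w
  have h1 := ((isOpen_step K).prod isOpen_Ioi).mem_nhds (⟨hK, ha⟩ :
    (w, a) ∈ {w : ℂ | 1 - (K : ℝ) < w.re} ×ˢ Set.Ioi (0 : ℝ))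
  refine (((hurwitzStep_properties K).1.continuousAt h1).congr ?_).continuousWithinAt
  filter_upwards [h1] with q hq
  exact (hurwitzEntire_eq hq.1 hq.2).symm

theorem differentiable_hurwitzEntire {a : ℝ} (ha : 0 < a) :
    Differentiable ℂ fun w => hurwitzEntire w a := by
  intro w
  obtain ⟨K, hK⟩ := exists_step w
  have h1 := (isOpen_step K).mem_nhds (show w ∈ {w : ℂ | 1 - (K : ℝ) < w.re} from hK)
  refine (((hurwitzStep_properties K).2.1 a ha).differentiableAt h1).congr_of_eventuallyEq ?_
  filter_upwards [h1] with q hq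
  exact hurwitzEntire_eq hq ha

theorem hasDerivAt_hurwitzEntire (w : ℂ) {a : ℝ} (ha : 0 < a) :
    HasDerivAt (fun a => hurwitzEntire w a) (-(w - 1) * hurwitzEntire (w + 1) a) a := by
  obtain ⟨K, hK⟩ := exists_step w
  have hK1 : 1 - (K : ℝ) < (w + 1).re := by
    simp only [add_re, one_re]
    linarith
  rw [hurwitzEntire_eq hK1 ha]
  refine ((hurwitzStep_properties K).2.2 w hK a ha).congr_of_eventuallyEq ?_
  filter_upwards [isOpen_Ioi.mem_nhds (Set.mem_Ioi.2 ha)] with b hb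
  exact hurwitzEntire_eq hK hb

theorem hurwitzEntire_of_one_lt {w : ℂ} (hw : 1 < w.re) {a : ℝ} (ha : 0 < a) :
    hurwitzEntire w a = (w - 1) * ((a : ℂ) ^ (-w) + hurwitzTail w a) :=
  hurwitzEntire_eq (K := 0) (by simpa using hw) ha

theorem hurwitzEntire_natCast {w : ℕ} (hw : 2 ≤ w) {a : ℝ} (ha : 0 < a) :
    hurwitzEntire w a = (w - 1) * ∑' j : ℕ, 1 / ((j : ℂ) + a) ^ w := by
  have hw' : 1 < (w : ℂ).re := by
    rw [natCast_re]
    exact_mod_cast hw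
  rw [hurwitzEntire_of_one_lt hw' ha, ← (hasSum_hurwitzTail hw' ha).tsum_eq]
  congr 1
  refine tsum_congr fun j => ?_
  rw [cpow_neg, cpow_natCast]
  push_cast
  rw [one_div]

theorem Differentiable.eq_of_eqOn_re_gt {f g : ℂ → ℂ} (hf : Differentiable ℂ f)
    (hg : Differentiable ℂ g) (h : ∀ w : ℂ, 1 < w.re → f w = g w) : f = g := by
  have h2 : (2 : ℂ) ∈ {w : ℂ | 1 < w.re} := by simp
  have h1 : f =ᶠ[nhds 2] g := by
    filter_upwards [(isOpen_lt continuous_const continuous_re).mem_nhds h2] with w hw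
    exact h w hw
  funext w
  exact AnalyticOnNhd.eqOn_of_preconnected_of_eventuallyEq
    (fun z _ => hf.analyticAt z) (fun z _ => hg.analyticAt z)
    isPreconnected_univ (Set.mem_univ _) h1 (Set.mem_univ w)

theorem hurwitzEntire_eq_add (w : ℂ) {a : ℝ} (ha : 0 < a) :
    hurwitzEntire w a = (w - 1) * (a : ℂ) ^ (-w) + hurwitzEntire w (1 + a) := by
  have ha1 : 0 < 1 + a := by linarith
  refine congrFun (Differentiable.eq_of_eqOn_re_gt (differentiable_hurwitzEntire ha)
    (g := fun w => (w - 1) * (a : ℂ) ^ (-w) + hurwitzEntire w (1 + a)) ?_ ?_) w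
  · exact (Differentiable.mul (by fun_prop)
      ((differentiable_ofReal_cpow ha).comp differentiable_neg)).add
      (differentiable_hurwitzEntire ha1)
  · intro w hw
    rw [hurwitzEntire_of_one_lt hw ha, hurwitzEntire_of_one_lt hw ha1,
      ← (hasSum_hurwitzTail hw ha1).tsum_eq, hurwitzTail, mul_add]
    congr 3
    funext j
    congr 2
    ring

theorem hurwitzZeta_eq_of_hasSum {a b : ℝ} (ha : a ∈ Set.Icc (0 : ℝ) 1) (hb : 0 < b)
    (h : ∀ w : ℂ, 1 < w.re →
      HasSum (fun n : ℕ => 1 / ((n : ℂ) + a) ^ w) ((b : ℂ) ^ (-w) + hurwitzTail w b))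
    {w : ℂ} (hw : w ≠ 1) :
    hurwitzZeta (a : UnitAddCircle) w = hurwitzEntire w b / (w - 1) := by
  have hw1 : w - 1 ≠ 0 := sub_ne_zero.2 hw
  rw [eq_div_iff hw1]
  have hU : IsOpen ({1}ᶜ : Set ℂ) := isOpen_compl_singleton
  have hpre : IsPreconnected ({1}ᶜ : Set ℂ) :=
    (isConnected_compl_singleton_of_one_lt_rank (by simp) 1).isPreconnected
  have h1 : DifferentiableOn ℂ (fun w => hurwitzZeta (a : UnitAddCircle) w * (w - 1)) {1}ᶜ :=
    fun z hz => ((differentiableAt_hurwitzZeta _ hz).mul (by fun_prop)).differentiableWithinAt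
  have h2 : (2 : ℂ) ∈ {w : ℂ | 1 < w.re} := by simp
  refine AnalyticOnNhd.eqOn_of_preconnected_of_eventuallyEq (h1.analyticOnNhd hU)
    (fun z _ => (differentiable_hurwitzEntire hb).analyticAt z) hpre (z₀ := 2) (by simp) ?_ hw
  filter_upwards [(isOpen_lt continuous_const continuous_re).mem_nhds h2] with z hz
  have h3 := (hasSum_hurwitzZeta_of_one_lt_re ha hz).unique (h z hz)
  rw [h3, hurwitzEntire_of_one_lt hz hb]
  ring

theorem hurwitzZeta_eq_of_pos {a : ℝ} (ha : 0 < a) (ha1 : a ≤ 1) {w : ℂ} (hw : w ≠ 1) :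
    hurwitzZeta (a : UnitAddCircle) w = hurwitzEntire w a / (w - 1) := by
  refine hurwitzZeta_eq_of_hasSum ⟨ha.le, ha1⟩ ha (fun w hw => ?_) hw
  refine (hasSum_hurwitzTail hw ha).congr_fun fun j => ?_
  rw [cpow_neg, one_div]
  push_cast
  rfl

theorem hurwitzZeta_zero_eq {w : ℂ} (hw : w ≠ 1) :
    hurwitzZeta ((0 : ℝ) : UnitAddCircle) w = hurwitzEntire w 1 / (w - 1) := by
  refine hurwitzZeta_eq_of_hasSum (by simp) one_pos (fun w hw => ?_) hw
  have h1 := hasSum_hurwitzTail hw one_pos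
  have hw0 : w ≠ 0 := by
    rintro rfl
    simp at hw
    linarith
  have h2 : HasSum (fun n : ℕ => 1 / (((n + 1 : ℕ) : ℂ) + ((0 : ℝ) : ℂ)) ^ w)
      (((1 : ℝ) : ℂ) ^ (-w) + hurwitzTail w 1) := by
    refine h1.congr_fun fun j => ?_
    rw [cpow_neg, one_div]
    push_cast
    simp
  have h3 := (hasSum_nat_add_iff (f := fun n : ℕ => 1 / ((n : ℂ) + ((0 : ℝ) : ℂ)) ^ w) 1).1 h2
  simpa [zero_cpow hw0] using h3

/-- For `re w < 0`, the Hurwitz zeta function at `a ∈ [0, 1]` with its first term split off. -/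
theorem hurwitzZeta_eq_cpow_add {a : ℝ} (ha : a ∈ Set.Icc (0 : ℝ) 1) {w : ℂ} (hw : w.re < 0) :
    hurwitzZeta (a : UnitAddCircle) w =
      (a : ℂ) ^ (-w) + hurwitzEntire w (1 + a) / (w - 1) := by
  have hw1 : w ≠ 1 := by
    rintro rfl
    simp at hw
    linarith
  have hw0 : -w ≠ 0 := by
    intro h
    rw [neg_eq_zero] at h
    simp [h] at hw
  rcases ha.1.eq_or_lt with rfl | h0
  · rw [hurwitzZeta_zero_eq hw1, ofReal_zero, zero_cpow hw0, zero_add, add_zero]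
  · rw [hurwitzZeta_eq_of_pos h0 ha.2 hw1, hurwitzEntire_eq_add w h0, add_div,
      mul_div_cancel_left₀ _ (sub_ne_zero.2 hw1)]

open scoped ContDiff in
theorem exists_contDiff_pos_of_le {n : ℕ} {q : (Fin n → ℝ) → ℝ} (hq : ContDiff ℝ ∞ q) {c : ℝ}
    (hc : 0 < c) : ∃ p : (Fin n → ℝ) → ℝ, ContDiff ℝ ∞ p ∧ (∀ t, 0 < p t) ∧
      ∀ t, c ≤ q t → p t = q t := by
  set χ : (Fin n → ℝ) → ℝ := fun t => Real.smoothTransition (2 * q t / c - 1) with hχ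
  have hχs : ContDiff ℝ ∞ χ := Real.smoothTransition.contDiff.comp (by fun_prop)
  refine ⟨fun t => q t * χ t + (1 - χ t) * c, by fun_prop, fun t => ?_, fun t ht => ?_⟩
  · by_cases h : q t ≤ c / 2
    · have h1 : χ t = 0 := Real.smoothTransition.zero_of_nonpos (by
        rw [sub_nonpos, div_le_one hc]
        linarith)
      simp only [h1]
      linarith
    · have h0 : 0 ≤ χ t := Real.smoothTransition.nonneg _
      have h1 : χ t ≤ 1 := Real.smoothTransition.le_one _
      have h2 : 0 < q t - c / 2 := by linarith [not_le.1 h]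
      show 0 < q t * χ t + (1 - χ t) * c
      nlinarith [mul_nonneg h0 h2.le, mul_nonneg (sub_nonneg.2 h1) hc.le]
  · have h1 : χ t = 1 := Real.smoothTransition.one_of_one_le (by
      rw [le_sub_iff_add_le, le_div_iff₀ hc]
      linarith)
    simp [h1]

theorem derivFamily_hurwitzEntire : DerivFamily fun k a s =>
    (∏ i ∈ Finset.range k, (s - i)) * hurwitzEntire (1 - s + k) a where
  cont k := by
    refine ContinuousOn.mul (Continuous.continuousOn (by fun_prop)) ?_
    have h := continuousOn_hurwitzEntire
    exact h.comp (f := fun p : ℝ × ℂ => ((1 - p.2 + k : ℂ), p.1)) (by fun_prop)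
      fun p hp => ⟨Set.mem_univ _, hp.1⟩
  entire k a ha := by
    refine Differentiable.mul (by fun_prop) ?_
    exact (differentiable_hurwitzEntire ha).comp (by fun_prop)
  deriv k a ha s := by
    refine ((hasDerivAt_hurwitzEntire (1 - s + k) ha).const_mul
      (∏ i ∈ Finset.range k, (s - i))).congr_deriv ?_
    rw [Finset.prod_range_succ]
    push_cast
    rw [show 1 - s + ((k : ℂ) + 1) = 1 - s + k + 1 by ring]
    ring

theorem derivFamily_cpow : DerivFamily fun k a s =>
    (∏ i ∈ Finset.range k, (s - 1 - i)) * (a : ℂ) ^ (s - 1 - k) where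
  cont k := by
    refine ContinuousOn.mul (Continuous.continuousOn (by fun_prop)) ?_
    exact continuousOn_ofReal_cpow.comp (f := fun p : ℝ × ℂ => ((p.2 - 1 - k : ℂ), p.1))
      (by fun_prop) fun p hp => ⟨Set.mem_univ _, hp.1⟩
  entire k a ha := by
    refine Differentiable.mul (by fun_prop) ?_
    exact (differentiable_ofReal_cpow ha).comp (by fun_prop)
  deriv k a ha s := by
    refine ((hasDerivAt_ofReal_cpow ha (s - 1 - k)).const_mul
      (∏ i ∈ Finset.range k, (s - 1 - i))).congr_deriv ?_
    rw [Finset.prod_range_succ]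
    push_cast
    rw [show s - 1 - ((k : ℂ) + 1) = s - 1 - k - 1 by ring]
    ring

/-- The coordinates with index in `[a, b)`. -/
def window (n a b : ℕ) : Finset (Fin n) := Finset.univ.filter fun i => a ≤ i.val ∧ i.val < b

theorem mem_window {n a b : ℕ} {i : Fin n} : i ∈ window n a b ↔ a ≤ i.val ∧ i.val < b := by
  simp [window]

/-- Coefficients of the staircase polynomial attached to the values `G`. -/
def stairCoeff (G : ℕ → ℚ) (e : ℕ) : ℕ → ℚ
  | 0 => G e
  | l + 1 => G (e + l + 1) - G (e + l)

/-- The staircase polynomial `G e + ∑ (G l - G (l-1)) t_e ⋯ t_{l-1}`. -/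
noncomputable def stair {n : ℕ} (G : ℕ → ℚ) (e : ℕ) (t : Fin n → ℝ) : ℝ :=
  ∑ l ∈ Finset.range (n - e + 1), (stairCoeff G e l : ℝ) * ∏ i ∈ window n e (e + l), t i

open scoped ContDiff in
theorem contDiff_stair {n : ℕ} (G : ℕ → ℚ) (e : ℕ) :
    ContDiff ℝ ∞ (stair G e : (Fin n → ℝ) → ℝ) := by
  unfold stair
  fun_prop

theorem window_self (n a : ℕ) : window n a a = ∅ := by
  ext i
  simp [mem_window]

theorem stair_zero {n : ℕ} (G : ℕ → ℚ) (e : ℕ) : stair G e (0 : Fin n → ℝ) = G e := by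
  rw [stair, Finset.sum_range_succ', Finset.sum_eq_zero, zero_add]
  · simp [window_self, stairCoeff]
  · intro l hl
    rw [Finset.mem_range] at hl
    rw [Finset.prod_eq_zero (i := (⟨e, by omega⟩ : Fin n)) (mem_window.2 ⟨le_rfl, by
      show e < e + (l + 1); omega⟩) rfl, mul_zero]

theorem le_stair {n : ℕ} {G : ℕ → ℚ} {e : ℕ} {c : ℚ} (hc : ∀ l, e ≤ l → c ≤ G l)
    {t : Fin n → ℝ} (ht : ∀ i, t i ∈ Set.Icc (0 : ℝ) 1) : (c : ℝ) ≤ stair G e t := by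
  set P : ℕ → ℝ := fun l => ∏ i ∈ window n e (e + l), t i with hP
  have hP0 : ∀ l, 0 ≤ P l := fun l => Finset.prod_nonneg fun i _ => (ht i).1
  have hP1 : P 0 = 1 := by simp [hP, window_self]
  have hPs : ∀ l, P (l + 1) ≤ P l := fun l => by
    have hsub : window n e (e + l) ⊆ window n e (e + (l + 1)) := fun i hi => by
      rw [mem_window] at hi ⊢
      exact ⟨hi.1, by omega⟩
    simp only [hP]
    rw [← Finset.prod_sdiff hsub]
    exact mul_le_of_le_one_left (hP0 l)
      (Finset.prod_le_one (fun i _ => (ht i).1) fun i _ => (ht i).2)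
  have hcR : ∀ l, e ≤ l → (c : ℝ) ≤ G l := fun l hl => by exact_mod_cast hc l hl
  have key : ∀ D : ℕ, (c : ℝ) * (1 - P D) + G (e + D) * P D ≤
      ∑ l ∈ Finset.range (D + 1), (stairCoeff G e l : ℝ) * P l := by
    intro D
    induction D with
    | zero => simp [hP1, stairCoeff]
    | succ D ih =>
      rw [Finset.sum_range_succ, show stairCoeff G e (D + 1) = G (e + D + 1) - G (e + D) from rfl,
        Rat.cast_sub]
      have h1 := hcR (e + D) (by omega)
      have h2 := mul_nonneg (sub_nonneg.2 h1) (sub_nonneg.2 (hPs D))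
      rw [← add_assoc]
      nlinarith
  refine le_trans ?_ (key (n - e))
  have h1 := mul_nonneg (sub_nonneg.2 (hcR (e + (n - e)) (by omega))) (hP0 (n - e))
  nlinarith

/-- Every index other than `e` occurs at most as often as the one before it. -/
def StairBalanced {n : ℕ} (e : ℕ) (a : Multiset (Fin n)) : Prop :=
  ∀ i i' : Fin n, i'.val = i.val + 1 → i'.val ≠ e → a.count i' ≤ a.count i

theorem StairBalanced.zero {n : ℕ} (e : ℕ) : StairBalanced e (0 : Multiset (Fin n)) := by
  simp [StairBalanced]

theorem StairBalanced.add {n e : ℕ} {a b : Multiset (Fin n)} (ha : StairBalanced e a) (hb : StairBalanced e b) :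
    StairBalanced e (a + b) := fun i i' h h' => by
  rw [Multiset.count_add, Multiset.count_add]
  exact add_le_add (ha i i' h h') (hb i i' h h')

theorem count_val_eq {n : ℕ} (S : Finset (Fin n)) (i : Fin n) :
    S.val.count i = if i ∈ S then 1 else 0 := by
  split_ifs with h
  · exact Multiset.count_eq_one_of_mem S.nodup h
  · exact Multiset.count_eq_zero_of_notMem h

theorem balanced_window {n : ℕ} (e b : ℕ) : StairBalanced e (window n e b).val := fun i i' h h' => by
  rw [count_val_eq, count_val_eq]
  simp only [mem_window]
  split_ifs with h1 h2 <;> omega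

/-- Admissible values of the derivatives of the Hurwitz factor. -/
def hurwitzValues {n : ℕ} (m : ℕ) (i₀ : Fin n) (b : ℝ) (k : ℕ) (a : Multiset (Fin n)) : Set ℂ :=
  {z | z = ∑' j : ℕ, 1 / ((j : ℂ) + b) ^ (m + 1 + k + a.count i₀) ∧ StairBalanced 0 a}

/-- Admissible values of the derivatives of a unit factor starting at the index `e`. -/
def unitValues {n : ℕ} (i₀ : Fin n) (e : ℕ) (a : Multiset (Fin n)) : Set ℂ :=
  {z | z = 1 ∧ a.count i₀ = 0 ∧ StairBalanced e a}

theorem exists_pos_le_of_min {n : ℕ} {G : ℕ → ℚ} {e : ℕ} (he : e ≤ n) (hG : ∀ l, e ≤ l → 0 < G l)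
    (hGn : ∀ l, n ≤ l → G l = G n) : ∃ c : ℚ, 0 < c ∧ ∀ l, e ≤ l → c ≤ G l := by
  obtain ⟨l₀, hl₀, h⟩ := (Finset.Icc e n).exists_min_image G ⟨e, by simp [he]⟩
  refine ⟨G l₀, hG _ (Finset.mem_Icc.1 hl₀).1, fun l hl => ?_⟩
  rcases le_total l n with hln | hln
  · exact h l (Finset.mem_Icc.2 ⟨hl, hln⟩)
  · rw [hGn l hln]
    exact h n (Finset.mem_Icc.2 ⟨he, le_rfl⟩)

theorem wordMem_stair {n : ℕ} (s : ℂ) (d : ℕ) (G : ℕ → ℚ) (e : ℕ) :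
    WordMem s d (fun a => {z | z = 1 ∧ ∃ l, a = (window n e (e + l)).val})
      (fun t _ => ((stair G e t : ℝ) : ℂ)) :=
  (WordMem.polynomial (Finset.range (n - e + 1)) (stairCoeff G e)
    (fun l => window n e (e + l))).mono fun _ _ ⟨h, l, _, hl⟩ => ⟨h, l, hl⟩

theorem exists_smooth_stair {n : ℕ} {G : ℕ → ℚ} {e : ℕ} (he : e ≤ n) (hG : ∀ l, e ≤ l → 0 < G l)
    (hGn : ∀ l, n ≤ l → G l = G n) : ∃ p : (Fin n → ℝ) → ℝ, ContDiff ℝ (⊤ : ℕ∞) p ∧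
      (∀ t, 0 < p t) ∧ p 0 = G e ∧ (∀ t : Fin n → ℝ, (∀ i, t i ∈ Set.Icc (0 : ℝ) 1) → p t = stair G e t) ∧
      ∀ s d, WordMem s d (fun a => {z | z = 1 ∧ ∃ l, a = (window n e (e + l)).val})
        (fun t _ => ((p t : ℝ) : ℂ)) := by
  obtain ⟨c, hc, hcG⟩ := exists_pos_le_of_min he hG hGn
  obtain ⟨p, hp, hp0, hpq⟩ := exists_contDiff_pos_of_le (contDiff_stair (n := n) G e)
    (c := (c : ℝ) / 2) (by positivity)
  have hcR : (0 : ℝ) < c := by exact_mod_cast hc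
  have h0 : (c : ℝ) ≤ stair G e (0 : Fin n → ℝ) := le_stair hcG (by simp)
  refine ⟨p, hp, hp0, ?_, fun t ht => hpq t ?_, fun s d => ?_⟩
  · rw [hpq 0 (by linarith), stair_zero]
  · have := le_stair hcG ht
    linarith
  · refine (wordMem_stair s d G e).congr_of_eventuallyEq (fun K => SmoothHol.of_contDiff hp) ?_
    have hcont : Continuous (stair G e : (Fin n → ℝ) → ℝ) := (contDiff_stair G e).continuous
    filter_upwards [hcont.continuousAt.eventually (lt_mem_nhds (a := (c : ℝ) / 2) (by linarith))]
      with t ht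
    funext s
    rw [hpq t (le_of_lt ht)]

theorem exists_hurwitz_factor {n : ℕ} {i₀ : Fin n} (hi₀ : i₀.val = 0) {G : ℕ → ℚ}
    (hG : ∀ l, 0 < G l) (hGn : ∀ l, n ≤ l → G l = G n) :
    ∃ φ : (Fin n → ℝ) → ℂ → ℂ,
      (∀ t : Fin n → ℝ, (∀ i, t i ∈ Set.Icc (0 : ℝ) 1) → ∀ s, φ t s = hurwitzEntire (1 - s) (stair G 0 t)) ∧
      ∀ m d : ℕ, 0 < m → WordMem (-(m : ℂ)) d (hurwitzValues m i₀ (G 0) 0) φ := by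
  obtain ⟨p, hp, hp0, hpG, hpq, hpY⟩ := exists_smooth_stair (n := n) (Nat.zero_le _)
    (fun l _ => hG l) hGn
  refine ⟨fun t s => hurwitzEntire (1 - s) (p t), fun t ht s => by simp only [hpq t ht], fun m d hm => ?_⟩
  have := WordMem.comp derivFamily_hurwitzEntire hp0 hp (hpY (-(m : ℂ)) d)
    (X := hurwitzValues m i₀ (G 0)) (fun k => ?_) ?_ 0
  · simpa using this
  · rw [hpG, show (1 - -(m : ℂ) + k) = ((m + 1 + k : ℕ) : ℂ) by push_cast; ring,
      hurwitzEntire_natCast (by omega) (by exact_mod_cast hG 0), ← mul_assoc]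
    have := Submodule.smul_mem (Submodule.span ℚ (hurwitzValues m i₀ (G 0) k 0))
      ((∏ i ∈ Finset.range k, (-(m : ℚ) - i)) * (((m + 1 + k : ℕ) : ℚ) - 1))
      (Submodule.subset_span (⟨rfl, StairBalanced.zero 0⟩))
    rw [Rat.smul_def] at this
    push_cast at this ⊢
    simpa using this
  · rintro k i a b x ⟨rfl, ha⟩ y ⟨rfl, l, hl⟩
    have hi : i ∈ window n 0 (0 + l) := by
      rw [← Finset.mem_val, ← hl]
      exact Multiset.mem_cons_self _ _
    rw [← Multiset.add_cons, hl]
    refine ⟨?_, ha.add (balanced_window 0 _)⟩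
    rw [mul_one, Multiset.count_add, count_val_eq, if_pos]
    · refine tsum_congr fun j => ?_
      congr 2
      ring
    · rw [mem_window] at hi ⊢
      omega

theorem exists_unit_factor {n : ℕ} {i₀ : Fin n} (hi₀ : i₀.val = 0) {G : ℕ → ℚ} {e : ℕ} (he : e ≤ n)
    (he1 : 1 ≤ e) (hG : ∀ l, e ≤ l → 0 < G l) (hGn : ∀ l, n ≤ l → G l = G n) :
    ∃ φ : (Fin n → ℝ) → ℂ → ℂ,
      (∀ t : Fin n → ℝ, (∀ i, t i ∈ Set.Icc (0 : ℝ) 1) → ∀ s, φ t s = ((stair G e t : ℝ) : ℂ) ^ (s - 1)) ∧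
      ∀ m d : ℕ, WordMem (-(m : ℂ)) d (unitValues i₀ e) φ := by
  obtain ⟨p, hp, hp0, hpG, hpq, hpY⟩ := exists_smooth_stair he hG hGn
  refine ⟨fun t s => (p t : ℂ) ^ (s - 1), fun t ht s => by simp only [hpq t ht], fun m d => ?_⟩
  have := WordMem.comp derivFamily_cpow hp0 hp (hpY (-(m : ℂ)) d)
    (X := fun _ => unitValues i₀ e) (fun k => ?_) ?_ 0
  · simpa using this
  · rw [hpG, show (-(m : ℂ) - 1 - k) = -((m + 1 + k : ℕ) : ℂ) by push_cast; ring, cpow_neg,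
      cpow_natCast]
    have := Submodule.smul_mem (Submodule.span ℚ (unitValues i₀ e 0))
      ((∏ i ∈ Finset.range k, (-(m : ℚ) - 1 - i)) * ((G e) ^ (m + 1 + k))⁻¹)
      (Submodule.subset_span (⟨rfl, by simp, StairBalanced.zero e⟩))
    rw [Rat.smul_def] at this
    push_cast at this ⊢
    simpa using this
  · rintro k i a b x ⟨rfl, ha0, ha⟩ y ⟨rfl, l, hl⟩
    rw [← Multiset.add_cons, hl]
    refine ⟨mul_one _, ?_, ha.add (balanced_window e _)⟩
    rw [Multiset.count_add, ha0, count_val_eq, if_neg, zero_add]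
    rw [mem_window]
    omega

/-- The product of the coordinates with index less than `k`. -/
def prefixProd {n : ℕ} (t : Fin n → ℝ) (k : ℕ) : ℝ := ∏ i ∈ window n 0 k, t i

theorem window_succ {n k : ℕ} (h : k < n) : window n 0 (k + 1) = insert ⟨k, h⟩ (window n 0 k) := by
  ext i
  simp only [mem_window, Finset.mem_insert, Fin.ext_iff]
  omega

theorem prefixProd_zero {n : ℕ} (t : Fin n → ℝ) : prefixProd t 0 = 1 := by
  simp [prefixProd, window_self]

theorem prefixProd_succ {n k : ℕ} (t : Fin n → ℝ) (h : k < n) :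
    prefixProd t (k + 1) = prefixProd t k * t ⟨k, h⟩ := by
  rw [prefixProd, window_succ h, Finset.prod_insert (by simp [mem_window]), mul_comm, prefixProd]

/-- The map `t ↦ (t₀, t₀ t₁, …, t₀ ⋯ t_{n-1})`. -/
def prefixMap {n : ℕ} (t : Fin n → ℝ) : Fin n → ℝ := fun l => prefixProd t (l + 1)

/-- The sequence `1, y₀, …, y_{n-1}, 0, 0, …`. -/
def extendSeq {n : ℕ} (y : Fin n → ℝ) : ℕ → ℝ
  | 0 => 1
  | l + 1 => if h : l < n then y ⟨l, h⟩ else 0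

/-- The open simplex `1 > y₀ > ⋯ > y_{n-1} > 0`. -/
def orderSimplex (n : ℕ) : Set (Fin n → ℝ) := {y | ∀ k ≤ n, extendSeq y (k + 1) < extendSeq y k}

theorem extendSeq_succ {n k : ℕ} (y : Fin n → ℝ) (h : k < n) : extendSeq y (k + 1) = y ⟨k, h⟩ := dif_pos h

theorem extendSeq_last {n : ℕ} (y : Fin n → ℝ) : extendSeq y (n + 1) = 0 := dif_neg (lt_irrefl n)

theorem extendSeq_prefixMap {n k : ℕ} (t : Fin n → ℝ) (h : k ≤ n) :
    extendSeq (prefixMap t) k = prefixProd t k := by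
  cases k with
  | zero => rw [prefixProd_zero]; rfl
  | succ k => rw [extendSeq_succ _ h]; rfl

theorem extendSeq_injective {n : ℕ} {y y' : Fin n → ℝ}
    (h : ∀ k ≤ n, extendSeq y k - extendSeq y (k + 1) = extendSeq y' k - extendSeq y' (k + 1)) : y = y' := by
  have key : ∀ k ≤ n, extendSeq y k = extendSeq y' k := by
    intro k
    induction k with
    | zero => intro _; rfl
    | succ k ih =>
      intro hk
      linarith [h k (by omega), ih (by omega)]
  funext l
  simpa [extendSeq_succ _ l.2] using key (l + 1) l.2

theorem prefixProd_pos {n : ℕ} {t : Fin n → ℝ} (ht : ∀ i, 0 < t i) (k : ℕ) : 0 < prefixProd t k :=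
  Finset.prod_pos fun i _ => ht i

theorem injOn_prefixMap (n : ℕ) :
    Set.InjOn (prefixMap : (Fin n → ℝ) → _) (Set.univ.pi fun _ => Set.Ioo 0 1) := by
  intro t ht t' _ h
  simp only [Set.mem_pi, Set.mem_univ, true_implies] at ht
  funext l
  have h1 : ∀ k ≤ n, prefixProd t k = prefixProd t' k := fun k hk => by
    rw [← extendSeq_prefixMap t hk, h, extendSeq_prefixMap t' hk]
  have h2 := h1 (l + 1) l.2
  rw [prefixProd_succ t l.2, prefixProd_succ t' l.2, ← h1 l l.2.le] at h2
  exact mul_left_cancel₀ (prefixProd_pos (fun i => (ht i).1) _).ne' h2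

theorem extendSeq_pos {n : ℕ} {y : Fin n → ℝ} (hy : y ∈ orderSimplex n) {k : ℕ} (hk : k ≤ n) :
    0 < extendSeq y k := by
  induction hk using Nat.decreasingInduction with
  | of_succ k hk ih => exact ih.trans (hy k hk.le)
  | self => simpa [extendSeq_last] using hy n le_rfl

theorem image_prefixMap (n : ℕ) :
    prefixMap '' (Set.univ.pi fun _ : Fin n => Set.Ioo (0 : ℝ) 1) = orderSimplex n := by
  ext y
  constructor
  · rintro ⟨t, ht, rfl⟩ k hk
    simp only [Set.mem_pi, Set.mem_univ, true_implies] at ht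
    have hpos := prefixProd_pos (fun i => (ht i).1)
    rw [extendSeq_prefixMap t hk]
    rcases hk.lt_or_eq with h | rfl
    · rw [extendSeq_prefixMap t h, prefixProd_succ t h]
      exact mul_lt_of_lt_one_right (hpos k) (ht _).2
    · rw [extendSeq_last]
      exact hpos _
  · intro hy
    refine ⟨fun l => extendSeq y (l + 1) / extendSeq y l, ?_, ?_⟩
    · intro l _
      have h0 := extendSeq_pos hy l.2.le
      exact ⟨div_pos (extendSeq_pos hy l.2) h0, (div_lt_one h0).2 (hy l l.2.le)⟩
    · have key : ∀ k ≤ n, prefixProd (fun l : Fin n => extendSeq y (l + 1) / extendSeq y l) k =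
          extendSeq y k := by
        intro k
        induction k with
        | zero => intro _; rw [prefixProd_zero]; rfl
        | succ k ih =>
          intro hk
          rw [prefixProd_succ _ hk, ih (by omega), mul_div_cancel₀]
          exact (extendSeq_pos hy (by omega)).ne'
      funext l
      rw [prefixMap, key _ l.2, extendSeq_succ _ l.2]

/-- The Jacobian matrix of `prefixMap`. -/
def prefixJacobian {n : ℕ} (t : Fin n → ℝ) : Matrix (Fin n) (Fin n) ℝ := fun l i =>
  if i ≤ l then ∏ j ∈ (window n 0 (l + 1)).erase i, t j else 0

theorem hasFDerivAt_prefixMap {n : ℕ} (t : Fin n → ℝ) :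
    HasFDerivAt prefixMap (LinearMap.toContinuousLinearMap (Matrix.toLin' (prefixJacobian t))) t := by
  rw [hasFDerivAt_pi']
  intro l
  have := HasFDerivAt.finsetProd (𝕜 := ℝ) (u := window n 0 (l + 1)) (x := t)
    (g := fun i (t : Fin n → ℝ) => t i) (g' := fun i => ContinuousLinearMap.proj i)
    fun i _ => hasFDerivAt_apply i t
  refine this.congr_fderiv ?_
  ext x
  simp only [sum_apply, smul_apply, smul_eq_mul,
    ContinuousLinearMap.proj_apply, ContinuousLinearMap.comp_apply,
    LinearMap.coe_toContinuousLinearMap', Matrix.toLin'_apply, Matrix.mulVec, dotProduct,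
    prefixJacobian, ite_mul, zero_mul]
  rw [← Finset.sum_filter]
  refine Finset.sum_congr ?_ fun _ _ => rfl
  ext i
  simp only [mem_window, Finset.mem_filter, Finset.mem_univ, true_and, Fin.le_def]
  omega

theorem det_prefixJacobian {n : ℕ} (t : Fin n → ℝ) :
    (prefixJacobian t).det = ∏ i, t i ^ (n - 1 - i.val) := by
  have htri : (prefixJacobian t).IsLowerTriangular := fun i j hij => if_neg (not_le.2 hij)
  rw [Matrix.det_of_isLowerTriangular _ htri]
  have : ∀ l : Fin n, prefixJacobian t l l = ∏ i, if i.val < l.val then t i else 1 := fun l => by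
    rw [prefixJacobian, if_pos le_rfl, ← Finset.prod_filter]
    refine Finset.prod_congr ?_ fun _ _ => rfl
    ext i
    simp only [mem_window, Finset.mem_filter, Finset.mem_univ, true_and, Finset.mem_erase, ne_eq,
      Fin.ext_iff]
    omega
  simp_rw [this]
  rw [Finset.prod_comm]
  refine Finset.prod_congr rfl fun i _ => ?_
  rw [Finset.prod_ite, Finset.prod_const, Finset.prod_const_one, mul_one]
  congr 1
  have : Finset.univ.filter (fun l : Fin n => i.val < l.val) = Finset.Ioi i := by
    ext l
    simp
  rw [this, Fin.card_Ioi]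

/-- An affine function in coordinates. -/
def IsAffineFun {n : ℕ} (g : (Fin n → ℝ) → ℝ) : Prop :=
  ∃ (a : Fin n → ℝ) (c : ℝ), ∀ x, g x = c + ∑ i, a i * x i

theorem AffineMap.isAffineFun {n : ℕ} (f : (Fin n → ℝ) →ᵃ[ℝ] ℝ) : IsAffineFun f := by
  refine ⟨fun i => f.linear (Pi.single i 1), f 0, fun x => ?_⟩
  have h1 := congrFun f.decomp x
  rw [Pi.add_apply] at h1
  rw [h1, add_comm, LinearMap.pi_apply_eq_sum_univ f.linear x]
  refine congrArg _ (Finset.sum_congr rfl fun i _ => ?_)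
  rw [smul_eq_mul, mul_comm]
  congr 2
  funext j
  rw [Pi.single_apply]
  simp only [eq_comm]

/-- The average of the vertices of index at most `l`. -/
noncomputable def prefixMean {n : ℕ} (u : Fin (n + 1) → Fin n → ℝ) (l : ℕ) : Fin n → ℝ := fun i =>
  (∑ k : Fin (n + 1), if k.val ≤ min l n then u k i else 0) / ((min l n : ℕ) + 1)

theorem card_fin_le {n l : ℕ} (h : l ≤ n) :
    (Finset.univ.filter fun k : Fin (n + 1) => k.val ≤ l).card = l + 1 := by
  have : (Finset.univ.filter fun k : Fin (n + 1) => k.val ≤ l) = Finset.Iic ⟨l, by omega⟩ := by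
    ext k
    simp [Fin.le_def]
  rw [this, Fin.card_Iic]

theorem IsAffineFun.apply_prefixMean {n : ℕ} {g : (Fin n → ℝ) → ℝ} (hg : IsAffineFun g)
    (u : Fin (n + 1) → Fin n → ℝ) (l : ℕ) :
    g (prefixMean u l) =
      (∑ k : Fin (n + 1), if k.val ≤ min l n then g (u k) else 0) / ((min l n : ℕ) + 1) := by
  obtain ⟨a, c, h⟩ := hg
  have h0 : ((min l n : ℕ) + 1 : ℝ) ≠ 0 := by positivity
  rw [eq_div_iff h0]
  simp only [h, prefixMean]
  rw [add_mul, Finset.sum_mul]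
  simp_rw [mul_assoc, div_mul_cancel₀ _ h0]
  rw [← Finset.sum_filter, Finset.sum_add_distrib, Finset.sum_const, card_fin_le (min_le_right _ _)]
  simp_rw [← Finset.sum_filter]
  rw [Finset.sum_comm]
  simp_rw [Finset.mul_sum]
  rw [nsmul_eq_mul]
  push_cast
  ring

/-- The affine parametrisation of the simplex spanned by the means. -/
noncomputable def meanMatrix {n : ℕ} (u : Fin (n + 1) → Fin n → ℝ) : Matrix (Fin n) (Fin n) ℝ :=
  fun i l => prefixMean u (l + 1) i - prefixMean u l i

noncomputable def meanMap {n : ℕ} (u : Fin (n + 1) → Fin n → ℝ) (y : Fin n → ℝ) : Fin n → ℝ :=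
  prefixMean u 0 + (meanMatrix u).mulVec y

theorem IsAffineFun.apply_meanMap {n : ℕ} {g : (Fin n → ℝ) → ℝ} (hg : IsAffineFun g)
    (u : Fin (n + 1) → Fin n → ℝ) (y : Fin n → ℝ) :
    g (meanMap u y) = g (prefixMean u 0) +
      ∑ l : Fin n, (g (prefixMean u (l + 1)) - g (prefixMean u l)) * y l := by
  obtain ⟨a, c, h⟩ := hg
  simp only [h, meanMap, meanMatrix, Matrix.mulVec, dotProduct, Pi.add_apply, mul_add,
    Finset.sum_add_distrib, add_assoc, add_right_inj]
  simp_rw [Finset.mul_sum]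
  rw [Finset.sum_comm]
  refine Finset.sum_congr rfl fun l _ => ?_
  rw [add_sub_add_left_eq_sub, ← Finset.sum_sub_distrib, Finset.sum_mul]
  exact Finset.sum_congr rfl fun i _ => by ring

theorem IsAffineFun.meanMap_eq_sum {n : ℕ} {g : (Fin n → ℝ) → ℝ} (hg : IsAffineFun g)
    (u : Fin (n + 1) → Fin n → ℝ) (y : Fin n → ℝ) :
    g (meanMap u y) = ∑ l ∈ Finset.range (n + 1),
      (extendSeq y l - extendSeq y (l + 1)) * g (prefixMean u l) := by
  rw [hg.apply_meanMap]
  set G : ℕ → ℝ := fun l => g (prefixMean u l)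
  have key : ∀ k : ℕ, G 0 + ∑ l ∈ Finset.range k, (G (l + 1) - G l) * extendSeq y (l + 1) =
      ∑ l ∈ Finset.range k, (extendSeq y l - extendSeq y (l + 1)) * G l + extendSeq y k * G k := by
    intro k
    induction k with
    | zero => simp [extendSeq]
    | succ k ih =>
      rw [Finset.sum_range_succ, Finset.sum_range_succ, ← add_assoc, ih]
      ring
  rw [Finset.sum_range_succ, extendSeq_last, sub_zero, ← key n]
  congr 1
  rw [← Fin.sum_univ_eq_sum_range fun l => (G (l + 1) - G l) * extendSeq y (l + 1)]
  exact Finset.sum_congr rfl fun l _ => by rw [extendSeq_succ y l.2]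

theorem IsAffineFun.stair_eq {n : ℕ} {g : (Fin n → ℝ) → ℝ} (hg : IsAffineFun g)
    (u : Fin (n + 1) → Fin n → ℝ) {G : ℕ → ℚ} (hG : ∀ l, (G l : ℝ) = g (prefixMean u l))
    (t : Fin n → ℝ) : g (meanMap u (prefixMap t)) = stair G 0 t := by
  rw [hg.apply_meanMap, stair, Finset.sum_range_succ', add_comm]
  congr 1
  · rw [← Fin.sum_univ_eq_sum_range (fun l => (stairCoeff G 0 (l + 1) : ℝ) *
      ∏ i ∈ window n 0 (0 + (l + 1)), t i) (n - 0)]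
    refine Finset.sum_congr rfl fun l _ => ?_
    rw [← hG, ← hG]
    simp [stairCoeff, prefixMap, prefixProd]
  · simp [stairCoeff, window_self, hG]

theorem stair_zero_eq_prod_mul {n : ℕ} {G : ℕ → ℚ} {e : ℕ} (he : e ≤ n) (hG : ∀ l < e, G l = 0)
    (t : Fin n → ℝ) : stair G 0 t = prefixProd t e * stair G e t := by
  have h0 : ∀ l < e, stairCoeff G 0 l = 0 := fun l hl => by
    cases l with
    | zero => exact hG 0 hl
    | succ l => simp [stairCoeff, hG (l + 1) hl, hG l (by omega)]
  have h1 : ∀ l, stairCoeff G 0 (e + l) = stairCoeff G e l := fun l => by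
    cases l with
    | zero =>
      cases e with
      | zero => rfl
      | succ e => simp [stairCoeff, hG e (by omega)]
    | succ l => simp [stairCoeff, ← add_assoc]
  rw [stair, stair, show n - 0 + 1 = e + (n - e + 1) by omega, Finset.sum_range_add,
    Finset.sum_eq_zero fun l hl => by rw [h0 l (Finset.mem_range.1 hl)]; simp, zero_add,
    Finset.mul_sum]
  refine Finset.sum_congr rfl fun l _ => ?_
  have hw : window n 0 (0 + (e + l)) = window n 0 e ∪ window n e (e + l) := by
    ext i
    simp only [mem_window, Finset.mem_union]
    omega
  rw [h1, hw, Finset.prod_union, prefixProd]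
  · ring
  · rw [Finset.disjoint_left]
    intro i
    simp only [mem_window]
    omega

section Chambers

variable {n : ℕ} (b : AffineBasis (Fin (n + 1)) ℝ (Fin n → ℝ)) (σ : Equiv.Perm (Fin (n + 1)))

/-- The barycentric coordinates in the order prescribed by `σ`, continued by zero. -/
noncomputable def coordSeq (k : ℕ) (x : Fin n → ℝ) : ℝ :=
  if h : k < n + 1 then b.coord (σ ⟨k, h⟩) x else 0

/-- The points whose barycentric coordinates are positive and decrease along `σ`. -/
def chamber : Set (Fin n → ℝ) := {x | ∀ k ≤ n, coordSeq b σ (k + 1) x < coordSeq b σ k x}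

theorem coordSeq_meanMap (y : Fin n → ℝ) {k : ℕ} (hk : k ≤ n) :
    coordSeq b σ k (meanMap (b ∘ σ) y) - coordSeq b σ (k + 1) (meanMap (b ∘ σ) y) =
      (extendSeq y k - extendSeq y (k + 1)) / (k + 1) := by
  have key : ∀ k : ℕ, coordSeq b σ k (meanMap (b ∘ σ) y) = ∑ l ∈ Finset.range (n + 1),
      (extendSeq y l - extendSeq y (l + 1)) * (if k ≤ l then 1 / ((l : ℝ) + 1) else 0) := by
    intro k
    by_cases hk : k < n + 1
    · rw [coordSeq, dif_pos hk, (AffineMap.isAffineFun (b.coord (σ ⟨k, hk⟩))).meanMap_eq_sum]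
      refine Finset.sum_congr rfl fun l hl => ?_
      have hl' : min l n = l := min_eq_left (by have := Finset.mem_range.1 hl; omega)
      rw [(AffineMap.isAffineFun (b.coord (σ ⟨k, hk⟩))).apply_prefixMean, hl']
      congr 1
      rw [Finset.sum_eq_single ⟨k, hk⟩]
      · split_ifs <;> simp
      · intro k' _ hk'
        simp [hk'.symm]
      · simp
    · rw [coordSeq, dif_neg hk]
      refine (Finset.sum_eq_zero fun l hl => ?_).symm
      rw [if_neg, mul_zero]
      have := Finset.mem_range.1 hl
      omega
  rw [key, key, ← Finset.sum_sub_distrib, Finset.sum_eq_single k]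
  · simp
    ring
  · intro l _ hl
    rw [← mul_sub]
    have : (k ≤ l ↔ k + 1 ≤ l) := by omega
    simp [this]
  · intro h
    exact absurd (Finset.mem_range.2 (by omega)) h

theorem injective_meanMap : Function.Injective (meanMap (b ∘ σ)) := fun y y' h =>
  extendSeq_injective fun k hk => by
    have h1 := coordSeq_meanMap b σ y hk
    rw [h, coordSeq_meanMap b σ y' hk] at h1
    have h0 : (k + 1 : ℝ) ≠ 0 := by positivity
    field_simp at h1
    exact h1.symm

theorem surjective_meanMap : Function.Surjective (meanMap (b ∘ σ)) := by
  have hinj : Function.Injective (Matrix.toLin' (meanMatrix (b ∘ σ))) := fun y y' h =>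
    injective_meanMap b σ (by simpa [meanMap] using h)
  intro x
  obtain ⟨y, hy⟩ := (LinearMap.injective_iff_surjective.1 hinj) (x - prefixMean (b ∘ σ) 0)
  refine ⟨y, ?_⟩
  rw [Matrix.toLin'_apply] at hy
  rw [meanMap, hy, add_sub_cancel]

theorem meanMap_mem_chamber {y : Fin n → ℝ} :
    meanMap (b ∘ σ) y ∈ chamber b σ ↔ y ∈ orderSimplex n := by
  refine forall₂_congr fun k hk => ?_
  rw [← sub_pos, coordSeq_meanMap b σ y hk, div_pos_iff_of_pos_right (by positivity), sub_pos]

theorem image_chamber :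
    (fun t => meanMap (b ∘ σ) (prefixMap t)) '' (Set.univ.pi fun _ : Fin n => Set.Ioo (0 : ℝ) 1) =
      chamber b σ := by
  rw [← Set.image_image, image_prefixMap]
  ext x
  constructor
  · rintro ⟨y, hy, rfl⟩
    exact (meanMap_mem_chamber b σ).2 hy
  · intro hx
    obtain ⟨y, rfl⟩ := surjective_meanMap b σ x
    exact ⟨y, (meanMap_mem_chamber b σ).1 hx, rfl⟩

theorem isOpen_chamber : IsOpen (chamber b σ) := by
  have hcont : ∀ k, Continuous (coordSeq b σ k) := fun k => by
    by_cases hk : k < n + 1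
    · have : coordSeq b σ k = b.coord (σ ⟨k, hk⟩) := funext fun _ => dif_pos hk
      rw [this]
      exact AffineMap.continuous_of_finiteDimensional _
    · have : coordSeq b σ k = fun _ => 0 := funext fun _ => dif_neg hk
      rw [this]
      exact continuous_const
  have : chamber b σ = ⋂ k : Fin (n + 1), {x | coordSeq b σ (k + 1) x < coordSeq b σ k x} := by
    ext x
    simp only [chamber, Set.mem_ofPred_eq, Set.mem_iInter]
    exact ⟨fun h k => h k (by omega), fun h k hk => h ⟨k, by omega⟩⟩
  rw [this]
  exact isOpen_iInter_of_finite fun k => isOpen_lt (hcont _) (hcont _)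

theorem integral_chamber (f : (Fin n → ℝ) → ℂ) :
    ∫ x in chamber b σ, f x = (|(meanMatrix (b ∘ σ)).det| : ℝ) *
      ∫ t, (∏ i, (t i : ℂ) ^ (n - 1 - i.val)) * f (meanMap (b ∘ σ) (prefixMap t)) ∂cubeMeasure n := by
  have hmeas : MeasurableSet (Set.univ.pi fun _ : Fin n => Set.Ioo (0 : ℝ) 1) :=
    MeasurableSet.univ_pi fun _ => measurableSet_Ioo
  rw [← image_chamber]
  have hderiv : ∀ t : Fin n → ℝ, HasFDerivAt (fun t => meanMap (b ∘ σ) (prefixMap t))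
      (LinearMap.toContinuousLinearMap (Matrix.toLin' (meanMatrix (b ∘ σ) * prefixJacobian t))) t := by
    intro t
    have h1 := ((LinearMap.toContinuousLinearMap (Matrix.toLin' (meanMatrix (b ∘ σ)))).hasFDerivAt
      (x := prefixMap t)).comp t (hasFDerivAt_prefixMap t)
    refine (h1.const_add (prefixMean (b ∘ σ) 0)).congr_fderiv ?_
    ext x : 1
    simp [Matrix.mulVec_mulVec]
  rw [integral_image_eq_integral_abs_det_fderiv_smul volume hmeas
    (fun t _ => (hderiv t).hasFDerivWithinAt)
    ((injective_meanMap b σ).comp_injOn (injOn_prefixMap n)), ← cubeMeasure_eq_restrict,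
    ← integral_const_mul]
  refine integral_congr_ae ?_
  filter_upwards [ae_mem_cube n] with t ht
  have : (LinearMap.toContinuousLinearMap
      (Matrix.toLin' (meanMatrix (b ∘ σ) * prefixJacobian t))).det =
      (meanMatrix (b ∘ σ)).det * ∏ i, t i ^ (n - 1 - i.val) := by
    rw [← det_prefixJacobian, ← Matrix.det_mul, ← LinearMap.det_toLin', ContinuousLinearMap.det]
    rfl
  rw [this, abs_mul, abs_of_nonneg (a := ∏ i, t i ^ (n - 1 - i.val))
    (Finset.prod_nonneg fun i _ => pow_nonneg (ht i).1.le _), real_smul]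
  push_cast
  ring

theorem chamber_disjoint {σ τ : Equiv.Perm (Fin (n + 1))} (h : σ ≠ τ) :
    Disjoint (chamber b σ) (chamber b τ) := by
  rw [Set.disjoint_left]
  intro x hσ hτ
  have anti : ∀ σ : Equiv.Perm (Fin (n + 1)), x ∈ chamber b σ →
      StrictMono fun k => -b.coord (σ k) x := fun σ hσ => by
    refine Fin.strictMono_iff_lt_succ.2 fun k => ?_
    have h1 := hσ k (by omega)
    rw [coordSeq, dif_pos (by omega), coordSeq, dif_pos (by omega)] at h1
    exact neg_lt_neg h1
  have hs := anti σ hσ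
  have ht := anti τ hτ
  have heq := (hs.range_inj ht).1 (by
    rw [show (fun k => -b.coord (σ k) x) = (fun k => -b.coord k x) ∘ σ from rfl,
      show (fun k => -b.coord (τ k) x) = (fun k => -b.coord k x) ∘ τ from rfl,
      σ.surjective.range_comp, τ.surjective.range_comp])
  refine h (Equiv.ext fun k => ?_)
  have h1 := congrFun heq k
  have h2 : -b.coord (σ (σ.symm (τ k))) x = -b.coord (σ k) x := by
    rw [Equiv.apply_symm_apply]
    exact h1.symm
  have h3 := hs.injective h2
  rw [← h3, Equiv.apply_symm_apply, h3]

theorem chamber_subset : chamber b σ ⊆ convexHull ℝ (Set.range b) := by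
  intro x hx
  rw [AffineBasis.convexHull_eq_nonneg_coord]
  have h : ∀ k ≤ n + 1, 0 ≤ coordSeq b σ k x := by
    intro k hk
    induction hk using Nat.decreasingInduction with
    | of_succ k hk ih => exact ih.trans (hx k (by omega)).le
    | self => simp [coordSeq]
  intro i
  have h1 := h (σ.symm i) (by omega)
  rw [coordSeq, dif_pos (σ.symm i).2] at h1
  simpa using h1

theorem volume_affine_eq_zero {f : (Fin n → ℝ) →ᵃ[ℝ] ℝ} {p : Fin n → ℝ} (hp : f p ≠ 0) :
    volume {x | f x = 0} = 0 := by
  have h := Measure.addHaar_affineSubspace (volume : Measure (Fin n → ℝ))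
    ((AffineSubspace.mk' (0 : ℝ) ⊥).comap f) (fun h => hp ?_)
  · convert h using 2
    ext x
    simp [AffineSubspace.mem_mk']
  · have : p ∈ (AffineSubspace.mk' (0 : ℝ) ⊥).comap f := h ▸ AffineSubspace.mem_top ℝ _ p
    simpa [AffineSubspace.mem_comap, AffineSubspace.mem_mk'] using this

theorem convexHull_ae_eq :
    (convexHull ℝ (Set.range b) : Set (Fin n → ℝ)) =ᵐ[volume] ⋃ σ, chamber b σ := by
  have h0 : ∀ᵐ x : Fin n → ℝ, ∀ i, b.coord i x ≠ 0 := by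
    rw [ae_all_iff]
    intro i
    exact measure_eq_zero_iff_ae_notMem.1 (volume_affine_eq_zero (p := b i) (by simp))
  have h1 : ∀ᵐ x : Fin n → ℝ, ∀ i j, i ≠ j → b.coord i x ≠ b.coord j x := by
    rw [ae_all_iff]
    intro i
    rw [ae_all_iff]
    intro j
    by_cases hij : i = j
    · simp [hij]
    · have := measure_eq_zero_iff_ae_notMem.1
        (volume_affine_eq_zero (f := b.coord i - b.coord j) (p := b i) (by simp [Ne.symm hij]))
      filter_upwards [this] with x hx _ h
      exact hx (by simp [h])
  filter_upwards [h0, h1] with x hx0 hx1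
  refine propext ⟨fun hx => ?_, fun hx => ?_⟩
  · rw [AffineBasis.convexHull_eq_nonneg_coord] at hx
    have hpos : ∀ i, 0 < b.coord i x := fun i => (hx i).lt_of_ne (hx0 i).symm
    refine Set.mem_iUnion.2 ⟨Tuple.sort fun i => -b.coord i x, fun k hk => ?_⟩
    set σ := Tuple.sort fun i => -b.coord i x with hσ
    by_cases hk' : k + 1 < n + 1
    · rw [coordSeq, dif_pos hk', coordSeq, dif_pos (by omega)]
      have h2 := Tuple.monotone_sort (fun i => -b.coord i x)
        (show (⟨k, by omega⟩ : Fin (n + 1)) ≤ ⟨k + 1, hk'⟩ from Nat.le_succ k)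
      refine lt_of_le_of_ne (neg_le_neg_iff.1 h2) (hx1 _ _ fun h => ?_)
      have := σ.injective h
      simp at this
    · rw [coordSeq, dif_neg hk', coordSeq, dif_pos (by omega)]
      exact hpos _
  · obtain ⟨σ, hσ⟩ := Set.mem_iUnion.1 hx
    exact chamber_subset b σ hσ

theorem integral_convexHull {f : (Fin n → ℝ) → ℂ}
    (hf : IntegrableOn f (convexHull ℝ (Set.range b))) :
    ∫ x in convexHull ℝ (Set.range b), f x = ∑ σ : Equiv.Perm (Fin (n + 1)),
      (|(meanMatrix (b ∘ σ)).det| : ℝ) * ∫ t, (∏ i, (t i : ℂ) ^ (n - 1 - i.val)) *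
        f (meanMap (b ∘ σ) (prefixMap t)) ∂cubeMeasure n := by
  rw [setIntegral_congr_set (convexHull_ae_eq b), integral_iUnion_fintype
    (fun σ => (isOpen_chamber b σ).measurableSet) (fun σ τ h => chamber_disjoint b h)
    (fun σ => hf.mono_set (chamber_subset b σ))]
  exact Finset.sum_congr rfl fun σ _ => integral_chamber b σ f

end Chambers

theorem AffineIndependent.exists_affineBasis {n : ℕ} {v : Fin (n + 1) → Fin n → ℝ}
    (hv : AffineIndependent ℝ v) : ∃ b : AffineBasis (Fin (n + 1)) ℝ (Fin n → ℝ), ⇑b = v :=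
  ⟨⟨v, hv, by rw [hv.affineSpan_eq_top_iff_card_eq_finrank_add_one]; simp⟩, rfl⟩

theorem MeromorphicOn.eventuallyEq_of_isPreconnected {f g : ℂ → ℂ} {U : Set ℂ}
    (hf : ∀ z ∈ U, MeromorphicAt f z) (hg : ∀ z ∈ U, MeromorphicAt g z) (hU : IsPreconnected U)
    {x z : ℂ} (hx : x ∈ U) (hz : z ∈ U) (h : f =ᶠ[nhdsWithin x {x}ᶜ] g) :
    f =ᶠ[nhdsWithin z {z}ᶜ] g := by
  have hfg : MeromorphicOn (f - g) U := fun y hy => (hf y hy).sub (hg y hy)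
  by_contra hne
  have h1 : meromorphicOrderAt (f - g) z ≠ ⊤ := fun htop => hne (by
    filter_upwards [meromorphicOrderAt_eq_top_iff.1 htop] with y hy
    exact sub_eq_zero.1 hy)
  refine hfg.meromorphicOrderAt_ne_top_of_isPreconnected hU hz hx h1 ?_
  rw [meromorphicOrderAt_eq_top_iff]
  filter_upwards [h] with y hy
  exact sub_eq_zero.2 hy

theorem eventuallyEq_of_eqOn_re_gt {f g S : ℂ → ℂ} {R : ℝ}
    (hf : ∀ z : ℂ, R < z.re → MeromorphicAt f z) (hg : ∀ z : ℂ, R < z.re → MeromorphicAt g z)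
    (hfS : ∀ s : ℂ, 1 < s.re → f s = S s) (hgS : ∀ s : ℂ, 1 < s.re → g s = S s) {z : ℂ}
    (hz : R < z.re) : f =ᶠ[nhdsWithin z {z}ᶜ] g := by
  have hx : R < (((max R 1 + 1 : ℝ) : ℂ)).re := by
    rw [ofReal_re]
    linarith [le_max_left R 1]
  refine MeromorphicOn.eventuallyEq_of_isPreconnected (U := {z : ℂ | R < z.re}) hf hg
    (convex_halfSpace_re_gt R).isPreconnected (x := ((max R 1 + 1 : ℝ) : ℂ)) hx hz ?_
  refine Filter.Eventually.filter_mono nhdsWithin_le_nhds ?_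
  have : {z : ℂ | 1 < z.re} ∈ nhds (((max R 1 + 1 : ℝ) : ℂ)) :=
    (isOpen_lt continuous_const continuous_re).mem_nhds (by
      show 1 < (((max R 1 + 1 : ℝ) : ℂ)).re
      rw [ofReal_re]
      linarith [le_max_right R 1])
  filter_upwards [this] with s hs
  rw [hfS s hs, hgS s hs]

theorem exists_meromorphic_glue {S : ℂ → ℂ} {K₀ : ℕ} (G : ℕ → ℂ → ℂ)
    (hG : ∀ K, K₀ ≤ K → ∀ z : ℂ, -(K : ℝ) < z.re → MeromorphicAt (G K) z)
    (hGS : ∀ K, K₀ ≤ K → ∀ s : ℂ, 1 < s.re → G K s = S s) :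
    ∃ F : ℂ → ℂ, (∀ z, MeromorphicAt F z) ∧ (∀ s : ℂ, 1 < s.re → F s = S s) ∧
      ∀ K, K₀ ≤ K → ∀ z : ℂ, -(K : ℝ) < z.re → F =ᶠ[nhdsWithin z {z}ᶜ] G K := by
  have hagree : ∀ K K', K₀ ≤ K → K₀ ≤ K' → ∀ z : ℂ, -(K : ℝ) < z.re → -(K' : ℝ) < z.re →
      G K =ᶠ[nhdsWithin z {z}ᶜ] G K' := by
    intro K K' hK hK' z hz hz'
    refine eventuallyEq_of_eqOn_re_gt (R := max (-(K : ℝ)) (-(K' : ℝ))) (S := S) (fun y hy => ?_)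
      (fun y hy => ?_) (hGS K hK) (hGS K' hK') (max_lt hz hz')
    · exact hG K hK y ((le_max_left _ _).trans_lt hy)
    · exact hG K' hK' y ((le_max_right _ _).trans_lt hy)
  set κ : ℂ → ℕ := fun z => K₀ + ⌈-z.re⌉₊ + 1 with hκ
  have hκ1 : ∀ z, -z.re + 1 ≤ κ z := fun z => by
    have := Nat.le_ceil (-z.re)
    have h0 : (0 : ℝ) ≤ K₀ := Nat.cast_nonneg _
    simp only [hκ]
    push_cast
    linarith
  have hκ0 : ∀ z, K₀ ≤ κ z := fun z => by simp only [hκ]; omega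
  have main : ∀ K, K₀ ≤ K → ∀ z : ℂ, -(K : ℝ) < z.re →
      (fun z => G (κ z) z) =ᶠ[nhdsWithin z {z}ᶜ] G K := by
    intro K hK z hz
    have h1 : ∀ᶠ y in nhdsWithin z {z}ᶜ, ∀ K' ∈ Finset.range (κ z + 2), K₀ ≤ K' →
        -(K' : ℝ) < z.re → G K' y = G K y := by
      rw [Finset.eventually_all]
      intro K' _
      by_cases h : K₀ ≤ K' ∧ -(K' : ℝ) < z.re
      · filter_upwards [hagree K' K h.1 hK z h.2 hz] with y hy _ _ using hy
      · exact Eventually.of_forall fun y h0 h1 => absurd ⟨h0, h1⟩ h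
    have h2 : ∀ᶠ y in nhdsWithin z {z}ᶜ, |y.re - z.re| < 1 :=
      Filter.Eventually.filter_mono nhdsWithin_le_nhds
        ((continuous_re.sub continuous_const).abs.continuousAt.eventually
          (gt_mem_nhds (by simp)))
    filter_upwards [h1, h2] with y hy1 hy2
    rw [abs_lt] at hy2
    refine hy1 _ ?_ (hκ0 y) ?_
    · have : ⌈-y.re⌉₊ ≤ ⌈-z.re⌉₊ + 1 := by
        rw [Nat.ceil_le]
        push_cast
        linarith [Nat.le_ceil (-z.re)]
      simp only [hκ, Finset.mem_range]
      omega
    · linarith [hκ1 y]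
  refine ⟨fun z => G (κ z) z, fun z => ?_, fun s hs => hGS _ (hκ0 s) s hs, main⟩
  have hz : -(κ z : ℝ) < z.re := by linarith [hκ1 z]
  exact (hG (κ z) (hκ0 z) z hz).congr (main (κ z) (hκ0 z) z hz).symm

/-- `S` continues meromorphically to `-R < re s` and `(s + m)^n` times the continuation has a limit
at `-m` in the rational span of `X`. -/
def HasLeadingCoeffIn (n m R : ℕ) (X : Set ℂ) (S : ℂ → ℂ) : Prop :=
  ∃ G : ℂ → ℂ, (∀ z : ℂ, -(R : ℝ) < z.re → MeromorphicAt G z) ∧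
    (∀ s : ℂ, 1 < s.re → G s = S s) ∧ ∃ L ∈ Submodule.span ℚ X,
      Tendsto (fun s => (s + (m : ℂ)) ^ n * G s) (nhdsWithin (-(m : ℂ)) {-(m : ℂ)}ᶜ) (nhds L)

namespace HasLeadingCoeffIn

variable {n m R : ℕ} {X : Set ℂ} {S S' : ℂ → ℂ}

theorem congr (h : HasLeadingCoeffIn n m R X S) (hS : ∀ s : ℂ, 1 < s.re → S' s = S s) :
    HasLeadingCoeffIn n m R X S' := by
  obtain ⟨G, hG, hGS, h⟩ := h
  exact ⟨G, hG, fun s hs => (hGS s hs).trans (hS s hs).symm, h⟩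

theorem zero : HasLeadingCoeffIn n m R X (fun _ => 0) :=
  ⟨fun _ => 0, fun _ _ => MeromorphicAt.const 0 _, fun _ _ => rfl, 0, zero_mem _, by simp⟩

theorem add (h : HasLeadingCoeffIn n m R X S) (h' : HasLeadingCoeffIn n m R X S') :
    HasLeadingCoeffIn n m R X (fun s => S s + S' s) := by
  obtain ⟨G, hG, hGS, L, hL, hlim⟩ := h
  obtain ⟨G', hG', hGS', L', hL', hlim'⟩ := h'
  refine ⟨fun s => G s + G' s, fun z hz => (hG z hz).add (hG' z hz),
    fun s hs => by simp only [hGS s hs, hGS' s hs], L + L', add_mem hL hL', ?_⟩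
  simpa [mul_add] using hlim.add hlim'

theorem sum {κ : Type*} (J : Finset κ) {S : κ → ℂ → ℂ}
    (h : ∀ j ∈ J, HasLeadingCoeffIn n m R X (S j)) :
    HasLeadingCoeffIn n m R X (fun s => ∑ j ∈ J, S j s) := by
  classical
  induction J using Finset.induction_on with
  | empty => simpa using zero
  | insert j J hj ih =>
    simp_rw [Finset.sum_insert hj]
    exact (h j (Finset.mem_insert_self _ _)).add
      (ih fun i hi => h i (Finset.mem_insert_of_mem hi))

theorem mul {c : ℂ → ℂ} (h : HasLeadingCoeffIn n m R X S) (hc : ∀ z, MeromorphicAt c z) (q : ℚ)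
    (hq : c (-(m : ℂ)) = q) (hcont : ContinuousAt c (-(m : ℂ))) :
    HasLeadingCoeffIn n m R X (fun s => c s * S s) := by
  obtain ⟨G, hG, hGS, L, hL, hlim⟩ := h
  refine ⟨fun s => c s * G s, fun z hz => (hc z).mul (hG z hz), fun s hs => by simp only [hGS s hs],
    q * L, by rw [← Rat.smul_def]; exact Submodule.smul_mem _ q hL, ?_⟩
  rw [ContinuousAt, hq] at hcont
  refine ((hcont.mono_left nhdsWithin_le_nhds).mul hlim).congr fun s => ?_
  ring

end HasLeadingCoeffIn

theorem stair_add_one {n : ℕ} (G : ℕ → ℚ) (t : Fin n → ℝ) :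
    stair (fun l => G l + 1) 0 t = 1 + stair G 0 t := by
  rw [stair, stair, Finset.sum_range_succ', Finset.sum_range_succ', add_left_comm]
  congr 1
  · refine Finset.sum_congr rfl fun l _ => ?_
    simp [stairCoeff]
  · simp [stairCoeff, window_self]
    ring

theorem exists_factor_decomposition {n m : ℕ} (hm : 0 < m) {i₀ : Fin n} (hi₀ : i₀.val = 0)
    {G : ℕ → ℚ} (hG0 : ∀ l, 0 ≤ G l) (hGpos : ∀ l l', l ≤ l' → 0 < G l → 0 < G l')
    (hGn : ∀ l, n ≤ l → G l = G n) :
    ∃ (b : ℚ) (e : ℕ) (φ ψ : (Fin n → ℝ) → ℂ → ℂ), (G 0 ≠ 0 → b = G 0 ∧ e = 0) ∧ (G 0 = 0 → b = 1) ∧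
      (∀ d, WordMem (-(m : ℂ)) d (hurwitzValues m i₀ b 0) φ) ∧
      (1 ≤ e → ∀ d, WordMem (-(m : ℂ)) d (unitValues i₀ e) ψ) ∧
      ∀ t : Fin n → ℝ, (∀ i, t i ∈ Set.Ioo (0 : ℝ) 1) → stair G 0 t ≤ 1 → ∀ s : ℂ, 1 < s.re →
        hurwitzZeta ((stair G 0 t : ℝ) : UnitAddCircle) (1 - s) =
          (if e = 0 then 0 else ((prefixProd t e : ℝ) : ℂ) ^ (s - 1) * ψ t s) + (-1 / s) * φ t s := by
  have hs1 : ∀ s : ℂ, 1 < s.re → 1 - s ≠ 1 := fun s hs h => by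
    have : s = 0 := by linear_combination -h
    simp [this] at hs
    linarith
  have hdiv : ∀ x s : ℂ, x / (1 - s - 1) = -1 / s * x := fun x s => by
    rw [show 1 - s - 1 = -s by ring, div_neg, neg_div, neg_mul, one_div, div_eq_inv_mul]
  have hIcc : ∀ t : Fin n → ℝ, (∀ i, t i ∈ Set.Ioo (0 : ℝ) 1) → ∀ i, t i ∈ Set.Icc (0 : ℝ) 1 :=
    fun t ht i => Set.Ioo_subset_Icc_self (ht i)
  by_cases h0 : G 0 = 0
  · obtain ⟨φ, hφ, hφm⟩ := exists_hurwitz_factor hi₀ (G := fun l => G l + 1)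
      (fun l => by linarith [hG0 l]) (fun l hl => by rw [hGn l hl])
    simp only [h0, zero_add] at hφm
    by_cases hall : ∀ l, G l = 0
    · refine ⟨1, 0, φ, φ, by simp [h0], fun _ => rfl, fun d => hφm m d hm, by simp,
        fun t ht ht1 s hs => ?_⟩
      have hst : stair G 0 t = 0 := by
        refine Finset.sum_eq_zero fun l _ => ?_
        cases l <;> simp [stairCoeff, hall]
      rw [hφ t (hIcc t ht), stair_add_one, hst, if_pos rfl, hurwitzZeta_zero_eq (hs1 s hs), hdiv,
        add_zero, zero_add]
    · push Not at hall
      have hex : ∃ l, 0 < G l := hall.imp fun l hl => (hG0 l).lt_of_ne hl.symm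
      have he0 : 0 < G (Nat.find hex) := Nat.find_spec hex
      have hlt : ∀ l < Nat.find hex, G l = 0 := fun l hl =>
        le_antisymm (not_lt.1 (Nat.find_min hex hl)) (hG0 l)
      set e := Nat.find hex with he
      have hen : e ≤ n := by
        by_contra h
        rw [hGn e (by omega), hlt n (by omega)] at he0
        exact lt_irrefl _ he0
      have he1 : 1 ≤ e := by
        by_contra h
        rw [show e = 0 by omega, h0] at he0
        exact lt_irrefl _ he0
      obtain ⟨ψ, hψ, hψm⟩ := exists_unit_factor hi₀ hen he1 (fun l hl => hGpos e l hl he0) hGn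
      refine ⟨1, e, φ, ψ, by simp [h0], fun _ => rfl, fun d => hφm m d hm, fun _ d => hψm m d,
        fun t ht ht1 s hs => ?_⟩
      have hP := (prefixProd_pos (fun i => (ht i).1) e).le
      have hq : 0 ≤ stair G e t := by
        simpa using le_stair (c := 0) (fun l _ => hG0 l) (hIcc t ht)
      have hst := stair_zero_eq_prod_mul hen hlt t
      rw [hφ t (hIcc t ht), hψ t (hIcc t ht), stair_add_one, if_neg (by omega),
        ← mul_cpow_ofReal_nonneg hP hq, ← ofReal_mul, ← hst,
        hurwitzZeta_eq_cpow_add ⟨hst ▸ mul_nonneg hP hq, ht1⟩ (by simpa using hs), hdiv, neg_sub]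
  · have hpos : ∀ l, 0 < G l := fun l => hGpos 0 l (Nat.zero_le _) ((hG0 0).lt_of_ne (Ne.symm h0))
    obtain ⟨φ, hφ, hφm⟩ := exists_hurwitz_factor hi₀ hpos hGn
    obtain ⟨c, hc, hcG⟩ := exists_pos_le_of_min (Nat.zero_le n) (fun l _ => hpos l) hGn
    refine ⟨G 0, 0, φ, φ, fun _ => ⟨rfl, rfl⟩, fun h => absurd h h0, fun d => hφm m d hm, by simp,
      fun t ht ht1 s hs => ?_⟩
    have hst : 0 < stair G 0 t :=
      lt_of_lt_of_le (by exact_mod_cast hc) (le_stair hcG (hIcc t ht))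
    rw [hφ t (hIcc t ht), if_pos rfl, hurwitzZeta_eq_of_pos hst ht1 (hs1 s hs), hdiv, zero_add]

theorem count_flatMap_replicate {n : ℕ} (k : Fin n → ℕ) (l : List (Fin n)) (hl : l.Nodup) (j : Fin n) :
    (l.flatMap fun i => List.replicate (k i) i).count j = if j ∈ l then k j else 0 := by
  induction l with
  | nil => simp
  | cons i l ih =>
    rw [List.nodup_cons] at hl
    rw [List.flatMap_cons, List.count_append, ih hl.2, List.count_replicate]
    by_cases hij : i = j
    · subst hij
      simp [hl.1]
    · simp [hij, Ne.symm hij]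

/-- The products `ζ(w₁, t₁) ⋯ ζ(w_l, t_l)` of total weight `(m + 1) N - n` with `1 ≤ l ≤ N - n`. -/
def zetaProducts (n N m : ℕ) (T : Set ℝ) : Set ℂ :=
  {z : ℂ | ∃ (l : ℕ) (w : Fin l → ℕ) (t : Fin l → ℝ),
    1 ≤ l ∧ l ≤ N - n ∧ (∀ j, m + 1 ≤ w j) ∧ (∑ j, w j) = (m + 1) * N - n ∧
    (∀ j, t j ∈ T) ∧
    z = ∏ j, ∑' a : ℕ, 1 / (((a : ℕ) : ℂ) + (t j : ℝ)) ^ (w j)}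

/-- The number of factors in `J` divisible by the coordinate `i`. -/
def exponentCount {n N : ℕ} (e : Fin N → ℕ) (J : Finset (Fin N)) (i : Fin n) : ℕ :=
  (J.filter fun j => i.val < e j).card

theorem mem_zetaProducts_of_mul {n N m : ℕ} {i₀ : Fin n} (hi₀ : i₀.val = 0)
    {b : Fin N → ℚ} {e : Fin N → ℕ} {J : Finset (Fin N)} (hJ : ∀ j ∈ J, 1 ≤ e j)
    (hJ' : ∃ j, j ∉ J) {T : Set ℝ} (hT : ∀ j, (b j : ℝ) ∈ T)
    (hA : ∀ i : Fin n, 1 ≤ exponentCount e J i)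
    {α : Fin N → Multiset (Fin n)} {ζ : Fin N → ℂ}
    (hα : ∀ j ∈ J, ζ j ∈ unitValues i₀ (e j) (α j))
    (hβ : ∀ j ∈ Jᶜ, ζ j ∈ hurwitzValues m i₀ (b j) 0 (α j))
    (hcount : ∀ i : Fin n, (∑ j, (α j).count i : ℤ) =
      exponentCount e J i * (m + 1) - (n - i.val)) :
    ∏ j, ζ j ∈ zetaProducts n N m T := by
  have hstep : ∀ i i' : Fin n, i'.val = i.val + 1 → exponentCount e J i' < exponentCount e J i := by
    intro i i' hi
    have hsub : (J.filter fun j => i'.val < e j) ⊆ J.filter fun j => i.val < e j := fun j hj => by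
      rw [Finset.mem_filter] at hj ⊢
      exact ⟨hj.1, by omega⟩
    by_contra hlt
    have hEq := Finset.eq_of_subset_of_card_le hsub (not_lt.1 hlt)
    have hne : ∀ j ∈ J, i'.val ≠ e j := fun j hj hij => by
      have h1 : j ∈ J.filter fun j => i.val < e j := Finset.mem_filter.2 ⟨hj, by omega⟩
      rw [← hEq, Finset.mem_filter] at h1
      omega
    have hle : ∑ j, ((α j).count i' : ℤ) ≤ ∑ j, ((α j).count i : ℤ) := by
      refine Finset.sum_le_sum fun j _ => ?_
      rw [Nat.cast_le]
      by_cases hj : j ∈ J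
      · exact (hα j hj).2.2 i i' hi (hne j hj)
      · exact (hβ j (Finset.mem_compl.2 hj)).2 i i' hi (by omega)
    have hA' : exponentCount e J i' = exponentCount e J i := by
      rw [exponentCount, exponentCount, hEq]
    rw [hcount, hcount, hA', hi] at hle
    push_cast at hle
    omega
  have hge : ∀ d : ℕ, ∀ i : Fin n, i.val + d + 1 = n → d + 1 ≤ exponentCount e J i := by
    intro d
    induction d with
    | zero => exact fun i _ => hA i
    | succ d ih =>
      intro i hi
      have h1 := ih ⟨i.val + 1, by omega⟩ (by simp only; omega)
      have h2 := hstep i ⟨i.val + 1, by omega⟩ rfl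
      omega
  have hcardJ : exponentCount e J i₀ = J.card := by
    rw [exponentCount, Finset.filter_true_of_mem]
    intro j hj
    have := hJ j hj
    omega
  have hnJ : n ≤ J.card := by
    have := hge (n - 1) i₀ (by have := i₀.2; omega)
    omega
  have hcompl : Jᶜ.card = N - J.card := by rw [Finset.card_compl, Fintype.card_fin]
  have hJN : J.card ≤ N := by simpa using J.card_le_univ
  have hJc : 1 ≤ Jᶜ.card := by
    obtain ⟨j, hj⟩ := hJ'
    exact Finset.card_pos.2 ⟨j, Finset.mem_compl.2 hj⟩
  set E : Fin Jᶜ.card ≃ {j // j ∈ Jᶜ} := (Jᶜ.equivFinOfCardEq rfl).symm with hE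
  have hsum : ∑ j ∈ Jᶜ, (α j).count i₀ + n = J.card * (m + 1) := by
    have h1 := hcount i₀
    rw [← Finset.sum_add_sum_compl J, Finset.sum_eq_zero fun j hj => by rw [(hα j hj).2.1]; rfl,
      zero_add, hcardJ, hi₀] at h1
    zify
    rw [h1]
    push_cast
    ring
  refine ⟨Jᶜ.card, fun k => m + 1 + 0 + (α (E k)).count i₀, fun k => b (E k), hJc, by omega,
    fun k => Nat.le_add_right _ _, ?_, fun k => hT _, ?_⟩
  · rw [Equiv.sum_comp E fun j : {j // j ∈ Jᶜ} => m + 1 + 0 + (α j).count i₀,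
      Finset.sum_coe_sort Jᶜ fun j => m + 1 + 0 + (α j).count i₀, Finset.sum_add_distrib,
      Finset.sum_const, hcompl, smul_eq_mul]
    obtain ⟨p, hp⟩ := Nat.exists_eq_add_of_le hJN
    have hmul : (m + 1) * N = (N - J.card) * (m + 1 + 0) + J.card * (m + 1) := by
      have hNJ : N - J.card = p := by omega
      rw [hNJ]
      calc (m + 1) * N = (m + 1) * (J.card + p) := by rw [← hp]
        _ = _ := by ring
    omega
  · rw [Equiv.prod_comp E fun j : {j // j ∈ Jᶜ} => ∑' a : ℕ, 1 / ((a : ℂ) + ((b j : ℝ) : ℂ)) ^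
        (m + 1 + 0 + (α j).count i₀),
      Finset.prod_coe_sort Jᶜ fun j => ∑' a : ℕ, 1 / ((a : ℂ) + ((b j : ℝ) : ℂ)) ^
        (m + 1 + 0 + (α j).count i₀), ← Finset.prod_mul_prod_compl J,
      Finset.prod_eq_one fun j hj => (hα j hj).1, one_mul]
    exact Finset.prod_congr rfl fun j hj => (hβ j hj).1

theorem tendsto_pow_mul_of_lt {k n m : ℕ} (hkn : k < n) {G : ℂ → ℂ} {L : ℂ}
    (h : Tendsto (fun s => (s + (m : ℂ)) ^ k * G s) (nhdsWithin (-(m : ℂ)) {-(m : ℂ)}ᶜ) (nhds L)) :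
    Tendsto (fun s => (s + (m : ℂ)) ^ n * G s) (nhdsWithin (-(m : ℂ)) {-(m : ℂ)}ᶜ) (nhds 0) := by
  have h1 : Tendsto (fun s : ℂ => (s + (m : ℂ)) ^ (n - k)) (nhdsWithin (-(m : ℂ)) {-(m : ℂ)}ᶜ)
      (nhds 0) := by
    have : ContinuousAt (fun s : ℂ => (s + (m : ℂ)) ^ (n - k)) (-(m : ℂ)) := by fun_prop
    have h2 := this.tendsto.mono_left (nhdsWithin_le_nhds (s := {-(m : ℂ)}ᶜ))
    simpa [(Nat.sub_pos_of_lt hkn).ne'] using h2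
  have h2 := h1.mul h
  rw [zero_mul] at h2
  refine h2.congr fun s => ?_
  rw [← mul_assoc, ← pow_add, Nat.sub_add_cancel hkn.le]

theorem HasLeadingCoeffIn.monomialIntegral_prod {n N m R : ℕ} (hmR : m < R) {i₀ : Fin n}
    (hi₀ : i₀.val = 0) {b : Fin N → ℚ} {e : Fin N → ℕ} {J : Finset (Fin N)}
    (hJ : ∀ j ∈ J, 1 ≤ e j) (hJ' : ∃ j, j ∉ J) {T : Set ℝ} (hT : ∀ j, (b j : ℝ) ∈ T)
    {F : Fin N → (Fin n → ℝ) → ℂ → ℂ}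
    (hF : ∀ j ∈ J, ∀ d, WordMem (-(m : ℂ)) d (unitValues i₀ (e j)) (F j))
    (hF' : ∀ j ∉ J, ∀ d, WordMem (-(m : ℂ)) d (hurwitzValues m i₀ (b j) 0) (F j)) :
    HasLeadingCoeffIn n m R (zetaProducts n N m T) fun s =>
      monomialIntegral (fun i => (exponentCount e J i : ℂ) * s +
        (((n - 1 - i.val : ℕ) - exponentCount e J i : ℤ) : ℂ)) fun t => ∏ j, F j t s := by
  set A : Fin n → ℕ := exponentCount e J with hA
  set B : Fin n → ℤ := fun i => (n - 1 - i.val : ℕ) - A i with hB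
  have hmem : ∀ d, WordMem (-(m : ℂ)) d _ (fun t s => ∏ j, F j t s) := fun d =>
    WordMem.prod (X := fun j => if j ∈ J then unitValues i₀ (e j) else hurwitzValues m i₀ (b j) 0)
      Finset.univ fun j _ => by
        by_cases hj : j ∈ J
        · simpa only [if_pos hj] using hF j hj d
        · simpa only [if_neg hj] using hF' j hj d
  have hAB : ∀ i, 0 ≤ (A i : ℤ) + B i := fun i => by simp only [hB]; omega
  by_cases hall : ∀ i, 1 ≤ A i
  · obtain ⟨G, L, hG, hGS, hlim, hL⟩ := monomialContinuation hmR (List.finRange n)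
      (List.nodup_finRange n) A B _ (hmem 0).1 (fun i _ => hall i) hAB
      (fun i hi => absurd (List.mem_finRange i) hi)
    rw [List.length_finRange] at hlim
    refine ⟨G, hG, hGS, L, ?_, hlim⟩
    obtain ⟨hL0, q, hq⟩ := hL (fun i hi => absurd (List.mem_finRange i) hi)
      (fun t t' h => by rw [show t = t' from funext fun i => h i (List.mem_finRange i)])
    by_cases hneg : ∃ i ∈ List.finRange n, (A i * m - B i - 1 : ℤ) < 0
    · rw [hL0 hneg]
      exact zero_mem _
    · push Not at hneg
      rw [hq, ← Rat.smul_def]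
      refine Submodule.smul_mem _ q (Submodule.span_mono ?_ ((hmem _).2 _ le_rfl))
      rintro z ⟨α, ζ, hα, hζ, rfl⟩
      refine mem_zetaProducts_of_mul hi₀ hJ hJ' hT hall (α := α) ?_ ?_ ?_
      · intro j hj
        simpa only [if_pos hj] using hζ j (Finset.mem_univ j)
      · intro j hj
        simpa only [if_neg (Finset.mem_compl.1 hj)] using hζ j (Finset.mem_univ j)
      · intro i
        have h1 := congrArg (Multiset.count i) hα
        rw [Multiset.count_sum', Multiset.coe_count, residueWord,
          count_flatMap_replicate _ _ (List.nodup_finRange n), if_pos (List.mem_finRange i)] at h1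
        have h2 := hneg i (List.mem_finRange i)
        rw [← Nat.cast_sum, h1, Int.toNat_of_nonneg h2]
        have h3 : ((n - 1 - i.val : ℕ) : ℤ) = n - 1 - i.val := by have := i.2; omega
        simp only [hB, h3]
        ring
  · push Not at hall
    obtain ⟨i₁, hi₁⟩ := hall
    obtain ⟨G, L, hG, hGS, hlim, -⟩ := monomialContinuation hmR
      ((List.finRange n).filter fun i => 1 ≤ A i) ((List.nodup_finRange n).filter _) A B _ (hmem 0).1
      (fun i hi => by simpa using (List.mem_filter.1 hi).2) hAB
      (fun i hi => by
        have : A i = 0 := by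
          by_contra h
          exact hi (List.mem_filter.2 ⟨List.mem_finRange i, decide_eq_true (Nat.pos_of_ne_zero h)⟩)
        simp [hB, this])
    have hlt : ((List.finRange n).filter fun i => 1 ≤ A i).length < n := by
      conv_rhs => rw [← List.length_finRange (n := n)]
      rw [List.length_filter_lt_length_iff_exists]
      exact ⟨i₁, List.mem_finRange _, by simpa using hi₁⟩
    exact ⟨G, hG, hGS, 0, zero_mem _, tendsto_pow_mul_of_lt hlt hlim⟩

theorem ofReal_prod_cpow {κ : Type*} (S : Finset κ) {x : κ → ℝ} (hx : ∀ i ∈ S, 0 ≤ x i) (w : ℂ) :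
    ((∏ i ∈ S, x i : ℝ) : ℂ) ^ w = ∏ i ∈ S, (x i : ℂ) ^ w := by
  classical
  induction S using Finset.induction_on with
  | empty => simp
  | insert i S hi ih =>
    rw [Finset.prod_insert hi, Finset.prod_insert hi, ofReal_mul,
      mul_cpow_ofReal_nonneg (hx i (Finset.mem_insert_self _ _))
        (Finset.prod_nonneg fun k hk => hx k (Finset.mem_insert_of_mem hk)),
      ih fun k hk => hx k (Finset.mem_insert_of_mem hk)]

theorem prod_pow_mul_prod_prefixProd_cpow {n N : ℕ} (e : Fin N → ℕ) (J : Finset (Fin N))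
    {t : Fin n → ℝ} (ht : ∀ i, 0 < t i) (s : ℂ) :
    (∏ i, (t i : ℂ) ^ (n - 1 - i.val)) * ∏ j ∈ J, ((prefixProd t (e j) : ℝ) : ℂ) ^ (s - 1) =
      ∏ i, (t i : ℂ) ^ ((exponentCount e J i : ℂ) * s +
        (((n - 1 - i.val : ℕ) - exponentCount e J i : ℤ) : ℂ)) := by
  have h1 : ∀ j ∈ J, ((prefixProd t (e j) : ℝ) : ℂ) ^ (s - 1) =
      ∏ i : Fin n, if i.val < e j then (t i : ℂ) ^ (s - 1) else 1 := fun j _ => by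
    rw [prefixProd, ofReal_prod_cpow _ (fun i _ => (ht i).le), window, Finset.prod_filter]
    simp
  rw [Finset.prod_congr rfl h1, Finset.prod_comm, ← Finset.prod_mul_distrib]
  refine Finset.prod_congr rfl fun i _ => ?_
  have h0 : (t i : ℂ) ≠ 0 := ofReal_ne_zero.2 (ht i).ne'
  rw [← Finset.prod_filter, Finset.prod_const, ← cpow_nat_mul, ← cpow_natCast, ← cpow_add _ _ h0]
  congr 1
  rw [exponentCount]
  push_cast
  ring

theorem HasLeadingCoeffIn.integral_prod_hurwitzZeta_stair {n N m R : ℕ} (hn : 1 ≤ n) (hm : 0 < m)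
    (hmR : m < R) {G : Fin N → ℕ → ℚ} (hG0 : ∀ j l, 0 ≤ G j l)
    (hGpos : ∀ j l l', l ≤ l' → 0 < G j l → 0 < G j l') (hGn : ∀ j l, n ≤ l → G j l = G j n)
    (hle : ∀ (j : Fin N) (t : Fin n → ℝ), (∀ i, t i ∈ Set.Ioo (0 : ℝ) 1) → stair (G j) 0 t ≤ 1)
    (hne : ∃ j, G j 0 ≠ 0) {T : Set ℝ} (h1T : 1 ∈ T) (hT : ∀ j, G j 0 ≠ 0 → (G j 0 : ℝ) ∈ T) :
    HasLeadingCoeffIn n m R (zetaProducts n N m T) fun s =>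
      ∫ t, (∏ i : Fin n, (t i : ℂ) ^ (n - 1 - i.val)) *
        ∏ j, hurwitzZeta ((stair (G j) 0 t : ℝ) : UnitAddCircle) (1 - s) ∂cubeMeasure n := by
  have hi₀ : (⟨0, hn⟩ : Fin n).val = 0 := rfl
  choose b e φ ψ hb hb1 hφ hψ hfac using fun j =>
    exists_factor_decomposition hm hi₀ (hG0 j) (hGpos j) (hGn j)
  have hbT : ∀ j, (b j : ℝ) ∈ T := fun j => by
    by_cases h : G j 0 = 0
    · simpa [hb1 j h] using h1T
    · simpa [(hb j h).1] using hT j h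
  set I : Finset (Fin N) → ℂ → (Fin n → ℝ) → ℂ := fun J s t =>
    (∏ i, (t i : ℂ) ^ ((exponentCount e J i : ℂ) * s +
      (((n - 1 - i.val : ℕ) - exponentCount e J i : ℤ) : ℂ))) *
        ∏ j, (if j ∈ J then ψ j else φ j) t s with hI
  have hterm : ∀ J : Finset (Fin N), (∀ j ∈ J, 1 ≤ e j) →
      HasLeadingCoeffIn n m R (zetaProducts n N m T)
        fun s => (-1 / s) ^ (Finset.univ \ J).card * ∫ t, I J s t ∂cubeMeasure n := fun J hJ => by
    have hJ' : ∃ j, j ∉ J := hne.imp fun j hj h => by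
      have := hJ j h
      rw [(hb j hj).2] at this
      omega
    have h := HasLeadingCoeffIn.monomialIntegral_prod (F := fun j => if j ∈ J then ψ j else φ j) hmR hi₀
      hJ hJ' hbT (fun j hj => by simpa only [if_pos hj] using hψ j (hJ j hj))
      (fun j hj => by simpa only [if_neg hj] using hφ j)
    refine h.mul (c := fun s => (-1 / s) ^ (Finset.univ \ J).card) (fun z => by fun_prop)
      ((1 / m) ^ (Finset.univ \ J).card) (by simp) ?_
    have : -(m : ℂ) ≠ 0 := by simpa using hm.ne'
    fun_prop (disch := assumption)
  refine (HasLeadingCoeffIn.sum (Finset.univ.powerset)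
    (S := fun J s => if ∀ j ∈ J, 1 ≤ e j then
      (-1 / s) ^ (Finset.univ \ J).card * ∫ t, I J s t ∂cubeMeasure n else 0) fun J _ => ?_).congr
    fun s hs => ?_
  · by_cases hJ : ∀ j ∈ J, 1 ≤ e j
    · simpa only [if_pos hJ] using hterm J hJ
    · simpa only [if_neg hJ] using HasLeadingCoeffIn.zero
  · have hint : ∀ J ∈ (Finset.univ : Finset (Fin N)).powerset, Integrable (fun t =>
        if ∀ j ∈ J, 1 ≤ e j then (-1 / s) ^ (Finset.univ \ J).card * I J s t else 0)
        (cubeMeasure n) := fun J _ => by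
      by_cases hJ : ∀ j ∈ J, 1 ≤ e j
      · simp only [if_pos hJ]
        refine (integrable_monomial (fun i => ?_) ?_).const_mul _
        · have h1 : (0 : ℝ) ≤ exponentCount e J i * (s.re - 1) :=
            mul_nonneg (Nat.cast_nonneg _) (by linarith)
          have h2 : (0 : ℝ) ≤ (n - 1 - i.val : ℕ) := Nat.cast_nonneg _
          simp
          linarith
        · refine continuous_finsetProd _ fun j _ => ?_
          by_cases hj : j ∈ J
          · simp only [if_pos hj]
            exact ((hψ j (hJ j hj) 0).1 0).cont.comp (continuous_id.prodMk continuous_const)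
          · simp only [if_neg hj]
            exact ((hφ j 0).1 0).cont.comp (continuous_id.prodMk continuous_const)
      · simp only [if_neg hJ]
        exact integrable_zero _ _ _
    have hae : ∀ᵐ t ∂cubeMeasure n, (∏ i : Fin n, (t i : ℂ) ^ (n - 1 - i.val)) *
        ∏ j, hurwitzZeta ((stair (G j) 0 t : ℝ) : UnitAddCircle) (1 - s) =
        ∑ J ∈ Finset.univ.powerset,
          if ∀ j ∈ J, 1 ≤ e j then (-1 / s) ^ (Finset.univ \ J).card * I J s t else 0 := by
      filter_upwards [ae_mem_cube n] with t ht
      rw [Finset.prod_congr rfl fun j _ => hfac j t ht (hle j t ht) s hs, Finset.prod_add,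
        Finset.mul_sum]
      refine Finset.sum_congr rfl fun J _ => ?_
      by_cases hJ : ∀ j ∈ J, 1 ≤ e j
      · have hunit : ∏ j ∈ J, (if e j = 0 then 0 else ((prefixProd t (e j) : ℝ) : ℂ) ^ (s - 1) * ψ j t s)
            = (∏ j ∈ J, ((prefixProd t (e j) : ℝ) : ℂ) ^ (s - 1)) * ∏ j ∈ J, ψ j t s := by
          rw [← Finset.prod_mul_distrib]
          exact Finset.prod_congr rfl fun j hj => if_neg (by have := hJ j hj; omega)
        have hsplit : ∏ j, (if j ∈ J then ψ j else φ j) t s =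
            (∏ j ∈ Finset.univ \ J, φ j t s) * ∏ j ∈ J, ψ j t s := by
          rw [← Finset.prod_sdiff (Finset.subset_univ J)]
          congr 1
          · exact Finset.prod_congr rfl fun j hj => by rw [if_neg (Finset.mem_sdiff.1 hj).2]
          · exact Finset.prod_congr rfl fun j hj => by rw [if_pos hj]
        rw [if_pos hJ, hI, hunit, Finset.prod_mul_distrib, Finset.prod_const]
        simp only
        rw [hsplit, ← prod_pow_mul_prod_prefixProd_cpow e J (fun i => (ht i).1) s]
        ring
      · rw [if_neg hJ]
        push Not at hJ
        obtain ⟨j, hj, hej⟩ := hJ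
        have h0 : ∏ j ∈ J,
            (if e j = 0 then 0 else ((prefixProd t (e j) : ℝ) : ℂ) ^ (s - 1) * ψ j t s) = 0 :=
          Finset.prod_eq_zero hj (if_pos (by omega))
        rw [h0, zero_mul, mul_zero]
    rw [integral_congr_ae hae, integral_finsetSum _ hint]
    refine Finset.sum_congr rfl fun J _ => ?_
    by_cases hJ : ∀ j ∈ J, 1 ≤ e j
    · simp only [if_pos hJ, integral_const_mul]
    · simp only [if_neg hJ, integral_zero]

theorem continuousOn_hurwitzZeta_comp {X : Type*} [TopologicalSpace X] {g : X → ℝ} (hg : Continuous g)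
    {V : Set X} (hV : ∀ x ∈ V, g x ∈ Set.Icc (0 : ℝ) 1) {w : ℂ} (hw : w.re < 0) :
    ContinuousOn (fun x => hurwitzZeta ((g x : ℝ) : UnitAddCircle) w) V := by
  refine ContinuousOn.congr ?_ fun x hx => hurwitzZeta_eq_cpow_add (hV x hx) hw
  refine ((continuous_ofReal_cpow_const (by simpa using hw)).comp hg).continuousOn.add
    (ContinuousOn.div_const ?_ _)
  exact continuousOn_hurwitzEntire.comp (f := fun x => (w, 1 + g x)) (by fun_prop)
    fun x hx => ⟨Set.mem_univ _, by have := (hV x hx).1; simp only [Set.mem_Ioi]; linarith⟩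

/-- Averages of the first `min l n + 1` terms of `c`. -/
def prefixAverage {n : ℕ} (c : Fin (n + 1) → ℚ) (l : ℕ) : ℚ :=
  (∑ k : Fin (n + 1), if k.val ≤ min l n then c k else 0) / ((min l n : ℕ) + 1)

theorem prefixAverage_zero {n : ℕ} (c : Fin (n + 1) → ℚ) : prefixAverage c 0 = c 0 := by
  rw [prefixAverage, Finset.sum_eq_single 0]
  · simp
  · intro k _ hk
    rw [if_neg]
    have := Fin.val_ne_zero_iff.2 hk
    omega
  · simp

theorem prefixAverage_nonneg {n : ℕ} {c : Fin (n + 1) → ℚ} (hc : ∀ k, 0 ≤ c k) (l : ℕ) :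
    0 ≤ prefixAverage c l := by
  refine div_nonneg (Finset.sum_nonneg fun k _ => ?_) (by positivity)
  split_ifs
  exacts [hc k, le_rfl]

theorem prefixAverage_pos_of_le {n : ℕ} {c : Fin (n + 1) → ℚ} (hc : ∀ k, 0 ≤ c k) {l l' : ℕ}
    (hl : l ≤ l') (h : 0 < prefixAverage c l) : 0 < prefixAverage c l' := by
  have hd : ∀ l : ℕ, (0 : ℚ) < (min l n : ℕ) + 1 := fun l => by positivity
  rw [prefixAverage, div_pos_iff_of_pos_right (hd _)] at h ⊢
  refine h.trans_le (Finset.sum_le_sum fun k _ => ?_)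
  by_cases hk : k.val ≤ min l n
  · rw [if_pos hk, if_pos (by omega)]
  · rw [if_neg hk]
    split_ifs
    exacts [hc k, le_rfl]

theorem prefixAverage_of_le {n : ℕ} (c : Fin (n + 1) → ℚ) {l : ℕ} (hl : n ≤ l) :
    prefixAverage c l = prefixAverage c n := by
  rw [prefixAverage, prefixAverage, min_eq_right hl, min_self]

theorem IsAffineFun.cast_prefixAverage {n : ℕ} {g : (Fin n → ℝ) → ℝ} (hg : IsAffineFun g)
    {u : Fin (n + 1) → Fin n → ℝ} {c : Fin (n + 1) → ℚ} (hc : ∀ k, g (u k) = c k) (l : ℕ) :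
    (prefixAverage c l : ℝ) = g (prefixMean u l) := by
  rw [hg.apply_prefixMean, prefixAverage]
  simp only [hc]
  push_cast [apply_ite (Rat.cast : ℚ → ℝ)]
  rfl

theorem exists_rat_det_meanMatrix {n : ℕ} {u : Fin (n + 1) → Fin n → ℝ}
    (hu : ∀ k i, ∃ q : ℚ, u k i = q) : ∃ q : ℚ, (meanMatrix u).det = q := by
  choose c hc using hu
  refine ⟨(Matrix.of fun i l : Fin n => prefixAverage (fun k => c k i) (l + 1) -
    prefixAverage (fun k => c k i) l).det, ?_⟩
  rw [← Rat.coe_castHom, RingHom.map_det]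
  congr 1
  ext i l
  have h : IsAffineFun fun x : Fin n → ℝ => x i :=
    ⟨Pi.single i 1, 0, fun x => by simp [Pi.single_apply]⟩
  simp [meanMatrix, h.cast_prefixAverage (u := u) fun k => hc k i]

theorem HasLeadingCoeffIn.integral_convexHull_prod_hurwitzZeta {n N m R : ℕ} (hn : 1 ≤ n) (hm : 0 < m)
    (hmR : m < R) (b : AffineBasis (Fin (n + 1)) ℝ (Fin n → ℝ)) (hb : ∀ k i, ∃ q : ℚ, b k i = q)
    {g : Fin N → (Fin n → ℝ) → ℝ} (hg : ∀ j, IsAffineFun (g j)) (hgb : ∀ j k, ∃ q : ℚ, g j (b k) = q)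
    (hg01 : ∀ j, ∀ x ∈ convexHull ℝ (Set.range b), g j x ∈ Set.Icc (0 : ℝ) 1)
    (hne : ∀ k, ∃ j, g j (b k) ≠ 0) {T : Set ℝ} (h1T : 1 ∈ T)
    (hT : ∀ j k, g j (b k) ≠ 0 → g j (b k) ∈ T) :
    HasLeadingCoeffIn n m R (zetaProducts n N m T) fun s =>
      ∫ x in convexHull ℝ (Set.range b), ∏ j, hurwitzZeta ((g j x : ℝ) : UnitAddCircle) (1 - s) := by
  choose c hc using hgb
  have hc0 : ∀ j k, 0 ≤ c j k := fun j k => by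
    have := (hg01 j (b k) (subset_convexHull ℝ _ (Set.mem_range_self k))).1
    rw [hc] at this
    exact_mod_cast this
  have hcont : ∀ j, Continuous (g j) := fun j => by
    obtain ⟨a, c, h⟩ := hg j
    rw [funext h]
    fun_prop
  have hchamber : ∀ σ : Equiv.Perm (Fin (n + 1)), HasLeadingCoeffIn n m R (zetaProducts n N m T)
      fun s => (|(meanMatrix (b ∘ σ)).det| : ℝ) * ∫ t, (∏ i, (t i : ℂ) ^ (n - 1 - i.val)) *
        ∏ j, hurwitzZeta ((g j (meanMap (b ∘ σ) (prefixMap t)) : ℝ) : UnitAddCircle) (1 - s)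
          ∂cubeMeasure n := fun σ => by
    have hG : ∀ j l, ((prefixAverage (c j ∘ σ) l : ℚ) : ℝ) = g j (prefixMean (b ∘ σ) l) := fun j =>
      (hg j).cast_prefixAverage fun k => hc j (σ k)
    have hst := fun j => (hg j).stair_eq (b ∘ σ) (hG j)
    have hz : ∀ j, prefixAverage (c j ∘ σ) 0 = c j (σ 0) := fun j => prefixAverage_zero _
    obtain ⟨q, hq⟩ := exists_rat_det_meanMatrix (u := b ∘ σ) fun k i => hb (σ k) i
    have h := HasLeadingCoeffIn.integral_prod_hurwitzZeta_stair (R := R)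
      (G := fun j => prefixAverage (c j ∘ σ)) (T := T) hn hm hmR
      (fun j => prefixAverage_nonneg fun k => hc0 j (σ k))
      (fun j l l' hl => prefixAverage_pos_of_le (fun k => hc0 j (σ k)) hl)
      (fun j l hl => prefixAverage_of_le _ hl)
      (fun j t ht => by
        rw [← hst]
        refine (hg01 j _ (chamber_subset b σ ?_)).2
        rw [← image_chamber]
        exact ⟨t, fun i _ => ht i, rfl⟩)
      ((hne (σ 0)).imp fun j hj => by
        rw [hc, Rat.cast_ne_zero] at hj
        rwa [hz]) h1T
      (fun j hj => by
        rw [hz] at hj ⊢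
        rw [← hc]
        exact hT j _ (by rwa [hc, Rat.cast_ne_zero]))
    simp only [hst]
    exact h.mul (fun z => MeromorphicAt.const _ z) |q| (by rw [hq]; norm_cast) continuousAt_const
  refine (HasLeadingCoeffIn.sum Finset.univ fun σ _ => hchamber σ).congr fun s hs => ?_
  refine integral_convexHull b (f := fun x => ∏ j, hurwitzZeta ((g j x : ℝ) : UnitAddCircle) (1 - s)) ?_
  refine ContinuousOn.integrableOn_compact ((Set.finite_range b).isCompact_convexHull ℝ) ?_
  exact continuousOn_finsetProd _ fun j _ =>
    continuousOn_hurwitzZeta_comp (hcont j) (hg01 j) (by simpa using hs)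

theorem exists_meromorphic_of_hasLeadingCoeffIn {n m : ℕ} {X : Set ℂ} {S : ℂ → ℂ}
    (h : ∀ R, m < R → HasLeadingCoeffIn n m R X S) :
    ∃ F : ℂ → ℂ, (∀ z, MeromorphicAt F z) ∧ (∀ s : ℂ, 1 < s.re → F s = S s) ∧
      ∃ L ∈ Submodule.span ℚ X,
        Tendsto (fun s => (s + (m : ℂ)) ^ n * F s) (nhdsWithin (-(m : ℂ)) {-(m : ℂ)}ᶜ) (nhds L) := by
  choose! G hG hGS L hL hlim using h
  obtain ⟨F, hF, hFS, hFG⟩ := exists_meromorphic_glue (K₀ := m + 1) G hG hGS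
  refine ⟨F, hF, hFS, L (m + 1), hL _ (Nat.lt_succ_self m), ?_⟩
  refine (hlim _ (Nat.lt_succ_self m)).congr' ?_
  filter_upwards [hFG (m + 1) le_rfl (-(m : ℂ)) (by simp)] with s hs
  rw [hs]

/-- Arithmetic nature of the leading Laurent coefficient at `s = -m` of
`∫_V ζ(1-s,g₁(x))⋯ζ(1-s,g_N(x)) dx`: it lies in the `ℚ`-span of products
`ζ(w₁,t₁)⋯ζ(w_l,t_l)` with `1 ≤ l ≤ N-n`, `w_j ≥ m+1`, `Σw_j = (m+1)N-n`, `t_j ∈ T`,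
where `T` is the set of nonzero values of the `g_i` at the vertices of `V`, together with `1`. -/
theorem stmt_13 (n N : ℕ) (hn : 1 ≤ n) (hN : n < N) (m : ℕ) (hm : 0 < m)
    (V : Set (Fin n → ℝ)) (v : Fin (n + 1) → (Fin n → ℝ))
    (hv : AffineIndependent ℝ v) (hV : V = convexHull ℝ (Set.range v))
    (hvQ : ∀ l i, ∃ q : ℚ, v l i = (q : ℝ))
    (g : Fin N → (Fin n → ℝ) → ℝ)
    (hg_aff : ∀ j, ∃ (a : Fin n → ℚ) (c : ℚ),
      g j = fun x => (c : ℝ) + ∑ i, (a i : ℝ) * x i)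
    (hg01 : ∀ j, ∀ x ∈ V, 0 ≤ g j x ∧ g j x ≤ 1)
    (hgv : ∀ l, ∃ j, g j (v l) ≠ 0) :
    ∃ F : ℂ → ℂ,
      (∀ z : ℂ, MeromorphicAt F z) ∧
      (∀ s : ℂ, 1 < s.re →
        F s = ∫ x in V, ∏ j, hurwitzZeta ((g j x : ℝ) : UnitAddCircle) (1 - s)) ∧
      ∃ L ∈ Submodule.span ℚ
          {z : ℂ | ∃ (l : ℕ) (w : Fin l → ℕ) (t : Fin l → ℝ),
            1 ≤ l ∧ l ≤ N - n ∧ (∀ j, m + 1 ≤ w j) ∧ (∑ j, w j) = (m + 1) * N - n ∧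
            (∀ j, t j ∈ (insert (1 : ℝ) {y : ℝ | ∃ i l', y = g i (v l')}) \ {0}) ∧
            z = ∏ j, ∑' a : ℕ, 1 / (((a : ℕ) : ℂ) + (t j : ℝ)) ^ (w j)},
        Tendsto (fun s => (s + (m : ℂ)) ^ n * F s)
          (nhdsWithin (-(m : ℂ)) {-(m : ℂ)}ᶜ) (nhds L) := by
  obtain ⟨b, rfl⟩ := hv.exists_affineBasis
  subst hV
  have haff : ∀ j, IsAffineFun (g j) := fun j => by
    obtain ⟨a, c, h⟩ := hg_aff j
    exact ⟨fun i => a i, c, fun x => by rw [h]⟩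
  have hgb : ∀ j k, ∃ q : ℚ, g j (b k) = q := fun j k => by
    obtain ⟨a, c, h⟩ := hg_aff j
    choose Q hQ using hvQ
    exact ⟨c + ∑ i, a i * Q k i, by simp [h, hQ]⟩
  exact exists_meromorphic_of_hasLeadingCoeffIn fun R hR =>
    HasLeadingCoeffIn.integral_convexHull_prod_hurwitzZeta hn hm hR b hvQ haff hgb hg01 hgv
      ⟨Set.mem_insert _ _, one_ne_zero⟩ fun j k hjk => ⟨Or.inr ⟨j, k, rfl⟩, hjk⟩
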